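/- Let l divide n and let χ be associated to the even nilpotent element of Q(n) all of whose Jordan blocks have size l. Then the associated graded superalgebra of the finite W-algebra W_χ with respect to the Kazhdan filtration is isomorphic to the supersymmetric algebra S(g^χ) of the annihilator g^χ, i.e., to the tensor product of the polynomial algebra on the even part of g^χ (of dimension n²/l) with the exterior algebra on the odd part of g^χ (of dimension n²/l). -/

import Mathlib

noncomputable section
open scoped Classical

/-! # The universal enveloping superalgebra `U(Q(n))` of the queer Lie superalgebra

`U(Q(n))` is presented by even generators `e i j` and odd generators `f i j`
(`1 ≤ i,j ≤ n`) subject to the relations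
`[e i j, e k l] = δ_{jk} e i l - δ_{li} e k j`,
`[e i j, f k l] = δ_{jk} f i l - δ_{li} f k j`,
`f i j * f k l + f k l * f i j = δ_{jk} e i l + δ_{li} e k j`. -/

/-- Generators of `U(Q(n))`: `E i j` (even) and `F i j` (odd). -/
inductive QGen (n : ℕ) : Type
  | E : Fin n → Fin n → QGen n
  | F : Fin n → Fin n → QGen n

/-- Kronecker delta. -/
def kd {n : ℕ} (i j : Fin n) : ℂ := if i = j then 1 else 0

/-- The defining relations of `U(Q(n))`. -/
inductive QRel (n : ℕ) : FreeAlgebra ℂ (QGen n) → FreeAlgebra ℂ (QGen n) → Prop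
  | ee (i j k l : Fin n) : QRel n
      (FreeAlgebra.ι ℂ (QGen.E i j) * FreeAlgebra.ι ℂ (QGen.E k l) -
        FreeAlgebra.ι ℂ (QGen.E k l) * FreeAlgebra.ι ℂ (QGen.E i j))
      (kd j k • FreeAlgebra.ι ℂ (QGen.E i l) - kd l i • FreeAlgebra.ι ℂ (QGen.E k j))
  | ef (i j k l : Fin n) : QRel n
      (FreeAlgebra.ι ℂ (QGen.E i j) * FreeAlgebra.ι ℂ (QGen.F k l) -
        FreeAlgebra.ι ℂ (QGen.F k l) * FreeAlgebra.ι ℂ (QGen.E i j))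
      (kd j k • FreeAlgebra.ι ℂ (QGen.F i l) - kd l i • FreeAlgebra.ι ℂ (QGen.F k j))
  | ff (i j k l : Fin n) : QRel n
      (FreeAlgebra.ι ℂ (QGen.F i j) * FreeAlgebra.ι ℂ (QGen.F k l) +
        FreeAlgebra.ι ℂ (QGen.F k l) * FreeAlgebra.ι ℂ (QGen.F i j))
      (kd j k • FreeAlgebra.ι ℂ (QGen.E i l) + kd l i • FreeAlgebra.ι ℂ (QGen.E k j))

/-- The universal enveloping superalgebra `U(Q(n))`. -/
abbrev UQ (n : ℕ) := RingQuot (QRel n)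

/-- The generator `e i j` of `U(Q(n))`. -/
def Ue {n : ℕ} (i j : Fin n) : UQ n :=
  RingQuot.mkAlgHom ℂ (QRel n) (FreeAlgebra.ι ℂ (QGen.E i j))

/-- The generator `f i j` of `U(Q(n))`. -/
def Uf {n : ℕ} (i j : Fin n) : UQ n :=
  RingQuot.mkAlgHom ℂ (QRel n) (FreeAlgebra.ι ℂ (QGen.F i j))

/-- Sergeev's elements `e_{ij}^{(m)}` and `f_{ij}^{(m)}` of `U(Q(n))`, defined recursively by
`e^{(0)} = δ`, `f^{(0)} = 0`,
`e_{ij}^{(m)} = Σ_k e_{ik} e_{kj}^{(m-1)} + (-1)^{m+1} Σ_k f_{ik} f_{kj}^{(m-1)}`,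
`f_{ij}^{(m)} = Σ_k e_{ik} f_{kj}^{(m-1)} + (-1)^{m+1} Σ_k f_{ik} e_{kj}^{(m-1)}`. -/
def efU (n : ℕ) : ℕ → (Fin n → Fin n → UQ n) × (Fin n → Fin n → UQ n)
  | 0 => (fun i j => algebraMap ℂ (UQ n) (kd i j), fun _ _ => 0)
  | m + 1 =>
      (fun i j => (∑ k, Ue i k * (efU n m).1 k j) +
        (-1 : ℂ) ^ m • ∑ k, Uf i k * (efU n m).2 k j,
       fun i j => (∑ k, Ue i k * (efU n m).2 k j) +
        (-1 : ℂ) ^ m • ∑ k, Uf i k * (efU n m).1 k j)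

/-- `e_{ij}^{(m)}`. -/
def eU {n : ℕ} (m : ℕ) (i j : Fin n) : UQ n := (efU n m).1 i j
/-- `f_{ij}^{(m)}`. -/
def fU {n : ℕ} (m : ℕ) (i j : Fin n) : UQ n := (efU n m).2 i j

/-- For `l ∣ n`, the index `l(p-1)+i` of `{1,…,n}` (0-based: block `p`, position `i`). -/
def bidx {n l : ℕ} (h : l ∣ n) (p : Fin (n / l)) (i : Fin l) : Fin n :=
  ⟨l * p.val + i.val, by
    have h1 : i.val < l := i.isLt
    have h2 : p.val + 1 ≤ n / l := p.isLt
    have h3 : l * (p.val + 1) ≤ l * (n / l) := Nat.mul_le_mul_left l h2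
    have h4 : n / l * l ≤ n := Nat.div_mul_le_self n l
    have h5 : l * (p.val + 1) = l * p.val + l := Nat.mul_succ l p.val
    have h6 : l * (n / l) = n / l * l := Nat.mul_comm l (n / l)
    omega⟩
set_option linter.unusedVariables false

/-! # The character `χ`, the left ideal `I_χ` and the finite W-algebra data

Here `l ∣ n` and `χ` corresponds to the even nilpotent element of `Q(n)` all of whose
Jordan blocks have size `l`.  The subalgebra `m = ⊕_{j<0} g_j` is spanned by the
elements `e_{l(p-1)+i+k, l(q-1)+i}` and `f_{l(p-1)+i+k, l(q-1)+i}` (`k ≥ 1`), and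
`χ(e_{l(p-1)+i+1, l(q-1)+i}) = δ_{pq}` and `χ = 0` on the other basis elements. -/

/-- The set of elements `a - χ(a)` for `a` ranging over the standard basis of `m`;
(rows/columns written 0-based: `a` is the position of the row inside its block `p`,
`b` the position of the column inside its block `q`, with `b < a`). -/
def mSet (n l : ℕ) (h : l ∣ n) : Set (UQ n) :=
  { x : UQ n | ∃ (p q : Fin (n / l)) (a b : Fin l), b.val < a.val ∧
      (x = Ue (bidx h p a) (bidx h q b) -
            algebraMap ℂ (UQ n) (if a.val = b.val + 1 ∧ p = q then 1 else 0) ∨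
       x = Uf (bidx h p a) (bidx h q b)) }

/-- The left ideal `I_χ` of `U(Q(n))` generated by the `a - χ(a)`, `a ∈ m`. -/
def Ichi (n l : ℕ) (h : l ∣ n) : Submodule (UQ n) (UQ n) :=
  Submodule.span (UQ n) (mSet n l h)

/-- The quotient `U(Q(n))/I_χ` (as a `ℂ`-vector space). -/
abbrev Wq (n l : ℕ) (h : l ∣ n) := UQ n ⧸ (Ichi n l h).restrictScalars ℂ

/-- The quotient map `π : U(Q(n)) → U(Q(n))/I_χ`. -/
def piq (n l : ℕ) (h : l ∣ n) : UQ n →ₗ[ℂ] Wq n l h :=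
  ((Ichi n l h).restrictScalars ℂ).mkQ

/-- `y` super-commutes with `m` into `I_χ`:  `[a, y] ∈ I_χ` for every `a` in the standard
basis of `m`.  Here the super-commutator of the odd element `f` with (the possibly
non-homogeneous) `y` is `f * y - σ(y) * f`, where `σ` is the parity involution of
`U(Q(n))` (the algebra automorphism fixing the `e`'s and negating the `f`'s). -/
def Wcond {n l : ℕ} (h : l ∣ n) (σ : UQ n →ₐ[ℂ] UQ n) (y : UQ n) : Prop :=
  ∀ (p q : Fin (n / l)) (a b : Fin l), b.val < a.val →
    (Ue (bidx h p a) (bidx h q b) * y - y * Ue (bidx h p a) (bidx h q b) ∈ Ichi n l h) ∧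
    (Uf (bidx h p a) (bidx h q b) * y - σ y * Uf (bidx h p a) (bidx h q b) ∈ Ichi n l h)

/-- The finite W-algebra `W_χ = {π(y) | [a, y] ∈ I_χ for all a ∈ m}`, as a subset of
`U(Q(n))/I_χ`.  (Its product is `π(y₁)·π(y₂) = π(y₁y₂)`.) -/
def WchiSet (n l : ℕ) (h : l ∣ n) (σ : UQ n →ₐ[ℂ] UQ n) : Set (Wq n l h) :=
  { w : Wq n l h | ∃ y : UQ n, Wcond h σ y ∧ piq n l h y = w }

/-- The standard basis elements of the parabolic subalgebra `p = ⊕_{j≥0} g_j`. -/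
def pSet (n l : ℕ) (h : l ∣ n) : Set (UQ n) :=
  { x : UQ n | ∃ (p q : Fin (n / l)) (a b : Fin l), a.val ≤ b.val ∧
      (x = Ue (bidx h p a) (bidx h q b) ∨ x = Uf (bidx h p a) (bidx h q b)) }

/-- The standard basis elements of the nilradical `n = ⊕_{j>0} g_j` of `p`. -/
def nSet (n l : ℕ) (h : l ∣ n) : Set (UQ n) :=
  { x : UQ n | ∃ (p q : Fin (n / l)) (a b : Fin l), a.val < b.val ∧
      (x = Ue (bidx h p a) (bidx h q b) ∨ x = Uf (bidx h p a) (bidx h q b)) }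

/-- The kernel of the Harish-Chandra projection `ϑ : U(p) → U(g₀)`, realized inside
`U(Q(n))`: the `ℂ`-span of `U(p)·n`.  (By the PBW theorem, `U(g) = U(p) ⊕ I_χ` and
`U(p) = U(g₀) ⊕ U(p)n`, so for `y ∈ U(g)`, `ϑ(pr(y)) = t` iff
`y - t ∈ I_χ + U(p)n`.) -/
def Lspan (n l : ℕ) (h : l ∣ n) : Submodule ℂ (UQ n) :=
  Submodule.span ℂ
    { x : UQ n | ∃ u ∈ Algebra.adjoin ℂ (pSet n l h), ∃ g ∈ nSet n l h, x = u * g }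

/-- A descriptor of a generator of `U(p)`:  `(b, p, q, a, c)` is
`e_{l(p-1)+(a+1), l(q-1)+(c+1)}` if `b = false` and `f_{…}` if `b = true`
(required: `a ≤ c`). -/
def pgElem {n l : ℕ} (h : l ∣ n) :
    Bool × Fin (n / l) × Fin (n / l) × Fin l × Fin l → UQ n
  | (b, p, q, a, c) => (if b then Uf else Ue) (bidx h p a) (bidx h q c)

/-- Kazhdan degree `2k+2` of a `p`-generator of block offset `k = c - a`. -/
def pgDeg {l m : ℕ} (d : Bool × Fin m × Fin m × Fin l × Fin l) : ℕ :=
  2 * (d.2.2.2.2.val - d.2.2.2.1.val) + 2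

/-- Weight `2k` of a `p`-generator of block offset `k = c - a`. -/
def pgWt {l m : ℕ} (d : Bool × Fin m × Fin m × Fin l × Fin l) : ℕ :=
  2 * (d.2.2.2.2.val - d.2.2.2.1.val)

/-- Monomials in the generators of `U(p)` which are "lower" than bidegree
(Kazhdan degree `D`, weight `W`): either of Kazhdan degree `< D`, or of Kazhdan
degree `≤ D` and weight `< W`. -/
def LowSet (n l : ℕ) (h : l ∣ n) (D W : ℕ) : Set (UQ n) :=
  { x : UQ n | ∃ L : List (Bool × Fin (n / l) × Fin (n / l) × Fin l × Fin l),
      (∀ d ∈ L, d.2.2.2.1.val ≤ d.2.2.2.2.val) ∧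
      x = (L.map (pgElem h)).prod ∧
      ((L.map pgDeg).sum < D ∨ ((L.map pgDeg).sum ≤ D ∧ (L.map pgWt).sum < W)) }

/-- The span of the "lower" monomials. -/
def LowSpan (n l : ℕ) (h : l ∣ n) (D W : ℕ) : Submodule ℂ (UQ n) :=
  Submodule.span ℂ (LowSet n l h D W)

/-! # The super tensor power `U(Q(m))^{⊗l}`

Modeled as the superalgebra with generators `x^i_{pq} = 1^{⊗(l-i)} ⊗ e_{pq} ⊗ 1^{⊗(i-1)}`
(even) and `ξ^i_{pq} = 1^{⊗(l-i)} ⊗ f_{pq} ⊗ 1^{⊗(i-1)}` (odd), subject to the `U(Q(m))`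
relations in each tensor slot and to (super-)commutation between different slots. -/

/-- Generators of `U(Q(m))^{⊗l}`: `X i p q` is `x^i_{pq}` and `Xi i p q` is `ξ^i_{pq}`
(`i : Fin l` is the 0-based tensor slot, counted from the right). -/
inductive TGen (m l : ℕ) : Type
  | X : Fin l → Fin m → Fin m → TGen m l
  | Xi : Fin l → Fin m → Fin m → TGen m l

/-- Kronecker delta on slots. -/
def kdl {l : ℕ} (i j : Fin l) : ℂ := if i = j then 1 else 0

/-- The defining relations of `U(Q(m))^{⊗l}`. -/
inductive TRel (m l : ℕ) : FreeAlgebra ℂ (TGen m l) → FreeAlgebra ℂ (TGen m l) → Prop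
  | xx (i i' : Fin l) (p q r s : Fin m) : TRel m l
      (FreeAlgebra.ι ℂ (TGen.X i p q) * FreeAlgebra.ι ℂ (TGen.X i' r s) -
        FreeAlgebra.ι ℂ (TGen.X i' r s) * FreeAlgebra.ι ℂ (TGen.X i p q))
      ((kdl i i' * kd q r) • FreeAlgebra.ι ℂ (TGen.X i p s) -
        (kdl i i' * kd s p) • FreeAlgebra.ι ℂ (TGen.X i' r q))
  | xxi (i i' : Fin l) (p q r s : Fin m) : TRel m l
      (FreeAlgebra.ι ℂ (TGen.X i p q) * FreeAlgebra.ι ℂ (TGen.Xi i' r s) -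
        FreeAlgebra.ι ℂ (TGen.Xi i' r s) * FreeAlgebra.ι ℂ (TGen.X i p q))
      ((kdl i i' * kd q r) • FreeAlgebra.ι ℂ (TGen.Xi i p s) -
        (kdl i i' * kd s p) • FreeAlgebra.ι ℂ (TGen.Xi i' r q))
  | xixi (i i' : Fin l) (p q r s : Fin m) : TRel m l
      (FreeAlgebra.ι ℂ (TGen.Xi i p q) * FreeAlgebra.ι ℂ (TGen.Xi i' r s) +
        FreeAlgebra.ι ℂ (TGen.Xi i' r s) * FreeAlgebra.ι ℂ (TGen.Xi i p q))
      ((kdl i i' * kd q r) • FreeAlgebra.ι ℂ (TGen.X i p s) +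
        (kdl i i' * kd s p) • FreeAlgebra.ι ℂ (TGen.X i' r q))

/-- The superalgebra `U(Q(m))^{⊗l}`. -/
abbrev TQ (m l : ℕ) := RingQuot (TRel m l)

/-- `x^i_{pq} := 1^{⊗(l-i)} ⊗ e_{pq} ⊗ 1^{⊗(i-1)} ∈ U(Q(m))^{⊗l}`. -/
def xT {m l : ℕ} (i : Fin l) (p q : Fin m) : TQ m l :=
  RingQuot.mkAlgHom ℂ (TRel m l) (FreeAlgebra.ι ℂ (TGen.X i p q))

/-- `ξ^i_{pq} := 1^{⊗(l-i)} ⊗ f_{pq} ⊗ 1^{⊗(i-1)} ∈ U(Q(m))^{⊗l}`. -/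
def xiT {m l : ℕ} (i : Fin l) (p q : Fin m) : TQ m l :=
  RingQuot.mkAlgHom ℂ (TRel m l) (FreeAlgebra.ι ℂ (TGen.Xi i p q))

/-! # The super-Yangian `Y(Q(n))` -/

/-- The index set `{±1, …, ±n}`:  `(false, a)` is the positive index `a` (even),
`(true, a)` is the negative index `-a` (odd). -/
abbrev QIdx (n : ℕ) := Bool × Fin n

/-- Negation `i ↦ -i` on indices. -/
def qneg {n : ℕ} (i : QIdx n) : QIdx n := (!i.1, i.2)

/-- The parity `p(i)`: `0` for positive `i`, `1` for negative `i`. -/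
def qpar {n : ℕ} (i : QIdx n) : ℕ := if i.1 then 1 else 0

/-- Kronecker delta on `{±1, …, ±n}`. -/
def kdq {n : ℕ} (i j : QIdx n) : ℂ := if i = j then 1 else 0

/-- Generators of `Y(Q(n))`: `T m i j` encodes `T^{(m+1)}_{i,j}`. -/
inductive YGen (n : ℕ) : Type
  | T : ℕ → QIdx n → QIdx n → YGen n

/-- `T^{(m)}_{i,j}` in the free algebra, with `T^{(0)}_{i,j} = δ_{ij}`. -/
def Tf {n : ℕ} : ℕ → QIdx n → QIdx n → FreeAlgebra ℂ (YGen n)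
  | 0, i, j => algebraMap ℂ _ (kdq i j)
  | m + 1, i, j => FreeAlgebra.ι ℂ (YGen.T m i j)

/-- The super-commutator `[T^{(a)}_{i,j}, T^{(b)}_{k,l}]` in the free algebra. -/
def ybr {n : ℕ} (a : ℕ) (i j : QIdx n) (b : ℕ) (k l : QIdx n) :
    FreeAlgebra ℂ (YGen n) :=
  Tf a i j * Tf b k l -
    ((-1 : ℂ) ^ ((qpar i + qpar j) * (qpar k + qpar l))) • (Tf b k l * Tf a i j)

/-- The defining relations of the super-Yangian `Y(Q(n))`: for `M, R ≥ 1`,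
`(-1)^{p(i)p(k)+p(i)p(l)+p(k)p(l)} ([T^{(M+1)}_{ij}, T^{(R-1)}_{kl}] - [T^{(M-1)}_{ij}, T^{(R+1)}_{kl}])
 = T^{(M)}_{kj}T^{(R-1)}_{il} + T^{(M-1)}_{kj}T^{(R)}_{il} - T^{(R-1)}_{kj}T^{(M)}_{il}
   - T^{(R)}_{kj}T^{(M-1)}_{il}
   + (-1)^{p(k)+p(l)} (-T^{(M)}_{-k,j}T^{(R-1)}_{-i,l} + T^{(M-1)}_{-k,j}T^{(R)}_{-i,l}
       + T^{(R-1)}_{k,-j}T^{(M)}_{i,-l} - T^{(R)}_{k,-j}T^{(M-1)}_{i,-l})`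
(here `M = m+1`, `R = r+1`), together with `T^{(m)}_{-i,-j} = (-1)^m T^{(m)}_{i,j}`. -/
inductive YRel (n : ℕ) : FreeAlgebra ℂ (YGen n) → FreeAlgebra ℂ (YGen n) → Prop
  | quad (m r : ℕ) (i j k l : QIdx n) : YRel n
      (((-1 : ℂ) ^ (qpar i * qpar k + qpar i * qpar l + qpar k * qpar l)) •
        (ybr (m + 2) i j r k l - ybr m i j (r + 2) k l))
      (Tf (m + 1) k j * Tf r i l + Tf m k j * Tf (r + 1) i l -
        Tf r k j * Tf (m + 1) i l - Tf (r + 1) k j * Tf m i l +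
        ((-1 : ℂ) ^ (qpar k + qpar l)) •
          (-(Tf (m + 1) (qneg k) j * Tf r (qneg i) l) +
            Tf m (qneg k) j * Tf (r + 1) (qneg i) l +
            Tf r k (qneg j) * Tf (m + 1) i (qneg l) -
            Tf (r + 1) k (qneg j) * Tf m i (qneg l)))
  | par (m : ℕ) (i j : QIdx n) : YRel n
      (Tf (m + 1) (qneg i) (qneg j)) (((-1 : ℂ) ^ (m + 1)) • Tf (m + 1) i j)

/-- The super-Yangian `Y(Q(n))`. -/
abbrev YQ (n : ℕ) := RingQuot (YRel n)

/-- The generator `T^{(m)}_{i,j}` of `Y(Q(n))` (with `T^{(0)}_{i,j} = δ_{ij}`). -/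
def TY {n : ℕ} (m : ℕ) (i j : QIdx n) : YQ n :=
  RingQuot.mkAlgHom ℂ (YRel n) (Tf m i j)

/-! # Values of the homomorphisms `U`, `ev`, `ēv` on the generators of `Y(Q(n))`,
and the explicit sums appearing in the main theorems. -/

/-- The value of the homomorphism `U : Y(Q(n)) → U(Q(n))` on the generator
`T^{(r)}_{i,j}`:  `U(T^{(r)}_{i,j}) = (-1)^r e^{(r)}_{j,i}`,
`U(T^{(r)}_{-i,j}) = (-1)^r f^{(r)}_{j,i}` for `i, j > 0`, and the values on the other
generators are forced by `T^{(r)}_{-i,-j} = (-1)^r T^{(r)}_{i,j}`. -/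
def Uval {n : ℕ} (r : ℕ) (i j : QIdx n) : UQ n :=
  (if j.1 then (-1 : ℂ) ^ r else 1) •
    ((-1 : ℂ) ^ r • (if xor i.1 j.1 then fU r j.2 i.2 else eU r j.2 i.2))

/-- The value of the evaluation homomorphism `ev : Y(Q(n)) → U(Q(n))` on `T^{(r)}_{i,j}`:
`ev(T^{(1)}_{i,j}) = -e_{j,i}`, `ev(T^{(1)}_{-i,j}) = -f_{j,i}` for `i, j > 0`,
`ev(T^{(0)}_{i,j}) = δ_{ij}` and `ev(T^{(r)}_{i,j}) = 0` for `r > 1` (with the values on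
the remaining generators forced by `T^{(r)}_{-i,-j} = (-1)^r T^{(r)}_{i,j}`). -/
def evval {n : ℕ} (r : ℕ) (i j : QIdx n) : UQ n :=
  (if j.1 then (-1 : ℂ) ^ r else 1) •
    (match r with
      | 0 => if xor i.1 j.1 then 0 else algebraMap ℂ (UQ n) (kd i.2 j.2)
      | 1 => -(if xor i.1 j.1 then Uf j.2 i.2 else Ue j.2 i.2)
      | _ + 2 => 0)

/-- The value of `ēv = α ∘ ev : Y(Q(n)) → U(Q(n))` on `T^{(r)}_{i,j}`, where `α` is the
principal anti-automorphism of `U(Q(n))`:  `ēv(T^{(1)}_{i,j}) = e_{j,i}`,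
`ēv(T^{(1)}_{-i,j}) = f_{j,i}` for `i, j > 0`, `ēv(T^{(0)}_{i,j}) = δ_{ij}`,
`ēv(T^{(r)}_{i,j}) = 0` for `r > 1`. -/
def bevval {n : ℕ} (r : ℕ) (i j : QIdx n) : UQ n :=
  (if j.1 then (-1 : ℂ) ^ r else 1) •
    (match r with
      | 0 => if xor i.1 j.1 then 0 else algebraMap ℂ (UQ n) (kd i.2 j.2)
      | 1 => (if xor i.1 j.1 then Uf j.2 i.2 else Ue j.2 i.2)
      | _ + 2 => 0)

/-- The sum `Σ_{p_1,…,p_{r-1}} Σ_{l ≥ i_1 ≥ i_2 ≥ … ≥ i_r ≥ 1}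
Π_{a=1}^r (x^{i_a}_{p_{a-1},p_a} + (-1)^{r-a} ξ^{i_a}_{p_{a-1},p_a})`
(with `p_0 = p`, `p_r = q`), an element of `U(Q(m))^{⊗l}`. -/
def chainProdDec (m l : ℕ) (r : ℕ) (p q : Fin m) : TQ m l :=
  ∑ c : Fin (r + 1) → Fin m, ∑ iv : Fin r → Fin l,
    (if c 0 = p ∧ c (Fin.last r) = q ∧ (∀ a b : Fin r, a ≤ b → iv b ≤ iv a)
      then (1 : ℂ) else 0) •
      (List.ofFn fun a : Fin r =>
        xT (iv a) (c a.castSucc) (c a.succ) +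
          ((-1 : ℂ) ^ (r - 1 - a.val)) • xiT (iv a) (c a.castSucc) (c a.succ)).prod

/-- The sum `Σ_{p_1,…,p_{r-1}} Σ_{1 ≤ i_1 < i_2 < … < i_r ≤ l}
Π_{a=1}^r (x^{i_a}_{p_{a-1},p_a} + (-1)^{r-a} ξ^{i_a}_{p_{a-1},p_a})`
(with `p_0 = p`, `p_r = q`), an element of `U(Q(m))^{⊗l}`. -/
def chainProdInc (m l : ℕ) (r : ℕ) (p q : Fin m) : TQ m l :=
  ∑ c : Fin (r + 1) → Fin m, ∑ iv : Fin r → Fin l,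
    (if c 0 = p ∧ c (Fin.last r) = q ∧ (∀ a b : Fin r, a < b → iv a < iv b)
      then (1 : ℂ) else 0) •
      (List.ofFn fun a : Fin r =>
        xT (iv a) (c a.castSucc) (c a.succ) +
          ((-1 : ℂ) ^ (r - 1 - a.val)) • xiT (iv a) (c a.castSucc) (c a.succ)).prod

/-- The elements `z^{(r)}_{±q,p}` of `U(Q(m))^{⊗l}`:  the even (`sgn = false`,
giving `z^{(r)}_{q,p}`) resp. odd (`sgn = true`, giving `z^{(r)}_{-q,p}`) component of
`chainProdDec`, computed using the parity involution `σT` of `U(Q(m))^{⊗l}`;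
`z^{(0)}_{q,p} = δ_{qp}`, `z^{(0)}_{-q,p} = 0`. -/
def zDec {m l : ℕ} (σT : TQ m l →ₐ[ℂ] TQ m l) :
    ℕ → Bool → Fin m → Fin m → TQ m l
  | 0, sgn, q, p => if sgn then 0 else algebraMap ℂ (TQ m l) (kd q p)
  | r + 1, sgn, q, p =>
      (2⁻¹ : ℂ) • (chainProdDec m l (r + 1) p q +
        (if sgn then (-1 : ℂ) else 1) • σT (chainProdDec m l (r + 1) p q))

/-- The elements `z̃^{(r)}_{±q,p}` of `U(Q(m))^{⊗l}` (as `zDec`, with increasing chains). -/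
def zInc {m l : ℕ} (σT : TQ m l →ₐ[ℂ] TQ m l) :
    ℕ → Bool → Fin m → Fin m → TQ m l
  | 0, sgn, q, p => if sgn then 0 else algebraMap ℂ (TQ m l) (kd q p)
  | r + 1, sgn, q, p =>
      (2⁻¹ : ℂ) • (chainProdInc m l (r + 1) p q +
        (if sgn then (-1 : ℂ) else 1) • σT (chainProdInc m l (r + 1) p q))

/-- The explicit formula for the antipode value `S(T^{(r)}_{i,j})` (`r ≥ 1`):
`S(T^{(r)}_{i,j}) = Σ_{m=1}^{r} (-1)^m Σ_{i_1,…,i_{m-1}} Σ_{r_1+⋯+r_m=r, r_a>0}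
(-1)^{ν(i,i_1,…,i_{m-1},j)} T^{(r_1)}_{i,i_1} ⋯ T^{(r_m)}_{i_{m-1},j}` where
`ν(i_0,…,i_m) = Σ_{0≤k<s≤m-1} (p(i_k)+p(i_{k+1}))(p(i_s)+p(i_{s+1}))`. -/
def STval {n : ℕ} (r : ℕ) (i j : QIdx n) : YQ n :=
  ∑ m : Fin r,
    ((-1 : ℂ) ^ (m.val + 1)) •
      ∑ ch : Fin (m.val + 2) → QIdx n, ∑ c : Fin (m.val + 1) → Fin (r + 1),
        (if ch 0 = i ∧ ch (Fin.last (m.val + 1)) = j ∧ (∀ a, 1 ≤ (c a).val) ∧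
              (∑ a, (c a).val) = r
          then ((-1 : ℂ) ^ (∑ a : Fin (m.val + 1), ∑ b : Fin (m.val + 1),
              if a < b then
                (qpar (ch a.castSucc) + qpar (ch a.succ)) *
                  (qpar (ch b.castSucc) + qpar (ch b.succ))
              else 0))
          else 0) •
        (List.ofFn fun a : Fin (m.val + 1) =>
          TY (c a).val (ch a.castSucc) (ch a.succ)).prod

/-! # The Kazhdan filtration and the supersymmetric algebra `S(g^χ)` (for Statement 8). -/

/-- The generator `e_{ij}` (if `b = false`) or `f_{ij}` (if `b = true`) of `U(Q(n))`. -/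
def agElem {n : ℕ} : Bool × Fin n × Fin n → UQ n
  | (b, i, j) => (if b then Uf else Ue) i j

/-- The Kazhdan degree of the generator `e_{ij}`/`f_{ij}`: it lies in `g_{2k}` where
`k = (j-1) mod l - (i-1) mod l` is its offset, and its Kazhdan degree is `2k+2`. -/
def agDeg (l : ℕ) {n : ℕ} (g : Bool × Fin n × Fin n) : ℤ :=
  2 * (((g.2.2.val % l : ℕ) : ℤ) - ((g.2.1.val % l : ℕ) : ℤ)) + 2

/-- The Kazhdan filtration of `U(Q(n))`: `KF n l d` is the span of the products of
generators of total Kazhdan degree `≤ d`. -/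
def KF (n l : ℕ) (d : ℤ) : Submodule ℂ (UQ n) :=
  Submodule.span ℂ
    { x : UQ n | ∃ L : List (Bool × Fin n × Fin n),
        ((L.map (agDeg l)).sum ≤ d) ∧ x = (L.map agElem).prod }

lemma one_mem_KF (n l : ℕ) (d : ℤ) (hd : 0 ≤ d) : (1 : UQ n) ∈ KF n l d :=
  Submodule.subset_span ⟨[], by simpa using hd⟩

lemma Wcond_one {n l : ℕ} (h : l ∣ n) (σ : UQ n →ₐ[ℂ] UQ n) : Wcond h σ 1 := by
  intro p q a b hab
  constructor
  · simpa using (Ichi n l h).zero_mem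
  · simpa [map_one] using (Ichi n l h).zero_mem

/-- `W_χ` as a `ℂ`-subspace of `U(Q(n))/I_χ`. -/
def WSub (n l : ℕ) (h : l ∣ n) (σ : UQ n →ₐ[ℂ] UQ n) : Submodule ℂ (Wq n l h) where
  carrier := WchiSet n l h σ
  zero_mem' := ⟨0, fun p q a b hab => by
      constructor
      · simpa using (Ichi n l h).zero_mem
      · simpa [map_zero] using (Ichi n l h).zero_mem,
    map_zero _⟩
  add_mem' := by
    rintro x y ⟨y1, hc1, rfl⟩ ⟨y2, hc2, rfl⟩
    refine ⟨y1 + y2, fun p q a b hab => ?_, map_add _ _ _⟩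
    obtain ⟨h11, h12⟩ := hc1 p q a b hab
    obtain ⟨h21, h22⟩ := hc2 p q a b hab
    constructor
    · have heq : Ue (bidx h p a) (bidx h q b) * (y1 + y2) -
          (y1 + y2) * Ue (bidx h p a) (bidx h q b) =
          (Ue (bidx h p a) (bidx h q b) * y1 - y1 * Ue (bidx h p a) (bidx h q b)) +
          (Ue (bidx h p a) (bidx h q b) * y2 - y2 * Ue (bidx h p a) (bidx h q b)) := by
        noncomm_ring
      rw [heq]; exact (Ichi n l h).add_mem h11 h21
    · have heq : Uf (bidx h p a) (bidx h q b) * (y1 + y2) -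
          σ (y1 + y2) * Uf (bidx h p a) (bidx h q b) =
          (Uf (bidx h p a) (bidx h q b) * y1 - σ y1 * Uf (bidx h p a) (bidx h q b)) +
          (Uf (bidx h p a) (bidx h q b) * y2 - σ y2 * Uf (bidx h p a) (bidx h q b)) := by
        rw [map_add]; noncomm_ring
      rw [heq]; exact (Ichi n l h).add_mem h12 h22
  smul_mem' := by
    rintro c x ⟨y, hc, rfl⟩
    refine ⟨c • y, fun p q a b hab => ?_, map_smul _ _ _⟩
    obtain ⟨h1, h2⟩ := hc p q a b hab
    constructor
    · have heq : Ue (bidx h p a) (bidx h q b) * (c • y) -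
          (c • y) * Ue (bidx h p a) (bidx h q b) =
          c • (Ue (bidx h p a) (bidx h q b) * y - y * Ue (bidx h p a) (bidx h q b)) := by
        rw [smul_sub, mul_smul_comm, smul_mul_assoc]
      rw [heq]
      exact ((Ichi n l h).restrictScalars ℂ).smul_mem c h1
    · have heq : Uf (bidx h p a) (bidx h q b) * (c • y) -
          σ (c • y) * Uf (bidx h p a) (bidx h q b) =
          c • (Uf (bidx h p a) (bidx h q b) * y - σ y * Uf (bidx h p a) (bidx h q b)) := by
        rw [map_smul, smul_sub, mul_smul_comm, smul_mul_assoc]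
      rw [heq]
      exact ((Ichi n l h).restrictScalars ℂ).smul_mem c h2

/-- The `d`-th piece of the Kazhdan filtration of `W_χ`. -/
def WFsub (n l : ℕ) (h : l ∣ n) (σ : UQ n →ₐ[ℂ] UQ n) (d : ℤ) : Submodule ℂ (Wq n l h) :=
  WSub n l h σ ⊓ (KF n l d).map (piq n l h)

/-- The `d`-th graded piece of the associated graded of `W_χ` for the Kazhdan filtration. -/
abbrev GrW (n l : ℕ) (h : l ∣ n) (σ : UQ n →ₐ[ℂ] UQ n) (d : ℤ) :=
  ↥(WFsub n l h σ d) ⧸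
    Submodule.comap (WFsub n l h σ d).subtype (WFsub n l h σ (d - 1))

/-- Generators of the supersymmetric algebra `S(g^χ)`: for each `0 ≤ k ≤ l-1` and
`1 ≤ p,q ≤ n/l`, an even generator `C k p q` (the element
`Σ_i e_{l(p-1)+i, l(q-1)+i+k}` of `g^χ`) and an odd generator `G k p q` (the element
`Σ_i (-1)^{i+k-1} f_{l(p-1)+i, l(q-1)+i+k}` of `g^χ`). -/
inductive SGen (m l : ℕ) : Type
  | C : Fin l → Fin m → Fin m → SGen m l
  | G : Fin l → Fin m → Fin m → SGen m l

/-- Supersymmetric-algebra relations: even generators are central, odd generators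
pairwise anticommute. -/
inductive SRel (m l : ℕ) : FreeAlgebra ℂ (SGen m l) → FreeAlgebra ℂ (SGen m l) → Prop
  | cc (k k' : Fin l) (p q p' q' : Fin m) : SRel m l
      (FreeAlgebra.ι ℂ (SGen.C k p q) * FreeAlgebra.ι ℂ (SGen.C k' p' q') -
        FreeAlgebra.ι ℂ (SGen.C k' p' q') * FreeAlgebra.ι ℂ (SGen.C k p q)) 0
  | cg (k k' : Fin l) (p q p' q' : Fin m) : SRel m l
      (FreeAlgebra.ι ℂ (SGen.C k p q) * FreeAlgebra.ι ℂ (SGen.G k' p' q') -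
        FreeAlgebra.ι ℂ (SGen.G k' p' q') * FreeAlgebra.ι ℂ (SGen.C k p q)) 0
  | gg (k k' : Fin l) (p q p' q' : Fin m) : SRel m l
      (FreeAlgebra.ι ℂ (SGen.G k p q) * FreeAlgebra.ι ℂ (SGen.G k' p' q') +
        FreeAlgebra.ι ℂ (SGen.G k' p' q') * FreeAlgebra.ι ℂ (SGen.G k p q)) 0

/-- The supersymmetric algebra `S(g^χ)`: the tensor product of a polynomial algebra on
`l·(n/l)² = n²/l` even generators and an exterior algebra on `n²/l` odd generators. -/
abbrev SA (m l : ℕ) := RingQuot (SRel m l)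

/-- The generators of `S(g^χ)`. -/
def sgElem {m l : ℕ} (g : SGen m l) : SA m l :=
  RingQuot.mkAlgHom ℂ (SRel m l) (FreeAlgebra.ι ℂ g)

/-- The Kazhdan degree of a generator of `S(g^χ)`: `2k+2` for `C k p q` and `G k p q`. -/
def sgDeg {m l : ℕ} : SGen m l → ℤ
  | SGen.C k _ _ => 2 * (k.val : ℤ) + 2
  | SGen.G k _ _ => 2 * (k.val : ℤ) + 2

/-- The degree-`d` graded piece of `S(g^χ)`. -/
def SGd (m l : ℕ) (d : ℤ) : Submodule ℂ (SA m l) :=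
  Submodule.span ℂ
    { x : SA m l | ∃ L : List (SGen m l),
        ((L.map sgDeg).sum = d) ∧ x = (L.map sgElem).prod }

/-! ## The supercommutative polynomial algebra on the basis of `Q(n)` -/

/-- Indices of the standard basis of `Q(n)`. -/
abbrev QG (n : ℕ) := Bool × Fin n × Fin n

/-- The sign `(-1)^{bc}`. -/
def sg (b c : Bool) : ℂ := if b && c then -1 else 1

@[simp] lemma sg_ff (b : Bool) : sg false b = 1 := by simp [sg]
@[simp] lemma sg_fr (b : Bool) : sg b false = 1 := by simp [sg]
@[simp] lemma sg_tt : sg true true = -1 := by simp [sg]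

lemma sg_comm (b c : Bool) : sg b c = sg c b := by cases b <;> cases c <;> simp
lemma sg_sq (b c : Bool) : sg b c * sg b c = 1 := by cases b <;> cases c <;> simp
lemma sg_xor (b c d : Bool) : sg (xor b c) d = sg b d * sg c d := by
  cases b <;> cases c <;> cases d <;> simp

/-- Relations of the supercommutative algebra. -/
inductive PRel (n : ℕ) : FreeAlgebra ℂ (QG n) → FreeAlgebra ℂ (QG n) → Prop
  | c (x y : QG n) : PRel n (FreeAlgebra.ι ℂ x * FreeAlgebra.ι ℂ y)
      (sg x.1 y.1 • (FreeAlgebra.ι ℂ y * FreeAlgebra.ι ℂ x))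

/-- The supercommutative algebra `S(Q(n))`. -/
abbrev PS (n : ℕ) := RingQuot (PRel n)

/-- Generators of `S(Q(n))`. -/
def pA {n : ℕ} (x : QG n) : PS n := RingQuot.mkAlgHom ℂ (PRel n) (FreeAlgebra.ι ℂ x)

/-- Monomials. -/
def pL {n : ℕ} (L : List (QG n)) : PS n := (L.map pA).prod

@[simp] lemma pL_nil {n : ℕ} : pL ([] : List (QG n)) = 1 := rfl
@[simp] lemma pL_cons {n : ℕ} (x : QG n) (L : List (QG n)) : pL (x :: L) = pA x * pL L := by
  simp [pL]

lemma pA_comm {n : ℕ} (x y : QG n) : pA x * pA y = sg x.1 y.1 • (pA y * pA x) := by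
  have := RingQuot.mkAlgHom_rel ℂ (PRel.c x y)
  simpa [pA, map_mul, map_smul] using this

/-- Universal property of `S(Q(n))`. -/
def pLift {n : ℕ} {R : Type*} [Ring R] [Algebra ℂ R] (f : QG n → R)
    (hf : ∀ x y, f x * f y = sg x.1 y.1 • (f y * f x)) : PS n →ₐ[ℂ] R :=
  RingQuot.liftAlgHom ℂ ⟨FreeAlgebra.lift ℂ f, by
    rintro _ _ ⟨x, y⟩
    simp [hf x y]⟩

@[simp] lemma pLift_A {n : ℕ} {R : Type*} [Ring R] [Algebra ℂ R] (f : QG n → R)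
    (hf : ∀ x y, f x * f y = sg x.1 y.1 • (f y * f x)) (x : QG n) :
    pLift f hf (pA x) = f x := by
  simp [pLift, pA]

lemma pLift_L {n : ℕ} {R : Type*} [Ring R] [Algebra ℂ R] (f : QG n → R)
    (hf : ∀ x y, f x * f y = sg x.1 y.1 • (f y * f x)) (L : List (QG n)) :
    pLift f hf (pL L) = (L.map f).prod := by
  induction L with
  | nil => simp
  | cons x L ih => simp [ih]

/-- A presented algebra is spanned by the words in its generators. -/
lemma span_words {X : Type*} (r : FreeAlgebra ℂ X → FreeAlgebra ℂ X → Prop) :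
    Submodule.span ℂ (Set.range fun L : List X =>
      (L.map fun x => RingQuot.mkAlgHom ℂ r (FreeAlgebra.ι ℂ x)).prod) = ⊤ := by
  have h1 : Algebra.adjoin ℂ (Set.range fun x : X =>
      RingQuot.mkAlgHom ℂ r (FreeAlgebra.ι ℂ x)) = ⊤ := by
    have h2 := congrArg (Subalgebra.map (RingQuot.mkAlgHom ℂ r))
      (FreeAlgebra.adjoin_range_ι (R := ℂ) (X := X))
    rw [AlgHom.map_adjoin, ← Set.range_comp, Algebra.map_top,
      (AlgHom.range_eq_top _).2 (RingQuot.mkAlgHom_surjective ℂ r)] at h2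
    exact h2
  rw [eq_top_iff]
  have h3 := Algebra.adjoin_eq_span ℂ (Set.range fun x : X =>
      RingQuot.mkAlgHom ℂ r (FreeAlgebra.ι ℂ x))
  rw [h1, Algebra.top_toSubmodule] at h3
  rw [h3]
  refine Submodule.span_mono ?_
  intro y hy
  obtain ⟨L, hL, rfl⟩ := Submonoid.exists_list_of_mem_closure hy
  clear hy
  induction L with
  | nil => exact ⟨[], rfl⟩
  | cons a L ih =>
    obtain ⟨x, hx⟩ := hL a (by simp)
    obtain ⟨M, hM⟩ := ih (fun y hy => hL y (by simp [hy]))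
    refine ⟨x :: M, ?_⟩
    simp only [List.map_cons, List.prod_cons] at hM ⊢
    rw [hM, ← hx]

lemma pL_span {n : ℕ} (F : PS n) : F ∈ Submodule.span ℂ (Set.range (pL (n := n))) := by
  have : (⊤ : Submodule ℂ (PS n)) = Submodule.span ℂ (Set.range (pL (n := n))) :=
    (span_words (PRel n)).symm
  rw [← this]; trivial

/-- Two linear maps agreeing on monomials are equal. -/
lemma pS_ext {n : ℕ} {V : Type*} [AddCommGroup V] [Module ℂ V] {f g : PS n →ₗ[ℂ] V}
    (hfg : ∀ L, f (pL L) = g (pL L)) : f = g := by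
  ext F
  have hF := pL_span F
  induction hF using Submodule.span_induction with
  | mem x hx => obtain ⟨L, rfl⟩ := hx; exact hfg L
  | zero => simp
  | add x y _ _ hx hy => simp [hx, hy]
  | smul c x _ hx => simp [hx]

/-! ### Homogeneous components -/

/-- The grading homomorphism for a weight function. -/
def pK {n : ℕ} {M : Type*} [AddCommMonoid M] (w : QG n → M) :
    PS n →ₐ[ℂ] AddMonoidAlgebra (PS n) M :=
  pLift (fun x => AddMonoidAlgebra.single (w x) (pA x)) (by
    intro x y
    rw [AddMonoidAlgebra.single_mul_single, AddMonoidAlgebra.single_mul_single,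
      AddMonoidAlgebra.smul_single, pA_comm, add_comm])

/-- Total weight of a word. -/
def wt {n : ℕ} {M : Type*} [AddCommMonoid M] (w : QG n → M) (L : List (QG n)) : M :=
  (L.map w).sum

lemma pK_L {n : ℕ} {M : Type*} [AddCommMonoid M] (w : QG n → M) (L : List (QG n)) :
    pK w (pL L) = AddMonoidAlgebra.single (wt w L) (pL L) := by
  induction L with
  | nil => simp [wt, AddMonoidAlgebra.one_def]
  | cons x L ih =>
    rw [pL_cons, map_mul, ih, pK, pLift_A, AddMonoidAlgebra.single_mul_single]
    simp [wt]

/-- The component of weight `d`. -/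
def pC {n : ℕ} {M : Type*} [AddCommMonoid M] (w : QG n → M) (d : M) : PS n →ₗ[ℂ] PS n where
  toFun F := (pK w F).coeff d
  map_add' := by intro x y; simp
  map_smul' := by intro c x; simp

lemma pC_L {n : ℕ} {M : Type*} [AddCommMonoid M] (w : QG n → M) (d : M) (L : List (QG n)) :
    pC w d (pL L) = if wt w L = d then pL L else 0 := by
  simp only [pC, LinearMap.coe_mk, AddHom.coe_mk, pK_L, AddMonoidAlgebra.coeff_single,
    Finsupp.single_apply]

lemma pC_ext {n : ℕ} {M : Type*} [AddCommMonoid M] (w : QG n → M) {F : PS n}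
    (h : ∀ d, pC w d F = 0) : F = 0 := by
  have h1 : pK w F = 0 := by
    ext d; exact h d
  have h2 : ∀ x : PS n, ((pK w x).coeff.sum fun _ a => a) = x := by
    intro x
    have hx := pL_span x
    induction hx using Submodule.span_induction with
    | mem x hx => obtain ⟨L, rfl⟩ := hx; rw [pK_L]; simp
    | zero => simp
    | add x y _ _ hx hy =>
      rw [map_add, AddMonoidAlgebra.coeff_add, Finsupp.sum_add_index' (by simp) (by simp), hx, hy]
    | smul c x _ hx =>
      rw [map_smul, AddMonoidAlgebra.coeff_smul, Finsupp.sum_smul_index' (by simp),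
        ← Finsupp.smul_sum, hx]
  rw [← h2 F, h1]; simp

/-! ### Partial derivatives -/

/-- The homomorphism encoding the (super) partial derivative. -/
def pDhom {n : ℕ} (x : QG n) : PS n →ₐ[ℂ] Matrix (Fin 2) (Fin 2) (PS n) :=
  pLift (fun h => !![sg x.1 h.1 • pA h, if x = h then 1 else 0; 0, pA h]) (by
    intro h k
    have hk := pA_comm h k
    ext i j
    fin_cases i <;> fin_cases j
    · simp only [Matrix.mul_apply, Fin.sum_univ_two, Matrix.smul_apply]
      simp [hk, smul_smul, mul_comm, mul_left_comm]
    · simp only [Matrix.mul_apply, Fin.sum_univ_two, Matrix.smul_apply]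
      by_cases h1 : x = h <;> by_cases h2 : x = k
      · subst h1; subst h2
        simp [smul_smul, sg_sq, add_comm]
      · subst h1
        simp [h2, smul_smul, sg_sq]
      · subst h2
        simp [h1, sg_comm]
      · simp [h1, h2]
    · simp [Matrix.mul_apply, Fin.sum_univ_two]
    · simp [Matrix.mul_apply, Fin.sum_univ_two, hk])

lemma pDhom_one_one {n : ℕ} (x : QG n) (F : PS n) : pDhom x F 1 1 = F ∧ pDhom x F 1 0 = 0 := by
  have hF := pL_span F
  induction hF using Submodule.span_induction with
  | mem F hF =>
    obtain ⟨L, rfl⟩ := hF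
    induction L with
    | nil => simp
    | cons h L ih =>
      rw [pL_cons, map_mul, Matrix.mul_apply, Matrix.mul_apply, Fin.sum_univ_two,
        Fin.sum_univ_two, ih.1, ih.2]
      simp [pDhom]
  | zero => simp
  | add x y _ _ hx hy => simp [hx, hy]
  | smul c x _ hx => simp [hx]

/-- The (left, super) partial derivative. -/
def pD {n : ℕ} (x : QG n) : PS n →ₗ[ℂ] PS n where
  toFun F := pDhom x F 0 1
  map_add' := by intro a b; simp
  map_smul' := by intro a b; simp

@[simp] lemma pD_one {n : ℕ} (x : QG n) : pD x 1 = 0 := by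
  simp [pD]

lemma pD_mul {n : ℕ} (x h : QG n) (F : PS n) :
    pD x (pA h * F) = (if x = h then F else 0) + sg x.1 h.1 • (pA h * pD x F) := by
  simp only [pD, LinearMap.coe_mk, AddHom.coe_mk, map_mul, Matrix.mul_apply, Fin.sum_univ_two,
    (pDhom_one_one x F).1]
  simp only [pDhom, pLift_A]
  by_cases hx : x = h <;> simp [hx, add_comm]

/-- `F` has parity `b` with respect to commutation. -/
def HP {n : ℕ} (b : Bool) (F : PS n) : Prop := ∀ h : QG n, F * pA h = sg b h.1 • (pA h * F)

lemma HP.add {n : ℕ} {b : Bool} {F F' : PS n} (h1 : HP b F) (h2 : HP b F') : HP b (F + F') := by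
  intro h; rw [add_mul, h1 h, h2 h, mul_add, smul_add]
lemma HP.sub {n : ℕ} {b : Bool} {F F' : PS n} (h1 : HP b F) (h2 : HP b F') : HP b (F - F') := by
  intro h; rw [sub_mul, h1 h, h2 h, mul_sub, smul_sub]
lemma HP.smul {n : ℕ} {b : Bool} {F : PS n} (c : ℂ) (h1 : HP b F) : HP b (c • F) := by
  intro h; rw [smul_mul_assoc, h1 h, mul_smul_comm, smul_comm]
lemma HP.zero {n : ℕ} (b : Bool) : HP b (0 : PS n) := by intro h; simp
lemma HP.pA {n : ℕ} (x : QG n) : HP x.1 (pA x) := fun h => pA_comm x h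
lemma HP.const {n : ℕ} (c : ℂ) : HP false (algebraMap ℂ (PS n) c) := by
  intro h; simp [Algebra.commutes]

/-- The derivation `Σ_x c_x ∂_x`. -/
def pDer {n : ℕ} (c : QG n → PS n) : PS n →ₗ[ℂ] PS n :=
  ∑ x, LinearMap.mulLeft ℂ (c x) ∘ₗ pD x

lemma pDer_apply {n : ℕ} (c : QG n → PS n) (F : PS n) : pDer c F = ∑ x, c x * pD x F := by
  simp [pDer, LinearMap.sum_apply]

@[simp] lemma pDer_one {n : ℕ} (c : QG n → PS n) : pDer c 1 = 0 := by
  simp [pDer_apply]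

lemma pDer_mul {n : ℕ} (b : Bool) (c : QG n → PS n) (hc : ∀ x, HP (xor b x.1) (c x))
    (h : QG n) (F : PS n) :
    pDer c (pA h * F) = c h * F + sg b h.1 • (pA h * pDer c F) := by
  simp only [pDer_apply, pD_mul, mul_add, Finset.sum_add_distrib]
  congr 1
  · simp
  · rw [Finset.mul_sum, Finset.smul_sum]
    refine Finset.sum_congr rfl fun x _ => ?_
    rw [mul_smul_comm, ← mul_assoc, hc x h, smul_mul_assoc, smul_smul, sg_xor, mul_assoc]
    congr 1
    have := sg_sq x.1 h.1
    linear_combination (sg b h.1) * this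

/-! ### Sorted monomials are independent -/

lemma pD_L_notMem {n : ℕ} (x : QG n) (L : List (QG n)) (hx : x ∉ L) : pD x (pL L) = 0 := by
  induction L with
  | nil => simp
  | cons h L ih =>
    simp only [List.mem_cons, not_or] at hx
    simp [pD_mul, hx.1, ih hx.2]

lemma pD_L_even {n : ℕ} (x : QG n) (L : List (QG n)) (hx : x.1 = false) :
    pA x * pD x (pL L) = (L.count x : ℂ) • pL L := by
  induction L with
  | nil => simp
  | cons h L ih =>
    have hc := pA_comm x h
    rw [hx, sg_ff, one_smul] at hc
    rw [pL_cons, pD_mul, hx, sg_ff, one_smul, mul_add, ← mul_assoc, hc, mul_assoc, ih,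
      List.count_cons]
    by_cases hh : x = h
    · subst hh; simp [add_smul, add_comm]
    · have : ¬ h = x := fun h' => hh h'.symm
      simp [hh, this]

/-- A word with no repeated odd letters has nonzero monomial. -/
lemma pL_ne_zero {n : ℕ} (L : List (QG n))
    (hL : L.Pairwise fun x y => x = y → x.1 = false) : pL L ≠ 0 := by
  induction L with
  | nil =>
    intro h0
    have := congrArg (pLift (n := n) (R := ℂ) (fun _ => 0) (by simp)) h0
    simp at this
  | cons h L ih =>
    rw [List.pairwise_cons] at hL
    intro h0
    have h1 := congrArg (pD h) h0
    rw [pL_cons, pD_mul, map_zero, if_pos rfl] at h1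
    rcases hb : h.1 with _ | _
    · rw [hb, sg_ff, one_smul, pD_L_even h L hb] at h1
      have h2 : ((1 : ℂ) + (L.count h : ℂ)) • pL L = 0 := by rw [add_smul, one_smul]; exact h1
      rcases smul_eq_zero.1 h2 with h3 | h3
      · have : ((1 + L.count h : ℕ) : ℂ) = 0 := by push_cast; exact h3
        rw [Nat.cast_eq_zero] at this; omega
      · exact ih hL.2 h3
    · have hn : h ∉ L := by
        intro hm
        have := hL.1 h hm rfl
        simp [hb] at this
      rw [pD_L_notMem h L hn] at h1
      simp at h1
      exact ih hL.2 h1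

/-! ## The action of `U(Q(n))` on `S(Q(n))` and the symbol map -/

/-- Elements of negative degree. -/
def mT (l : ℕ) {n : ℕ} (X : QG n) : Prop := X.2.2.val % l < X.2.1.val % l

/-- The linear form `χ`, extended by zero. -/
def chi (l : ℕ) {n : ℕ} (X : QG n) : ℂ :=
  if X.1 = false ∧ X.2.1.val % l = X.2.2.val % l + 1 ∧ X.2.1.val / l = X.2.2.val / l
  then 1 else 0

/-- `x + χ(x)` in `S(Q(n))`. -/
def pB (l : ℕ) {n : ℕ} (X : QG n) : PS n := pA X + algebraMap ℂ (PS n) (chi l X)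

/-- Associative product in `Q(n)` on basis elements (up to the Kronecker delta `km`). -/
def mulG {n : ℕ} (X Y : QG n) : QG n := (xor X.1 Y.1, X.2.1, Y.2.2)

/-- The Kronecker delta of the associative product. -/
def km {n : ℕ} (X Y : QG n) : ℂ := kd X.2.2 Y.2.1

lemma chi_odd (l : ℕ) {n : ℕ} (X : QG n) (h : X.1 = true) : chi l X = 0 := by simp [chi, h]

lemma chi_deg (l : ℕ) {n : ℕ} (X : QG n) (h : chi l X ≠ 0) : agDeg l X = 0 := by
  unfold chi at h
  split_ifs at h with h1
  · simp [agDeg, h1.2.1]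
  · simp at h

lemma chi_mT (l : ℕ) {n : ℕ} (X : QG n) (h : chi l X ≠ 0) : mT l X := by
  unfold chi at h
  split_ifs at h with h1
  · simp [mT, h1.2.1]
  · simp at h

lemma HP_B (l : ℕ) {n : ℕ} (X : QG n) : HP X.1 (pB l X) := by
  refine (HP.pA X).add ?_
  rcases hb : X.1 with _ | _
  · exact HP.const _
  · rw [chi_odd l X hb, map_zero]; exact HP.zero _

lemma mulG_deg (l : ℕ) {n : ℕ} (X Y : QG n) (h : km X Y ≠ 0) :
    agDeg l (mulG X Y) = agDeg l X + agDeg l Y - 2 := by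
  unfold km kd at h
  split_ifs at h with h1
  · simp only [agDeg, mulG, h1]; ring
  · simp at h

/-- The derivation extending left multiplication. -/
def lD (l : ℕ) {n : ℕ} (X : QG n) : PS n →ₗ[ℂ] PS n :=
  pDer fun Z => km X Z • pB l (mulG X Z)

/-- The action operator of a basis element. -/
def opX (l : ℕ) {n : ℕ} (X : QG n) : PS n →ₗ[ℂ] PS n :=
  LinearMap.mulLeft ℂ (pB l X) + lD l X

lemma opX_apply (l : ℕ) {n : ℕ} (X : QG n) (F : PS n) : opX l X F = pB l X * F + lD l X F := rfl

lemma opX_one (l : ℕ) {n : ℕ} (X : QG n) : opX l X 1 = pB l X := by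
  simp [opX_apply, lD]

lemma lD_mul (l : ℕ) {n : ℕ} (X h : QG n) (F : PS n) :
    lD l X (pA h * F) = km X h • (pB l (mulG X h) * F) + sg X.1 h.1 • (pA h * lD l X F) := by
  rw [lD, pDer_mul X.1 _ (fun Z => (HP_B l (mulG X Z)).smul _), smul_mul_assoc]

lemma opX_A (l : ℕ) {n : ℕ} (X h : QG n) (F : PS n) :
    opX l X (pA h * F) = km X h • (pB l (mulG X h) * F) + sg X.1 h.1 • (pA h * opX l X F) := by
  rw [opX_apply, opX_apply, lD_mul, ← mul_assoc, HP_B l X h, mul_add, smul_add, smul_mul_assoc,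
    mul_assoc]
  abel

lemma lD_B (l : ℕ) {n : ℕ} (X h : QG n) (F : PS n) :
    lD l X (pB l h * F) = km X h • (pB l (mulG X h) * F) + sg X.1 h.1 • (pB l h * lD l X F) := by
  conv_lhs => rw [pB, add_mul, map_add, lD_mul, ← Algebra.smul_def, map_smul]
  conv_rhs => rw [pB.eq_1 l h, add_mul, smul_add, ← Algebra.smul_def]
  rcases hb : h.1 with _ | _
  · simp [add_assoc]
  · simp [chi_odd l h hb]

lemma opX_B (l : ℕ) {n : ℕ} (X h : QG n) (F : PS n) :
    opX l X (pB l h * F) = km X h • (pB l (mulG X h) * F) + sg X.1 h.1 • (pB l h * opX l X F) := by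
  conv_lhs => rw [pB, add_mul, map_add, opX_A, ← Algebra.smul_def, map_smul]
  conv_rhs => rw [pB.eq_1 l h, add_mul, smul_add, ← Algebra.smul_def]
  rcases hb : h.1 with _ | _
  · simp [add_assoc]
  · simp [chi_odd l h hb]

lemma pB_comm (l : ℕ) {n : ℕ} (X Y : QG n) : pB l X * pB l Y = sg X.1 Y.1 • (pB l Y * pB l X) := by
  conv_lhs => rw [pB.eq_1 l Y, mul_add, HP_B l X Y]
  conv_rhs => rw [pB.eq_1 l Y, add_mul, smul_add]
  congr 1
  rcases hb : Y.1 with _ | _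
  · simp [Algebra.commutes]
  · simp [chi_odd l Y hb]

lemma km_assoc {n : ℕ} (X Y Z : QG n) : km Y Z * km X (mulG Y Z) = km X Y * km (mulG X Y) Z := by
  simp only [km, mulG]; ring

lemma mulG_assoc {n : ℕ} (X Y Z : QG n) : mulG X (mulG Y Z) = mulG (mulG X Y) Z := by
  simp [mulG]

lemma opX_rel (l : ℕ) {n : ℕ} (X Y : QG n) (F : PS n) :
    opX l X (opX l Y F) - sg X.1 Y.1 • opX l Y (opX l X F) =
      km X Y • opX l (mulG X Y) F - (sg X.1 Y.1 * km Y X) • opX l (mulG Y X) F := by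
  have key : (opX l X ∘ₗ opX l Y - sg X.1 Y.1 • (opX l Y ∘ₗ opX l X)) =
      km X Y • opX l (mulG X Y) - (sg X.1 Y.1 * km Y X) • opX l (mulG Y X) := by
    refine pS_ext fun L => ?_
    induction L with
    | nil =>
      simp only [LinearMap.sub_apply, LinearMap.comp_apply, LinearMap.smul_apply, pL_nil, opX_one]
      have h1 := opX_B l X Y 1
      have h2 := opX_B l Y X 1
      simp only [mul_one, opX_one] at h1 h2
      rw [h1, h2, pB_comm l X Y, sg_comm Y.1 X.1]
      simp only [smul_add, smul_smul, sg_sq, one_smul]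
      abel
    | cons h L ih =>
      simp only [LinearMap.sub_apply, LinearMap.comp_apply, LinearMap.smul_apply, pL_cons] at ih ⊢
      simp only [opX_A, map_add, map_smul, opX_B]
      have e1 : (mulG X Y).1 = xor X.1 Y.1 := rfl
      have e2 : (mulG Y X).1 = xor X.1 Y.1 := by simp [mulG, Bool.xor_comm]
      have e3 : (mulG Y h).1 = xor Y.1 h.1 := rfl
      have e4 : (mulG X h).1 = xor X.1 h.1 := rfl
      have ih2 := congrArg (fun z => sg (xor X.1 Y.1) h.1 • (pA h * z)) ih
      simp only [mul_sub, smul_sub, mul_smul_comm] at ih2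
      have a1 := km_assoc X Y h
      have a2 := km_assoc Y X h
      rw [e1, e2, e3, e4, mulG_assoc, mulG_assoc]
      simp only [smul_add, smul_smul] at ih2 ⊢
      rw [a1, show sg X.1 Y.1 * (km X h * km Y (mulG X h)) =
        sg X.1 Y.1 * (km Y X * km (mulG Y X) h) by rw [a2]]
      have s1 : sg X.1 Y.1 * (km X h * sg Y.1 (xor X.1 h.1)) = km X h * sg Y.1 h.1 := by
        rw [sg_comm Y.1, sg_xor, sg_comm h.1]
        linear_combination (km X h * sg Y.1 h.1) * sg_sq X.1 Y.1
      have s2 : km Y h * sg X.1 (xor Y.1 h.1) = sg X.1 Y.1 * (sg X.1 h.1 * km Y h) := by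
        rw [sg_comm X.1, sg_xor, sg_comm h.1, sg_comm Y.1]; ring
      rw [s1, s2]
      rw [sg_xor] at ih2 ⊢
      have ih3 := sub_eq_zero.2 ih2
      refine sub_eq_zero.1 ?_
      rw [← ih3]
      module
  exact LinearMap.congr_fun key F

/-- The action of `U(Q(n))` on `S(Q(n))`. -/
def phi (l n : ℕ) : UQ n →ₐ[ℂ] Module.End ℂ (PS n) :=
  RingQuot.liftAlgHom ℂ ⟨FreeAlgebra.lift ℂ (fun g : QGen n => match g with
      | QGen.E i j => (opX l (false, i, j) : Module.End ℂ (PS n))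
      | QGen.F i j => opX l (true, i, j)), by
    rintro _ _ (⟨i, j, k, m⟩ | ⟨i, j, k, m⟩ | ⟨i, j, k, m⟩)
    · ext F
      have := opX_rel l (false, i, j) (false, k, m) F
      simpa [mulG, km] using this
    · ext F
      have := opX_rel l (false, i, j) (true, k, m) F
      simpa [mulG, km] using this
    · ext F
      have := opX_rel l (true, i, j) (true, k, m) F
      simp only [mulG, km, sg_tt] at this
      simp only [map_sub, map_add, map_mul, map_smul, FreeAlgebra.lift_ι_apply,
        LinearMap.add_apply, LinearMap.smul_apply, Module.End.mul_apply]
      refine Eq.trans ?_ (this.trans ?_)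
      · module
      · simp only [Bool.xor_self]
        module⟩

lemma phi_ag (l n : ℕ) (X : QG n) : phi l n (agElem X) = opX l X := by
  obtain ⟨b, i, j⟩ := X
  cases b <;> simp [phi, agElem, Ue, Uf]

lemma ag_comm {n : ℕ} (X Y : QG n) :
    agElem X * agElem Y - sg X.1 Y.1 • (agElem Y * agElem X) =
      km X Y • agElem (mulG X Y) - (sg X.1 Y.1 * km Y X) • agElem (mulG Y X) := by
  obtain ⟨b, i, j⟩ := X
  obtain ⟨c, k, m⟩ := Y
  have h1 := RingQuot.mkAlgHom_rel ℂ (QRel.ee i j k m)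
  have h2 := RingQuot.mkAlgHom_rel ℂ (QRel.ef i j k m)
  have h3 := RingQuot.mkAlgHom_rel ℂ (QRel.ef k m i j)
  have h4 := RingQuot.mkAlgHom_rel ℂ (QRel.ff i j k m)
  simp only [map_sub, map_add, map_mul, map_smul] at h1 h2 h3 h4
  cases b <;> cases c <;> simp [agElem, mulG, km, Ue, Uf]
  · exact h1
  · exact h2
  · rw [← neg_inj, neg_sub, neg_sub, h3]
  · refine Eq.trans ?_ (h4.trans ?_) <;> module

/-- Words in `U(Q(n))`. -/
def uL {n : ℕ} (L : List (QG n)) : UQ n := (L.map agElem).prod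

@[simp] lemma uL_nil {n : ℕ} : uL ([] : List (QG n)) = 1 := rfl
@[simp] lemma uL_cons {n : ℕ} (x : QG n) (L : List (QG n)) : uL (x :: L) = agElem x * uL L := by
  simp [uL]
lemma uL_append {n : ℕ} (L M : List (QG n)) : uL (L ++ M) = uL L * uL M := by simp [uL]

lemma uL_span {n : ℕ} (y : UQ n) : y ∈ Submodule.span ℂ (Set.range (uL (n := n))) := by
  have h1 : y ∈ Submodule.span ℂ (Set.range fun L : List (QGen n) =>
      (L.map fun x => RingQuot.mkAlgHom ℂ (QRel n) (FreeAlgebra.ι ℂ x)).prod) := by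
    rw [span_words (QRel n)]; trivial
  refine Submodule.span_mono ?_ h1
  rintro _ ⟨L, rfl⟩
  refine ⟨L.map (fun g => match g with
      | QGen.E i j => (false, i, j)
      | QGen.F i j => (true, i, j)), ?_⟩
  simp only [uL, List.map_map]
  congr 2
  funext g
  cases g <;> simp [agElem, Ue, Uf]

@[simp] lemma wt_nil {n : ℕ} {M : Type*} [AddCommMonoid M] (w : QG n → M) : wt w [] = 0 := rfl
@[simp] lemma wt_cons {n : ℕ} {M : Type*} [AddCommMonoid M] (w : QG n → M) (x : QG n)
    (L : List (QG n)) : wt w (x :: L) = w x + wt w L := by simp [wt]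
lemma wt_append {n : ℕ} {M : Type*} [AddCommMonoid M] (w : QG n → M)
    (L L' : List (QG n)) : wt w (L ++ L') = wt w L + wt w L' := by simp [wt]

lemma uL_mem_KF {n l : ℕ} (L : List (QG n)) {d : ℤ} (h : wt (agDeg l) L ≤ d) : uL L ∈ KF n l d :=
  Submodule.subset_span ⟨L, h, rfl⟩

lemma KF_induction {n l : ℕ} {d : ℤ} {P : UQ n → Prop} (h : ∀ L, wt (agDeg l) L ≤ d → P (uL L))
    (h0 : P 0) (ha : ∀ x y, P x → P y → P (x + y)) (hs : ∀ (c : ℂ) x, P x → P (c • x))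
    {y : UQ n} (hy : y ∈ KF n l d) : P y := by
  unfold KF at hy
  induction hy using Submodule.span_induction with
  | mem x hx => obtain ⟨L, hL, rfl⟩ := hx; exact h L hL
  | zero => exact h0
  | add x y _ _ hx hy => exact ha x y hx hy
  | smul c x _ hx => exact hs c x hx

lemma KF_mono {n l : ℕ} {d d' : ℤ} (h : d ≤ d') : KF n l d ≤ KF n l d' :=
  Submodule.span_mono (by rintro _ ⟨L, hL, rfl⟩; exact ⟨L, hL.trans h, rfl⟩)

lemma KF_mul {n l : ℕ} {d d' : ℤ} {x y : UQ n} (hx : x ∈ KF n l d) (hy : y ∈ KF n l d') :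
    x * y ∈ KF n l (d + d') := by
  refine KF_induction (P := fun x => x * y ∈ KF n l (d + d')) ?_ ?_ ?_ ?_ hx
  · intro L hL
    refine KF_induction (P := fun y => uL L * y ∈ KF n l (d + d')) ?_ ?_ ?_ ?_ hy
    · intro M hM
      rw [← uL_append]
      exact uL_mem_KF _ (by rw [wt_append]; linarith)
    · simp
    · intro x y hx hy; rw [mul_add]; exact add_mem hx hy
    · intro c x hx; rw [mul_smul_comm]; exact Submodule.smul_mem _ _ hx
  · simp
  · intro x y hx hy; rw [add_mul]; exact add_mem hx hy
  · intro c x hx; rw [smul_mul_assoc]; exact Submodule.smul_mem _ _ hx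

lemma ag_mem_KF {n l : ℕ} (X : QG n) {d : ℤ} (h : agDeg l X ≤ d) : agElem X ∈ KF n l d := by
  have := uL_mem_KF (l := l) [X] (d := d) (by simpa using h)
  simpa using this

/-- Kazhdan filtration of `S(Q(n))`. -/
def SLow (l n : ℕ) (d : ℤ) : Submodule ℂ (PS n) :=
  Submodule.span ℂ {x | ∃ L, wt (agDeg l) L ≤ d ∧ x = pL L}

lemma SLow_mono {l n : ℕ} {d d' : ℤ} (h : d ≤ d') : SLow l n d ≤ SLow l n d' :=
  Submodule.span_mono (by rintro _ ⟨L, hL, rfl⟩; exact ⟨L, hL.trans h, rfl⟩)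

lemma SLow_induction {n l : ℕ} {d : ℤ} {P : PS n → Prop} (h : ∀ L, wt (agDeg l) L ≤ d → P (pL L))
    (h0 : P 0) (ha : ∀ x y, P x → P y → P (x + y)) (hs : ∀ (c : ℂ) x, P x → P (c • x))
    {y : PS n} (hy : y ∈ SLow l n d) : P y := by
  unfold SLow at hy
  induction hy using Submodule.span_induction with
  | mem x hx => obtain ⟨L, hL, rfl⟩ := hx; exact h L hL
  | zero => exact h0
  | add x y _ _ hx hy => exact ha x y hx hy
  | smul c x _ hx => exact hs c x hx

lemma pA_SLow {l n : ℕ} {d : ℤ} (X : QG n) {F : PS n} (hF : F ∈ SLow l n d) :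
    pA X * F ∈ SLow l n (agDeg l X + d) := by
  refine SLow_induction (P := fun F => pA X * F ∈ SLow l n (agDeg l X + d)) ?_ ?_ ?_ ?_ hF
  · intro L hL
    exact Submodule.subset_span ⟨X :: L, by simpa using hL, by simp⟩
  · simp
  · intro x y hx hy; rw [mul_add]; exact add_mem hx hy
  · intro c x hx; rw [mul_smul_comm]; exact Submodule.smul_mem _ _ hx

lemma pB_SLow {l n : ℕ} {d : ℤ} (X : QG n) {F : PS n} (hF : F ∈ SLow l n d) :
    pB l X * F ∈ SLow l n (agDeg l X + d) := by
  rw [pB, add_mul, ← Algebra.smul_def]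
  refine add_mem (pA_SLow X hF) ?_
  by_cases hc : chi l X = 0
  · simp [hc]
  · rw [chi_deg l X hc, zero_add]; exact Submodule.smul_mem _ _ hF

lemma lD_SLow {l n : ℕ} {d : ℤ} (X : QG n) {F : PS n} (hF : F ∈ SLow l n d) :
    lD l X F ∈ SLow l n (agDeg l X + d - 2) := by
  refine SLow_induction (P := fun F => lD l X F ∈ SLow l n (agDeg l X + d - 2)) ?_ ?_ ?_ ?_ hF
  · intro L hL
    refine SLow_mono (d := agDeg l X + wt (agDeg l) L - 2) (by linarith) ?_
    clear hL
    induction L with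
    | nil => simp [lD]
    | cons h L ih =>
      rw [pL_cons, lD_mul]
      refine add_mem ?_ ?_
      · by_cases hk : km X h = 0
        · simp [hk]
        · refine Submodule.smul_mem _ _ ?_
          have := pB_SLow (l := l) (mulG X h) (F := pL L) (d := wt (agDeg l) L)
            (Submodule.subset_span ⟨L, le_rfl, rfl⟩)
          rw [mulG_deg l X h hk] at this
          refine SLow_mono ?_ this
          rw [wt_cons]; linarith
      · refine Submodule.smul_mem _ _ ?_
        refine SLow_mono ?_ (pA_SLow h ih)
        rw [wt_cons]; linarith
  · simp
  · intro x y hx hy; rw [map_add]; exact add_mem hx hy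
  · intro c x hx; rw [map_smul]; exact Submodule.smul_mem _ _ hx

/-- Symbols of words. -/
def bL (l : ℕ) {n : ℕ} (L : List (QG n)) : PS n := (L.map (pB l)).prod

@[simp] lemma bL_nil (l : ℕ) {n : ℕ} : bL l ([] : List (QG n)) = 1 := rfl
@[simp] lemma bL_cons (l : ℕ) {n : ℕ} (x : QG n) (L : List (QG n)) :
    bL l (x :: L) = pB l x * bL l L := by simp [bL]

lemma bL_SLow {l n : ℕ} (L : List (QG n)) : bL l L ∈ SLow l n (wt (agDeg l) L) := by
  induction L with
  | nil => exact Submodule.subset_span ⟨[], by simp, by simp⟩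
  | cons h L ih => rw [bL_cons, wt_cons]; exact pB_SLow h ih

/-- Evaluation at `1`. -/
def ev (l n : ℕ) : UQ n →ₗ[ℂ] PS n := (LinearMap.applyₗ (1 : PS n)) ∘ₗ (phi l n).toLinearMap

lemma ev_one (l n : ℕ) : ev l n 1 = 1 := by simp [ev]

lemma ev_mul (l n : ℕ) (X : QG n) (y : UQ n) : ev l n (agElem X * y) = opX l X (ev l n y) := by
  simp [ev, phi_ag]

lemma ev_uL {l n : ℕ} (L : List (QG n)) :
    ev l n (uL L) - bL l L ∈ SLow l n (wt (agDeg l) L - 1) := by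
  induction L with
  | nil => simp [ev_one]
  | cons h L ih =>
    rw [uL_cons, ev_mul, bL_cons, opX_apply, wt_cons]
    have e : pB l h * ev l n (uL L) + lD l h (ev l n (uL L)) - pB l h * bL l L =
        pB l h * (ev l n (uL L) - bL l L) + lD l h (ev l n (uL L) - bL l L) + lD l h (bL l L) := by
      rw [map_sub, mul_sub]; abel
    rw [e]
    refine add_mem (add_mem ?_ ?_) ?_
    · exact SLow_mono (by linarith) (pB_SLow h ih)
    · exact SLow_mono (by linarith) (lD_SLow h ih)
    · exact SLow_mono (by linarith) (lD_SLow h (bL_SLow L))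

lemma pC_SLow {l n : ℕ} {d d' : ℤ} (h : d < d') {F : PS n} (hF : F ∈ SLow l n d) :
    pC (agDeg l) d' F = 0 := by
  refine SLow_induction (P := fun F => pC (agDeg l) d' F = 0) ?_ ?_ ?_ ?_ hF
  · intro L hL; rw [pC_L, if_neg (by omega)]
  · simp
  · intro x y hx hy; simp [hx, hy]
  · intro c x hx; simp [hx]

lemma pC_pA {l n : ℕ} {d : ℤ} (X : QG n) (F : PS n) :
    pC (agDeg l) (agDeg l X + d) (pA X * F) = pA X * pC (agDeg l) d F := by
  have : (pC (agDeg l) (agDeg l X + d)) ∘ₗ (LinearMap.mulLeft ℂ (pA X)) =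
      (LinearMap.mulLeft ℂ (pA X)) ∘ₗ pC (agDeg l) d := by
    refine pS_ext fun L => ?_
    simp only [LinearMap.comp_apply, LinearMap.mulLeft_apply]
    rw [← pL_cons, pC_L, pC_L, wt_cons]
    by_cases h : wt (agDeg l) L = d <;> simp [h]
  exact LinearMap.congr_fun this F

lemma pC_bL {l n : ℕ} (L : List (QG n)) : pC (agDeg l) (wt (agDeg l) L) (bL l L) = bL l L := by
  induction L with
  | nil => rw [bL_nil, ← pL_nil, pC_L]; simp
  | cons h L ih =>
    rw [bL_cons, wt_cons, pB, add_mul, map_add, pC_pA, ih, ← Algebra.smul_def, map_smul]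
    by_cases hc : chi l h = 0
    · simp [hc]
    · rw [chi_deg l h hc, zero_add, ih]

/-- The symbol of degree `d`. -/
def sym (l n : ℕ) (d : ℤ) : UQ n →ₗ[ℂ] PS n := pC (agDeg l) d ∘ₗ ev l n

lemma sym_uL {l n : ℕ} (L : List (QG n)) : sym l n (wt (agDeg l) L) (uL L) = bL l L := by
  have h1 := pC_SLow (d' := wt (agDeg l) L) (by linarith) (ev_uL (l := l) L)
  rw [map_sub, pC_bL, sub_eq_zero] at h1
  exact h1

lemma ev_KF {l n : ℕ} {d : ℤ} {y : UQ n} (hy : y ∈ KF n l d) : ev l n y ∈ SLow l n d := by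
  refine KF_induction (P := fun y => ev l n y ∈ SLow l n d) ?_ ?_ ?_ ?_ hy
  · intro L hL
    rw [show ev l n (uL L) = (ev l n (uL L) - bL l L) + bL l L by abel]
    exact add_mem (SLow_mono (by linarith) (ev_uL L)) (SLow_mono hL (bL_SLow L))
  · simp
  · intro x y hx hy; rw [map_add]; exact add_mem hx hy
  · intro c x hx; rw [map_smul]; exact Submodule.smul_mem _ _ hx

lemma sym_low {l n : ℕ} {d d' : ℤ} (h : d < d') {y : UQ n} (hy : y ∈ KF n l d) :
    sym l n d' y = 0 := pC_SLow h (ev_KF hy)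

lemma sym_mul {l n : ℕ} {d d' : ℤ} {x y : UQ n} (hx : x ∈ KF n l d) (hy : y ∈ KF n l d') :
    sym l n (d + d') (x * y) = sym l n d x * sym l n d' y := by
  refine KF_induction (P := fun x => sym l n (d + d') (x * y) = sym l n d x * sym l n d' y)
    ?_ ?_ ?_ ?_ hx
  · intro L hL
    refine KF_induction (P := fun y => sym l n (d + d') (uL L * y) =
      sym l n d (uL L) * sym l n d' y) ?_ ?_ ?_ ?_ hy
    · intro M hM
      rcases lt_or_eq_of_le hL with h1 | h1
      · rw [sym_low h1 (uL_mem_KF L le_rfl), zero_mul, ← uL_append]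
        refine sym_low (d := wt (agDeg l) (L ++ M)) ?_ (uL_mem_KF _ le_rfl)
        rw [wt_append]; linarith
      · rcases lt_or_eq_of_le hM with h2 | h2
        · rw [sym_low h2 (uL_mem_KF M le_rfl), mul_zero, ← uL_append]
          refine sym_low (d := wt (agDeg l) (L ++ M)) ?_ (uL_mem_KF _ le_rfl)
          rw [wt_append]; linarith
        · subst h1; subst h2
          rw [← uL_append, ← wt_append, sym_uL, sym_uL, sym_uL]
          simp [bL]
    · simp
    · intro x y hx hy; simp [mul_add, hx, hy]
    · intro c x hx; simp [hx]
  · simp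
  · intro x y hx hy; simp [add_mul, hx, hy]
  · intro c x hx; simp [hx]

lemma sym_ag {l n : ℕ} (X : QG n) : sym l n (agDeg l X) (agElem X) = pB l X := by
  have := sym_uL (l := l) [X]
  simpa using this

/-! ## Straightening of words -/

/-- Ordering key. -/
def key (l : ℕ) {n : ℕ} (X : QG n) : ℕ :=
  (if mT l X then Fintype.card (QG n) else 0) + (Fintype.equivFin (QG n) X).val

lemma key_inj (l : ℕ) {n : ℕ} {X Y : QG n} (h : key l X = key l Y) : X = Y := by
  unfold key at h
  have h1 := (Fintype.equivFin (QG n) X).isLt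
  have h2 := (Fintype.equivFin (QG n) Y).isLt
  apply (Fintype.equivFin (QG n)).injective
  apply Fin.ext
  split_ifs at h <;> omega

lemma key_mT (l : ℕ) {n : ℕ} {X Y : QG n} (h : key l X < key l Y) (hX : mT l X) : mT l Y := by
  unfold key at h
  have h2 := (Fintype.equivFin (QG n) Y).isLt
  rw [if_pos hX] at h
  by_contra hY
  rw [if_neg hY] at h
  omega

/-- The ordering relation on letters of a sorted word. -/
def rel (l : ℕ) {n : ℕ} (g h : QG n) : Prop := key l g < key l h ∨ (g = h ∧ g.1 = false)

lemma rel_trans (l : ℕ) {n : ℕ} {g h k : QG n} (h1 : rel l g h) (h2 : rel l h k) : rel l g k := by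
  rcases h1 with h1 | ⟨rfl, h1⟩
  · rcases h2 with h2 | ⟨rfl, h2⟩
    · exact Or.inl (h1.trans h2)
    · exact Or.inl h1
  · exact h2

lemma rel_mT (l : ℕ) {n : ℕ} {g h : QG n} (h1 : rel l g h) (hg : mT l g) : mT l h := by
  rcases h1 with h1 | ⟨rfl, h1⟩
  · exact key_mT l h1 hg
  · exact hg

/-- Sorted words. -/
def Srt (l : ℕ) {n : ℕ} (L : List (QG n)) : Prop := L.Pairwise (rel l)

/-- Words containing a letter from `m`. -/
def HasM (l : ℕ) {n : ℕ} (L : List (QG n)) : Prop := ∃ x ∈ L, mT l x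

lemma HasM_tail {l n : ℕ} {h : QG n} {L : List (QG n)} (hs : Srt l (h :: L)) (hm : HasM l (h :: L))
    (hL : L ≠ []) : HasM l L := by
  obtain ⟨x, hx, hxm⟩ := hm
  rcases List.mem_cons.1 hx with rfl | hx
  · obtain ⟨y, hy⟩ := List.exists_mem_of_ne_nil L hL
    exact ⟨y, hy, rel_mT l ((List.pairwise_cons.1 hs).1 y hy) hxm⟩
  · exact ⟨x, hx, hxm⟩

/-- Shifted generators `a - χ(a)`. -/
def vv (l : ℕ) {n : ℕ} (X : QG n) : UQ n := agElem X - algebraMap ℂ (UQ n) (chi l X)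

/-- The constant in the commutator. -/
def cc (l : ℕ) {n : ℕ} (g h : QG n) : ℂ :=
  km g h * chi l (mulG g h) - sg g.1 h.1 * km h g * chi l (mulG h g)

lemma vv_comm (l : ℕ) {n : ℕ} (g h : QG n) :
    vv l g * vv l h = sg g.1 h.1 • (vv l h * vv l g) +
      (km g h • vv l (mulG g h) - (sg g.1 h.1 * km h g) • vv l (mulG h g) +
        algebraMap ℂ (UQ n) (cc l g h)) := by
  have h1 := ag_comm g h
  have h2 : vv l g * vv l h - sg g.1 h.1 • (vv l h * vv l g) =
      agElem g * agElem h - sg g.1 h.1 • (agElem h * agElem g) := by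
    simp only [vv, sub_mul, mul_sub, Algebra.algebraMap_eq_smul_one, smul_mul_assoc, mul_smul_comm,
      one_mul, mul_one]
    rcases hg : g.1 with _ | _
    · simp only [sg_ff]; module
    · rcases hh : h.1 with _ | _
      · simp only [sg_fr]; module
      · simp [chi_odd l g hg, chi_odd l h hh]
  rw [h1, sub_eq_iff_eq_add'] at h2
  rw [h2]
  simp only [vv, cc, Algebra.algebraMap_eq_smul_one]
  module

lemma cc_deg (l : ℕ) {n : ℕ} (g h : QG n) (hc : cc l g h ≠ 0) : agDeg l g + agDeg l h = 2 := by
  unfold cc at hc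
  by_cases h1 : km g h * chi l (mulG g h) = 0
  · rw [h1, zero_sub, neg_ne_zero] at hc
    have h2 : km h g ≠ 0 := by rintro h0; simp [h0] at hc
    have h3 : chi l (mulG h g) ≠ 0 := by rintro h0; simp [h0] at hc
    have h4 := mulG_deg l h g h2
    rw [chi_deg l _ h3] at h4; linarith
  · have h2 : km g h ≠ 0 := by rintro h0; simp [h0] at h1
    have h3 : chi l (mulG g h) ≠ 0 := by rintro h0; simp [h0] at h1
    have h4 := mulG_deg l g h h2
    rw [chi_deg l _ h3] at h4; linarith

lemma mT_deg {l n : ℕ} {g : QG n} (h : mT l g) : agDeg l g ≤ 0 := by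
  unfold mT at h; unfold agDeg; omega

lemma mT_mulG {l n : ℕ} {g h : QG n} (hk : km g h ≠ 0) (hg : mT l g) (hh : mT l h) :
    mT l (mulG g h) := by
  unfold km kd at hk
  split_ifs at hk with h1
  · simp only [mT, mulG, h1] at *; omega
  · simp at hk

/-- Words in the shifted generators. -/
def vL (l : ℕ) {n : ℕ} (L : List (QG n)) : UQ n := (L.map (vv l)).prod

@[simp] lemma vL_nil (l : ℕ) {n : ℕ} : vL l ([] : List (QG n)) = 1 := rfl
@[simp] lemma vL_cons (l : ℕ) {n : ℕ} (x : QG n) (L : List (QG n)) :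
    vL l (x :: L) = vv l x * vL l L := by simp [vL]

/-- Spans of sorted words with constraints. -/
def SS (l n : ℕ) (N : ℕ) (d : ℤ) (T : Prop) : Submodule ℂ (UQ n) :=
  Submodule.span ℂ (vL l '' {L | Srt l L ∧ L.length ≤ N ∧ wt (agDeg l) L ≤ d ∧ (T → HasM l L)})

lemma SS_mono {l n N N' : ℕ} {d d' : ℤ} {T T' : Prop} (hN : N ≤ N') (hd : d ≤ d') (hT : T' → T) :
    SS l n N d T ≤ SS l n N' d' T' :=
  Submodule.span_mono (Set.image_mono (by
    rintro L ⟨h1, h2, h3, h4⟩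
    exact ⟨h1, h2.trans hN, h3.trans hd, fun h => h4 (hT h)⟩))

lemma SS_vL {l n N : ℕ} {d : ℤ} {T : Prop} {L : List (QG n)} (h1 : Srt l L) (h2 : L.length ≤ N)
    (h3 : wt (agDeg l) L ≤ d) (h4 : T → HasM l L) : vL l L ∈ SS l n N d T :=
  Submodule.subset_span ⟨L, ⟨h1, h2, h3, h4⟩, rfl⟩

lemma SS_mul {l n N N' : ℕ} {d d' : ℤ} {T T' : Prop} (u : UQ n)
    (h : ∀ L, Srt l L → L.length ≤ N → wt (agDeg l) L ≤ d → (T → HasM l L) →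
      u * vL l L ∈ SS l n N' d' T') {y : UQ n} (hy : y ∈ SS l n N d T) :
    u * y ∈ SS l n N' d' T' := by
  unfold SS at hy
  induction hy using Submodule.span_induction with
  | mem x hx => obtain ⟨L, ⟨h1, h2, h3, h4⟩, rfl⟩ := hx; exact h L h1 h2 h3 h4
  | zero => simp
  | add x y _ _ hx hy => rw [mul_add]; exact add_mem hx hy
  | smul c x _ hx => rw [mul_smul_comm]; exact Submodule.smul_mem _ _ hx

/-- Insertion statement. -/
def InsS (l n : ℕ) (N : ℕ) : Prop :=
  ∀ (g : QG n) (L : List (QG n)), Srt l L → L.length ≤ N →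
    ∃ (c : ℂ) (M : List (QG n)), (c = 0 ∨ (Srt l M ∧ M.Perm (g :: L))) ∧
      vv l g * vL l L - c • vL l M ∈
        SS l n L.length (agDeg l g + wt (agDeg l) L) (HasM l L ∨ L = [])

lemma wt_perm {n : ℕ} {M : Type*} [AddCommMonoid M] (w : QG n → M) {L L' : List (QG n)}
    (h : L.Perm L') : wt w L = wt w L' := (h.map w).sum_eq

lemma HasM_perm {l n : ℕ} {L L' : List (QG n)} (h : L.Perm L') (h1 : HasM l L) : HasM l L' := by
  obtain ⟨x, hx, hm⟩ := h1
  exact ⟨x, h.mem_iff.1 hx, hm⟩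

lemma InsS_cor {l n N : ℕ} (h : InsS l n N) (g : QG n) (L : List (QG n)) (hL : Srt l L)
    (hN : L.length ≤ N) :
    vv l g * vL l L ∈ SS l n (L.length + 1) (agDeg l g + wt (agDeg l) L) (HasM l L) := by
  obtain ⟨c, M, h1, h2⟩ := h g L hL hN
  rw [show vv l g * vL l L = (vv l g * vL l L - c • vL l M) + c • vL l M by abel]
  refine add_mem (SS_mono (Nat.le_succ _) le_rfl Or.inl h2) ?_
  rcases h1 with rfl | ⟨h3, h4⟩
  · simp
  · refine Submodule.smul_mem _ _ (SS_vL h3 ?_ ?_ ?_)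
    · rw [h4.length_eq]; simp
    · rw [wt_perm _ h4, wt_cons]
    · rintro ⟨x, hx, hm⟩
      exact HasM_perm h4.symm ⟨x, List.mem_cons_of_mem _ hx, hm⟩

lemma rest_one {l n N : ℕ} (IH : InsS l n N) (g h : QG n) (L : List (QG n))
    (hL : Srt l L) (hN : L.length ≤ N) (hm : L = [] → mT l g → mT l h → km g h ≠ 0 →
      mT l (mulG g h)) (T : Prop) (hT : T → L ≠ [] → HasM l L)
    (hT2 : T → L = [] → mT l g ∧ mT l h) :
    km g h • (vv l (mulG g h) * vL l L) ∈
      SS l n (L.length + 1) (agDeg l g + agDeg l h + wt (agDeg l) L) T := by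
  by_cases hk : km g h = 0
  · simp [hk]
  refine Submodule.smul_mem _ _ ?_
  have hd := mulG_deg l g h hk
  by_cases hnil : L = []
  · subst hnil
    have e : vv l (mulG g h) * vL l [] = vL l [mulG g h] := by simp
    rw [e]
    refine SS_vL (by simp [Srt]) (by simp) (by simp [hd]) ?_
    intro ht
    obtain ⟨h1, h2⟩ := hT2 ht rfl
    exact ⟨_, List.mem_singleton_self _, hm rfl h1 h2 hk⟩
  · refine SS_mono le_rfl ?_ (fun ht => hT ht hnil) (InsS_cor IH (mulG g h) L hL hN)
    rw [hd]; linarith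

lemma rest_mem {l n N : ℕ} (IH : InsS l n N) (g h : QG n) (L : List (QG n))
    (hL : Srt l (h :: L)) (hN : L.length ≤ N) (hgh : mT l h → mT l g) :
    (km g h • vv l (mulG g h) - (sg g.1 h.1 * km h g) • vv l (mulG h g) +
        algebraMap ℂ (UQ n) (cc l g h)) * vL l L ∈
      SS l n (L.length + 1) (agDeg l g + agDeg l h + wt (agDeg l) L) (HasM l (h :: L)) := by
  have hL' : Srt l L := (List.pairwise_cons.1 hL).2
  have hT : HasM l (h :: L) → L ≠ [] → HasM l L := fun h1 h2 => HasM_tail hL h1 h2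
  have hT2 : HasM l (h :: L) → L = [] → mT l g ∧ mT l h := by
    rintro ⟨x, hx, hm⟩ rfl
    rw [List.mem_singleton] at hx
    subst hx
    exact ⟨hgh hm, hm⟩
  rw [add_mul, sub_mul, smul_mul_assoc, smul_mul_assoc, ← Algebra.smul_def, mul_smul]
  refine add_mem (sub_mem ?_ (Submodule.smul_mem _ _ ?_)) ?_
  · exact rest_one IH g h L hL' hN (fun _ h1 h2 h3 => mT_mulG h3 h1 h2) _ hT hT2
  · rw [add_comm (agDeg l g)]
    exact rest_one IH h g L hL' hN (fun _ h1 h2 h3 => mT_mulG h3 h1 h2) _ hT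
      (fun h1 h2 => (hT2 h1 h2).symm)
  · by_cases hc : cc l g h = 0
    · simp [hc]
    · have hd := cc_deg l g h hc
      refine Submodule.smul_mem _ _ (SS_vL hL' (by simp) (by rw [hd]; linarith) ?_)
      intro ht
      refine hT ht ?_
      intro h0
      obtain ⟨h1, h2⟩ := hT2 ht h0
      have := mT_deg h1
      have := mT_deg h2
      omega

lemma InsS_all (l n : ℕ) : ∀ N, InsS l n N := by
  intro N
  induction N with
  | zero =>
    intro g L hL hN
    have : L = [] := List.length_eq_zero_iff.1 (by omega)
    subst this
    exact ⟨1, [g], Or.inr ⟨by simp [Srt], List.Perm.refl _⟩, by simp⟩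
  | succ N IH =>
    intro g L hL hN
    rcases L with _ | ⟨h, L⟩
    · exact ⟨1, [g], Or.inr ⟨by simp [Srt], List.Perm.refl _⟩, by simp⟩
    have hN' : L.length ≤ N := by simpa using hN
    have hL' : Srt l L := (List.pairwise_cons.1 hL).2
    by_cases hr : rel l g h
    · refine ⟨1, g :: h :: L, Or.inr ⟨?_, List.Perm.refl _⟩, by simp⟩
      refine List.pairwise_cons.2 ⟨?_, hL⟩
      intro x hx
      rcases List.mem_cons.1 hx with rfl | hx
      · exact hr
      · exact rel_trans l hr ((List.pairwise_cons.1 hL).1 x hx)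
    have hgh : key l h ≤ key l g := by
      by_contra hlt
      exact hr (Or.inl (by omega))
    have hgm : mT l h → mT l g := by
      intro hm
      rcases lt_or_eq_of_le hgh with h1 | h1
      · exact key_mT l h1 hm
      · rwa [← key_inj l h1]
    have hrest := rest_mem IH g h L hL hN' hgm
    have hlen : (h :: L).length = L.length + 1 := rfl
    rw [hlen, wt_cons, ← add_assoc]
    have hT' : HasM l (h :: L) ∨ h :: L = [] → HasM l (h :: L) := by
      rintro (h1 | h1)
      · exact h1
      · simp at h1
    rw [vL_cons, ← mul_assoc, vv_comm, add_mul]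
    rcases lt_or_eq_of_le hgh with h1 | h1
    · obtain ⟨c, M, hM, hmem⟩ := IH g L hL' hN'
      refine ⟨sg g.1 h.1 * c, h :: M, ?_, ?_⟩
      · rcases hM with rfl | ⟨hM1, hM2⟩
        · left; simp
        · right
          refine ⟨List.pairwise_cons.2 ⟨?_, hM1⟩, (hM2.cons h).trans (List.Perm.swap _ _ _)⟩
          intro x hx
          rcases List.mem_cons.1 (hM2.mem_iff.1 hx) with rfl | hx
          · exact Or.inl h1
          · exact (List.pairwise_cons.1 hL).1 x hx
      · have e : sg g.1 h.1 • (vv l h * vv l g) * vL l L +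
            (km g h • vv l (mulG g h) - (sg g.1 h.1 * km h g) • vv l (mulG h g) +
              algebraMap ℂ (UQ n) (cc l g h)) * vL l L - (sg g.1 h.1 * c) • vL l (h :: M) =
            sg g.1 h.1 • (vv l h * (vv l g * vL l L - c • vL l M)) +
            (km g h • vv l (mulG g h) - (sg g.1 h.1 * km h g) • vv l (mulG h g) +
              algebraMap ℂ (UQ n) (cc l g h)) * vL l L := by
          rw [vL_cons, mul_sub, mul_smul_comm, smul_sub, smul_smul, smul_mul_assoc, mul_assoc]
          abel
        rw [e]
        refine add_mem (Submodule.smul_mem _ _ ?_) (SS_mono le_rfl le_rfl hT' hrest)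
        refine SS_mul _ ?_ hmem
        intro K hK1 hK2 hK3 hK4
        refine SS_mono (by omega) (by linarith) ?_ (InsS_cor IH h K hK1 (by omega))
        intro ht
        apply hK4
        by_cases hn : L = []
        · right; exact hn
        · left; exact HasM_tail hL (hT' ht) hn
    · have := key_inj l h1
      subst this
      have hodd : h.1 = true := by
        by_contra hb
        exact hr (Or.inr ⟨rfl, by simpa using hb⟩)
      refine ⟨0, [], Or.inl rfl, ?_⟩
      have hv := vv_comm l h h
      rw [zero_smul, sub_zero, ← add_mul, ← hv]
      rw [hodd, sg_tt] at hv
      rw [hodd, sg_tt] at hrest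
      have e : vv l h * vv l h = (2⁻¹ : ℂ) • (km h h • vv l (mulG h h) -
          ((-1 : ℂ) * km h h) • vv l (mulG h h) + algebraMap ℂ (UQ n) (cc l h h)) := by
        have h2 : (2 : ℂ) • (vv l h * vv l h) = (km h h • vv l (mulG h h) -
          ((-1 : ℂ) * km h h) • vv l (mulG h h) + algebraMap ℂ (UQ n) (cc l h h)) := by
          rw [two_smul]
          nth_rewrite 1 [hv]
          module
        rw [← h2, smul_smul]; norm_num
      rw [e, smul_mul_assoc]
      exact Submodule.smul_mem _ _ (SS_mono le_rfl le_rfl hT' hrest)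

/-- Spans of sorted words of bounded degree. -/
def SD (l n : ℕ) (d : ℤ) (T : Prop) : Submodule ℂ (UQ n) :=
  Submodule.span ℂ (vL l '' {L | Srt l L ∧ wt (agDeg l) L ≤ d ∧ (T → HasM l L)})

lemma SD_mono {l n : ℕ} {d d' : ℤ} {T T' : Prop} (hd : d ≤ d') (hT : T' → T) :
    SD l n d T ≤ SD l n d' T' :=
  Submodule.span_mono (Set.image_mono (by
    rintro L ⟨h1, h3, h4⟩
    exact ⟨h1, h3.trans hd, fun h => h4 (hT h)⟩))

lemma SS_le_SD {l n N : ℕ} {d : ℤ} {T : Prop} : SS l n N d T ≤ SD l n d T :=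
  Submodule.span_mono (Set.image_mono (by
    rintro L ⟨h1, _, h3, h4⟩
    exact ⟨h1, h3, h4⟩))

lemma SD_vv {l n : ℕ} {d : ℤ} {T : Prop} (g : QG n) {y : UQ n} (hy : y ∈ SD l n d T) :
    vv l g * y ∈ SD l n (agDeg l g + d) T := by
  unfold SD at hy
  induction hy using Submodule.span_induction with
  | mem x hx =>
    obtain ⟨L, ⟨h1, h3, h4⟩, rfl⟩ := hx
    exact SD_mono (by linarith) h4 (SS_le_SD (InsS_cor (InsS_all l n L.length) g L h1 le_rfl))
  | zero => simp
  | add x y _ _ hx hy => rw [mul_add]; exact add_mem hx hy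
  | smul c x _ hx => rw [mul_smul_comm]; exact Submodule.smul_mem _ _ hx

lemma ag_vv (l : ℕ) {n : ℕ} (g : QG n) :
    agElem g = vv l g + algebraMap ℂ (UQ n) (chi l g) := by simp [vv]

lemma SD_ag {l n : ℕ} {d : ℤ} {T : Prop} (g : QG n) {y : UQ n} (hy : y ∈ SD l n d T) :
    agElem g * y ∈ SD l n (agDeg l g + d) T := by
  rw [ag_vv l g, add_mul, ← Algebra.smul_def]
  refine add_mem (SD_vv g hy) ?_
  by_cases hc : chi l g = 0
  · simp [hc]
  · rw [chi_deg l g hc, zero_add]; exact Submodule.smul_mem _ _ hy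

lemma SD_uL {l n : ℕ} {d : ℤ} {T : Prop} (L : List (QG n)) {y : UQ n} (hy : y ∈ SD l n d T) :
    uL L * y ∈ SD l n (wt (agDeg l) L + d) T := by
  induction L with
  | nil => simpa using hy
  | cons g L ih => rw [uL_cons, mul_assoc, wt_cons, add_assoc]; exact SD_ag g ih

lemma KF_le_SD {l n : ℕ} {d : ℤ} : KF n l d ≤ SD l n d False := by
  intro y hy
  refine KF_induction (P := fun y => y ∈ SD l n d False) ?_ ?_ ?_ ?_ hy
  · intro L hL
    have h1 : (1 : UQ n) ∈ SD l n 0 False :=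
      Submodule.subset_span ⟨[], ⟨by simp [Srt], by simp, by simp⟩, by simp⟩
    have := SD_uL L h1
    rw [mul_one, add_zero] at this
    exact SD_mono hL id this
  · simp
  · intro x y hx hy; exact add_mem hx hy
  · intro c x hx; exact Submodule.smul_mem _ _ hx

lemma vv_KF {l n : ℕ} (g : QG n) : vv l g ∈ KF n l (agDeg l g) := by
  unfold vv
  refine sub_mem (ag_mem_KF g le_rfl) ?_
  by_cases hc : chi l g = 0
  · simp [hc]
  · rw [chi_deg l g hc, Algebra.algebraMap_eq_smul_one]
    exact Submodule.smul_mem _ _ (one_mem_KF n l 0 le_rfl)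

lemma vL_KF {l n : ℕ} (L : List (QG n)) : vL l L ∈ KF n l (wt (agDeg l) L) := by
  induction L with
  | nil => exact one_mem_KF n l _ (by simp)
  | cons g L ih => rw [vL_cons, wt_cons]; exact KF_mul (vv_KF g) ih

lemma SD_le_KF {l n : ℕ} {d : ℤ} {T : Prop} : SD l n d T ≤ KF n l d := by
  refine Submodule.span_le.2 ?_
  rintro _ ⟨L, ⟨_, h, _⟩, rfl⟩
  exact KF_mono h (vL_KF L)

lemma sym_one {l n : ℕ} : sym l n 0 1 = 1 := by
  have := sym_uL (l := l) (n := n) []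
  simpa using this

lemma sym_vv {l n : ℕ} (g : QG n) : sym l n (agDeg l g) (vv l g) = pA g := by
  unfold vv
  rw [map_sub, sym_ag, pB]
  by_cases hc : chi l g = 0
  · simp [hc]
  · rw [chi_deg l g hc, Algebra.algebraMap_eq_smul_one (A := UQ n), map_smul, sym_one,
      Algebra.algebraMap_eq_smul_one]
    simp

lemma sym_vL {l n : ℕ} (L : List (QG n)) : sym l n (wt (agDeg l) L) (vL l L) = pL L := by
  induction L with
  | nil => simpa using sym_one
  | cons g L ih => rw [vL_cons, wt_cons, sym_mul (vv_KF g) (vL_KF L), sym_vv, ih, pL_cons]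

lemma sym_vL' {l n : ℕ} (L : List (QG n)) {d : ℤ} (h : wt (agDeg l) L ≤ d) :
    sym l n d (vL l L) = if wt (agDeg l) L = d then pL L else 0 := by
  split_ifs with h1
  · rw [← h1, sym_vL]
  · exact sym_low (lt_of_le_of_ne h h1) (vL_KF L)

/-- Independence of sorted monomials. -/
lemma sorted_indep {l n : ℕ} (c : List (QG n) →₀ ℂ) (hc : ∀ L ∈ c.support, Srt l L)
    (h0 : c.sum (fun L a => a • pL L) = 0) : c = 0 := by
  by_contra hne
  obtain ⟨L, hL⟩ := Finsupp.support_nonempty_iff.2 hne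
  have h1 := congrArg (pC (fun x : QG n => ({x} : Multiset (QG n)))
    (wt (fun x : QG n => ({x} : Multiset (QG n))) L)) h0
  have hw : ∀ K : List (QG n), wt (fun x : QG n => ({x} : Multiset (QG n))) K = (K : Multiset _) := by
    intro K
    induction K with
    | nil => simp
    | cons x K ih => rw [wt_cons, ih]; simp
  rw [map_zero, Finsupp.sum, map_sum, Finset.sum_eq_single L] at h1
  · rw [map_smul, pC_L, if_pos rfl] at h1
    rcases smul_eq_zero.1 h1 with h2 | h2
    · exact (Finsupp.mem_support_iff.1 hL) h2
    · refine pL_ne_zero L ((hc L hL).imp ?_) h2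
      rintro x y (h3 | ⟨_, h3⟩) hxy
      · subst hxy; omega
      · exact h3
  · intro K hK hKL
    rw [map_smul, pC_L, if_neg, smul_zero]
    rw [hw, hw, Multiset.coe_eq_coe]
    intro hp
    refine hKL (List.Perm.eq_of_pairwise (le := rel l) ?_ (hc K hK) (hc L hL) hp)
    rintro a b _ _ (h3 | ⟨h3, _⟩) h4
    · rcases h4 with h4 | ⟨h4, _⟩
      · omega
      · exact h4.symm
    · exact h3
  · intro h2; exact absurd hL h2

lemma span_repr {l n : ℕ} {A : Set (List (QG n))} {y : UQ n}
    (hy : y ∈ Submodule.span ℂ (vL l '' A)) :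
    ∃ c : List (QG n) →₀ ℂ, (∀ L ∈ c.support, L ∈ A) ∧ y = c.sum (fun L a => a • vL l L) := by
  rw [Finsupp.mem_span_image_iff_linearCombination] at hy
  obtain ⟨c, hc, rfl⟩ := hy
  exact ⟨c, fun L hL => (Finsupp.mem_supported ℂ c).1 hc hL, rfl⟩

lemma sum_mem_of {l n : ℕ} (c : List (QG n) →₀ ℂ) (S : Submodule ℂ (UQ n))
    (h : ∀ L ∈ c.support, vL l L ∈ S) : c.sum (fun L a => a • vL l L) ∈ S :=
  Submodule.sum_mem _ fun L hL => Submodule.smul_mem _ _ (h L hL)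

lemma sym_sum {l n : ℕ} {d : ℤ} (c : List (QG n) →₀ ℂ)
    (hc : ∀ L ∈ c.support, wt (agDeg l) L ≤ d) :
    sym l n d (c.sum (fun L a => a • vL l L)) =
      (c.filter (fun L => wt (agDeg l) L = d)).sum (fun L a => a • pL L) := by
  rw [Finsupp.sum, map_sum, Finsupp.sum, Finsupp.support_filter, Finset.sum_filter]
  refine Finset.sum_congr rfl fun L hL => ?_
  rw [map_smul, sym_vL' L (hc L hL)]
  split_ifs with h
  · rw [Finsupp.filter_apply_pos (fun L => wt (agDeg l) L = d) _ h]
  · simp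

/-- Restriction to `p`. -/
def rr (l n : ℕ) : PS n →ₐ[ℂ] PS n :=
  pLift (fun X => if mT l X then 0 else pA X) (by
    intro x y
    split_ifs <;> simp [pA_comm x y])

lemma rr_A (l : ℕ) {n : ℕ} (X : QG n) : rr l n (pA X) = if mT l X then 0 else pA X := by
  simp [rr, pLift_A]

lemma rr_L (l : ℕ) {n : ℕ} (L : List (QG n)) : rr l n (pL L) = if HasM l L then 0 else pL L := by
  induction L with
  | nil => simp [HasM]
  | cons x L ih =>
    rw [pL_cons, map_mul, rr_A, ih]
    by_cases h1 : mT l x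
    · simp [HasM, h1]
    · by_cases h2 : HasM l L
      · have : HasM l (x :: L) := by
          obtain ⟨y, hy, hm⟩ := h2; exact ⟨y, List.mem_cons_of_mem _ hy, hm⟩
        simp [h2, this]
      · have : ¬ HasM l (x :: L) := by
          rintro ⟨y, hy, hm⟩
          rcases List.mem_cons.1 hy with rfl | hy
          · exact h1 hm
          · exact h2 ⟨y, hy, hm⟩
        simp [h1, h2, this]

lemma SD_step {l n : ℕ} {d : ℤ} {T : Prop} {y : UQ n} (hy : y ∈ SD l n d T)
    (h0 : sym l n d y = 0) : y ∈ SD l n (d - 1) T := by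
  obtain ⟨c, hc, rfl⟩ := span_repr hy
  rw [sym_sum c (fun L hL => (hc L hL).2.1)] at h0
  have h1 := sorted_indep (l := l) _ (fun L hL => (hc L (by
    rw [Finsupp.support_filter, Finset.mem_filter] at hL; exact hL.1)).1) h0
  refine sum_mem_of c _ fun L hL => ?_
  obtain ⟨h2, h3, h4⟩ := hc L hL
  refine Submodule.subset_span ⟨L, ⟨h2, ?_, h4⟩, rfl⟩
  by_contra hlt
  have h5 : wt (agDeg l) L = d := by omega
  have h6 := DFunLike.congr_fun h1 L
  rw [Finsupp.filter_apply_pos (fun L => wt (agDeg l) L = d) _ h5] at h6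
  exact (Finsupp.mem_support_iff.1 hL) h6

lemma SD_drop {l n : ℕ} {d : ℤ} {T : Prop} {y : UQ n} (hK : y ∈ KF n l d) (k : ℕ)
    (hy : y ∈ SD l n (d + k) T) : y ∈ SD l n d T := by
  induction k with
  | zero => simpa using hy
  | succ k ih =>
    apply ih
    have := SD_step hy (sym_low (by push_cast; omega) hK)
    rwa [show d + ((k + 1 : ℕ) : ℤ) - 1 = d + k by push_cast; ring] at this

lemma rr_sym_SD {l n : ℕ} {d : ℤ} {y : UQ n} (hy : y ∈ SD l n d True) :
    rr l n (sym l n d y) = 0 := by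
  unfold SD at hy
  induction hy using Submodule.span_induction with
  | mem x hx =>
    obtain ⟨L, ⟨_, h1, h2⟩, rfl⟩ := hx
    rw [sym_vL' L h1]
    split_ifs
    · rw [rr_L, if_pos (h2 trivial)]
    · simp
  | zero => simp
  | add x y _ _ hx hy => simp [hx, hy]
  | smul c x _ hx => simp [hx]

/-! ### Indices -/

lemma bidx_mod {n l : ℕ} (h : l ∣ n) (p : Fin (n / l)) (a : Fin l) :
    (bidx h p a).val % l = a.val := by
  simp [bidx, Nat.mod_eq_of_lt a.isLt]

lemma bidx_div {n l : ℕ} (h : l ∣ n) (p : Fin (n / l)) (a : Fin l) :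
    (bidx h p a).val / l = p.val := by
  have : 0 < l := a.pos
  simp [bidx, Nat.mul_add_div this, Nat.div_eq_of_lt a.isLt]

/-- Block index. -/
def blk {n l : ℕ} (h : l ∣ n) (i : Fin n) : Fin (n / l) :=
  ⟨i.val / l, Nat.div_lt_div_of_lt_of_dvd h i.isLt⟩

/-- Position in the block. -/
def ps {n l : ℕ} (hl : 0 < l) (i : Fin n) : Fin l := ⟨i.val % l, Nat.mod_lt _ hl⟩

lemma bidx_blk {n l : ℕ} (hl : 0 < l) (h : l ∣ n) (i : Fin n) : bidx h (blk h i) (ps hl i) = i := by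
  apply Fin.ext
  simp only [bidx, blk, ps]
  exact Nat.div_add_mod i.val l

lemma chi_bidx {n l : ℕ} (h : l ∣ n) (p q : Fin (n / l)) (a b : Fin l) :
    chi l (false, bidx h p a, bidx h q b) = if a.val = b.val + 1 ∧ p = q then 1 else 0 := by
  simp only [chi, bidx_mod, bidx_div, true_and, Fin.ext_iff]

lemma vv_mem_Ichi {n l : ℕ} (hl : 0 < l) (h : l ∣ n) (X : QG n) (hX : mT l X) :
    vv l X ∈ Ichi n l h := by
  obtain ⟨b, i, j⟩ := X
  apply Submodule.subset_span
  refine ⟨blk h i, blk h j, ps hl i, ps hl j, hX, ?_⟩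
  rw [← chi_bidx h, bidx_blk, bidx_blk]
  cases b
  · left; simp [vv, agElem]
  · right; simp [vv, agElem, chi]

lemma mSet_vv {n l : ℕ} (h : l ∣ n) {x : UQ n} (hx : x ∈ mSet n l h) :
    ∃ X : QG n, mT l X ∧ x = vv l X := by
  obtain ⟨p, q, a, b, hab, rfl | rfl⟩ := hx
  · refine ⟨(false, bidx h p a, bidx h q b), ?_, ?_⟩
    · simpa [mT, bidx_mod] using hab
    · rw [vv, chi_bidx]; rfl
  · refine ⟨(true, bidx h p a, bidx h q b), ?_, ?_⟩
    · simpa [mT, bidx_mod] using hab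
    · simp [vv, chi, agElem]

lemma Ichi_SD {n l : ℕ} (h : l ∣ n) {y : UQ n} (hy : y ∈ Ichi n l h) :
    ∃ d, y ∈ SD l n d True := by
  unfold Ichi at hy
  induction hy using Submodule.span_induction with
  | mem x hx =>
    obtain ⟨X, hX, rfl⟩ := mSet_vv h hx
    exact ⟨agDeg l X, Submodule.subset_span ⟨[X], ⟨by simp [Srt], by simp,
      fun _ => ⟨X, by simp, hX⟩⟩, by simp⟩⟩
  | zero => exact ⟨0, zero_mem _⟩
  | add x y _ _ hx hy =>
    obtain ⟨d, hd⟩ := hx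
    obtain ⟨d', hd'⟩ := hy
    exact ⟨max d d', add_mem (SD_mono (le_max_left _ _) id hd) (SD_mono (le_max_right _ _) id hd')⟩
  | smul u x _ hx =>
    obtain ⟨d, hd⟩ := hx
    rw [smul_eq_mul]
    have hu := uL_span u
    induction hu using Submodule.span_induction with
    | mem u hu =>
      obtain ⟨L, rfl⟩ := hu
      exact ⟨_, SD_uL L hd⟩
    | zero => exact ⟨0, by simp⟩
    | add u v _ _ hx hy =>
      obtain ⟨d, hd⟩ := hx
      obtain ⟨d', hd'⟩ := hy
      refine ⟨max d d', ?_⟩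
      rw [add_mul]
      exact add_mem (SD_mono (le_max_left _ _) id hd) (SD_mono (le_max_right _ _) id hd')
    | smul c u _ hx =>
      obtain ⟨d, hd⟩ := hx
      exact ⟨d, by rw [smul_mul_assoc]; exact Submodule.smul_mem _ _ hd⟩

/-- Symbols of elements of the ideal vanish on `p`. -/
lemma rr_sym_Ichi {n l : ℕ} (h : l ∣ n) {d : ℤ} {y : UQ n} (hy : y ∈ Ichi n l h)
    (hK : y ∈ KF n l d) : rr l n (sym l n d y) = 0 := by
  obtain ⟨D, hD⟩ := Ichi_SD h hy
  refine rr_sym_SD (SD_drop hK (D - d).toNat (SD_mono ?_ id hD))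
  omega

lemma vL_Ichi {n l : ℕ} (hl : 0 < l) (h : l ∣ n) (L : List (QG n)) (hL : Srt l L)
    (hm : HasM l L) : vL l L ∈ Ichi n l h := by
  induction L with
  | nil => obtain ⟨x, hx, _⟩ := hm; simp at hx
  | cons g L ih =>
    rw [vL_cons]
    by_cases hn : L = []
    · subst hn
      obtain ⟨x, hx, hx2⟩ := hm
      rw [List.mem_singleton] at hx
      subst hx
      simpa using vv_mem_Ichi hl h x hx2
    · exact (Ichi n l h).smul_mem _ (ih (List.pairwise_cons.1 hL).2 (HasM_tail hL hm hn))

/-- If the symbol vanishes on `p`, then the element has lower degree modulo the ideal. -/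
lemma ker_rr_sym {n l : ℕ} (hl : 0 < l) (h : l ∣ n) {d : ℤ} {y : UQ n} (hK : y ∈ KF n l d)
    (h0 : rr l n (sym l n d y) = 0) :
    ∃ z ∈ KF n l (d - 1), y - z ∈ Ichi n l h := by
  obtain ⟨c, hc, rfl⟩ := span_repr (KF_le_SD hK)
  rw [sym_sum c (fun L hL => (hc L hL).2.1), Finsupp.sum, map_sum] at h0
  have h2 : ((c.filter (fun L => wt (agDeg l) L = d)).filter (fun L => ¬ HasM l L)).sum
      (fun L a => a • pL L) = 0 := by
    rw [← h0, Finsupp.sum, Finsupp.support_filter, Finset.sum_filter]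
    refine Finset.sum_congr rfl fun L hL => ?_
    rw [map_smul, rr_L]
    by_cases hm : HasM l L
    · simp [hm]
    · rw [if_pos hm, if_neg hm, Finsupp.filter_apply_pos (fun L => ¬ HasM l L) _ hm]
  have h3 := sorted_indep (l := l) _ (fun L hL => (hc L (by
    rw [Finsupp.support_filter, Finset.mem_filter, Finsupp.support_filter,
      Finset.mem_filter] at hL; exact hL.1.1)).1) h2
  have h4 : c.sum (fun L a => a • vL l L) ∈
      KF n l (d - 1) ⊔ (Ichi n l h).restrictScalars ℂ := by
    refine sum_mem_of c _ fun L hL => ?_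
    obtain ⟨h5, h6, _⟩ := hc L hL
    by_cases hm : HasM l L
    · exact Submodule.mem_sup_right (vL_Ichi hl h L h5 hm)
    · refine Submodule.mem_sup_left (KF_mono ?_ (vL_KF L))
      by_contra hlt
      have h7 : wt (agDeg l) L = d := by omega
      have h8 := DFunLike.congr_fun h3 L
      rw [Finsupp.filter_apply_pos (fun L => ¬ HasM l L) _ hm,
        Finsupp.filter_apply_pos (fun L => wt (agDeg l) L = d) _ h7] at h8
      exact (Finsupp.mem_support_iff.1 hL) h8
  obtain ⟨z, hz, w, hw, e⟩ := Submodule.mem_sup.1 h4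
  exact ⟨z, hz, by rw [← e, add_sub_cancel_left]; exact hw⟩

/-! ## Commutators and their symbols -/

/-- Parity twist. -/
def tw {n : ℕ} (σ : UQ n →ₐ[ℂ] UQ n) (b : Bool) : UQ n →ₐ[ℂ] UQ n :=
  if b then σ else AlgHom.id ℂ _

/-- The hypothesis on the parity involution. -/
def IsPar {n : ℕ} (σ : UQ n →ₐ[ℂ] UQ n) : Prop :=
  ∀ X : QG n, σ (agElem X) = sg true X.1 • agElem X

lemma tw_ag {n : ℕ} {σ : UQ n →ₐ[ℂ] UQ n} (hσ : IsPar σ) (b : Bool) (X : QG n) :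
    tw σ b (agElem X) = sg b X.1 • agElem X := by
  cases b
  · simp [tw]
  · simp only [tw, if_true]; exact hσ X

/-- Supercommutator with a generator. -/
def br {n : ℕ} (σ : UQ n →ₐ[ℂ] UQ n) (Y : QG n) : UQ n →ₗ[ℂ] UQ n :=
  LinearMap.mulLeft ℂ (agElem Y) - LinearMap.mulRight ℂ (agElem Y) ∘ₗ (tw σ Y.1).toLinearMap

lemma br_apply {n : ℕ} (σ : UQ n →ₐ[ℂ] UQ n) (Y : QG n) (y : UQ n) :
    br σ Y y = agElem Y * y - tw σ Y.1 y * agElem Y := rfl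

lemma br_mul {n : ℕ} {σ : UQ n →ₐ[ℂ] UQ n} (hσ : IsPar σ) (Y h : QG n) (y : UQ n) :
    br σ Y (agElem h * y) = (km Y h • agElem (mulG Y h) -
      (sg Y.1 h.1 * km h Y) • agElem (mulG h Y)) * y + sg Y.1 h.1 • (agElem h * br σ Y y) := by
  rw [← ag_comm, br_apply, br_apply, map_mul, tw_ag hσ, sub_mul, mul_sub, smul_sub]
  simp only [smul_mul_assoc, mul_assoc]
  abel

/-- The classical adjoint derivation. -/
def adD (l : ℕ) {n : ℕ} (Y : QG n) : PS n →ₗ[ℂ] PS n :=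
  pDer fun Z => km Y Z • pB l (mulG Y Z) - (sg Y.1 Z.1 * km Z Y) • pB l (mulG Z Y)

lemma adD_mul (l : ℕ) {n : ℕ} (Y h : QG n) (F : PS n) :
    adD l Y (pA h * F) = (km Y h • pB l (mulG Y h) - (sg Y.1 h.1 * km h Y) • pB l (mulG h Y)) * F +
      sg Y.1 h.1 • (pA h * adD l Y F) := by
  rw [adD, pDer_mul Y.1]
  intro Z
  refine ((HP_B l (mulG Y Z)).smul _).sub ?_
  have := (HP_B l (mulG Z Y)).smul (sg Y.1 Z.1 * km Z Y)
  rwa [show (mulG Z Y).1 = xor Y.1 Z.1 by simp [mulG, Bool.xor_comm]] at this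

lemma adD_mulB (l : ℕ) {n : ℕ} (Y h : QG n) (F : PS n) :
    adD l Y (pB l h * F) =
      (km Y h • pB l (mulG Y h) - (sg Y.1 h.1 * km h Y) • pB l (mulG h Y)) * F +
      sg Y.1 h.1 • (pB l h * adD l Y F) := by
  conv_lhs => rw [pB, add_mul, map_add, adD_mul, ← Algebra.smul_def, map_smul]
  conv_rhs => rw [pB.eq_1 l h, add_mul, smul_add, ← Algebra.smul_def]
  rcases hb : h.1 with _ | _
  · simp [add_assoc]
  · simp [chi_odd l h hb]

lemma br_KF_word {n l : ℕ} {σ : UQ n →ₐ[ℂ] UQ n} (hσ : IsPar σ) (Y : QG n) (L : List (QG n)) :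
    br σ Y (uL L) ∈ KF n l (wt (agDeg l) L + agDeg l Y - 2) ∧
      sym l n (wt (agDeg l) L + agDeg l Y - 2) (br σ Y (uL L)) = adD l Y (bL l L) := by
  induction L with
  | nil => simp [br_apply, adD]
  | cons h L ih =>
    have hq : ∀ A B : QG n, km A B ≠ 0 → agDeg l A + agDeg l B = agDeg l Y + agDeg l h →
        agElem (mulG A B) * uL L ∈ KF n l (wt (agDeg l) (h :: L) + agDeg l Y - 2) ∧
        sym l n (wt (agDeg l) (h :: L) + agDeg l Y - 2) (agElem (mulG A B) * uL L) =
          pB l (mulG A B) * bL l L := by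
      intro A B hk he
      have hd := mulG_deg l A B hk
      have e : wt (agDeg l) (h :: L) + agDeg l Y - 2 =
        agDeg l (mulG A B) + wt (agDeg l) L := by rw [wt_cons, hd, he]; ring
      rw [e, ← uL_cons, ← wt_cons]
      exact ⟨uL_mem_KF _ le_rfl, by rw [sym_uL, bL_cons]⟩
    have hq' : ∀ A B : QG n, agDeg l A + agDeg l B = agDeg l Y + agDeg l h →
        km A B • (agElem (mulG A B) * uL L) ∈ KF n l (wt (agDeg l) (h :: L) + agDeg l Y - 2) ∧
        sym l n (wt (agDeg l) (h :: L) + agDeg l Y - 2) (km A B • (agElem (mulG A B) * uL L)) =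
          km A B • (pB l (mulG A B) * bL l L) := by
      intro A B he
      by_cases hk : km A B = 0
      · simp [hk]
      · obtain ⟨h1, h2⟩ := hq A B hk he
        exact ⟨Submodule.smul_mem _ _ h1, by rw [map_smul, h2]⟩
    obtain ⟨a1, a2⟩ := hq' Y h rfl
    obtain ⟨b1, b2⟩ := hq' h Y (add_comm _ _)
    have e : wt (agDeg l) (h :: L) + agDeg l Y - 2 =
        agDeg l h + (wt (agDeg l) L + agDeg l Y - 2) := by rw [wt_cons]; ring
    have c1 : agElem h * br σ Y (uL L) ∈ KF n l (wt (agDeg l) (h :: L) + agDeg l Y - 2) := by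
      rw [e]; exact KF_mul (ag_mem_KF h le_rfl) ih.1
    have c2 : sym l n (wt (agDeg l) (h :: L) + agDeg l Y - 2) (agElem h * br σ Y (uL L)) =
        pB l h * adD l Y (bL l L) := by
      rw [e, sym_mul (ag_mem_KF h le_rfl) ih.1, ih.2, sym_ag]
    rw [uL_cons, br_mul hσ, bL_cons, adD_mulB]
    simp only [sub_mul, smul_mul_assoc, mul_smul (sg Y.1 h.1)]
    refine ⟨add_mem (sub_mem a1 (Submodule.smul_mem _ _ b1)) (Submodule.smul_mem _ _ c1), ?_⟩
    rw [map_add, map_sub, a2, map_smul (sym l n _) (sg Y.1 h.1) (agElem h * _), c2,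
      map_smul (sym l n _) (sg Y.1 h.1) (km h Y • _), b2]

lemma br_KF {n l : ℕ} {σ : UQ n →ₐ[ℂ] UQ n} (hσ : IsPar σ) (Y : QG n) {d : ℤ} {y : UQ n}
    (hy : y ∈ KF n l d) :
    br σ Y y ∈ KF n l (d + agDeg l Y - 2) ∧
      sym l n (d + agDeg l Y - 2) (br σ Y y) = adD l Y (sym l n d y) := by
  refine KF_induction (P := fun y => br σ Y y ∈ KF n l (d + agDeg l Y - 2) ∧
      sym l n (d + agDeg l Y - 2) (br σ Y y) = adD l Y (sym l n d y)) ?_ ?_ ?_ ?_ hy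
  · intro L hL
    obtain ⟨h1, h2⟩ := br_KF_word (l := l) hσ Y L
    refine ⟨KF_mono (by linarith) h1, ?_⟩
    rcases lt_or_eq_of_le hL with h3 | h3
    · rw [sym_low (by linarith) h1, sym_low h3 (uL_mem_KF L le_rfl), map_zero]
    · subst h3; rw [h2, sym_uL]
  · simp
  · rintro x y ⟨h1, h2⟩ ⟨h3, h4⟩
    exact ⟨by rw [map_add]; exact add_mem h1 h3, by simp [h2, h4]⟩
  · rintro c x ⟨h1, h2⟩
    exact ⟨by rw [map_smul]; exact Submodule.smul_mem _ _ h1, by simp [h2]⟩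

/-- Restriction of `x + χ(x)`. -/
def qq (l : ℕ) {n : ℕ} (X : QG n) : PS n := rr l n (pB l X)

lemma qq_m {l n : ℕ} {X : QG n} (h : mT l X) : qq l X = algebraMap ℂ (PS n) (chi l X) := by
  simp [qq, pB, rr_A, h]

lemma qq_p {l n : ℕ} {X : QG n} (h : ¬ mT l X) : qq l X = pA X := by
  have : chi l X = 0 := by by_contra h0; exact h (chi_mT l X h0)
  simp [qq, pB, rr_A, h, this]

lemma HP_q {l n : ℕ} (X : QG n) : HP X.1 (qq l X) := by
  by_cases h : mT l X
  · rw [qq_m h]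
    rcases hb : X.1 with _ | _
    · exact HP.const _
    · rw [chi_odd l X hb, map_zero]; exact HP.zero _
  · rw [qq_p h]; exact HP.pA X

/-- Coefficients of the derivation `θ_Y`. -/
def thc (l : ℕ) {n : ℕ} (Y Z : QG n) : PS n :=
  if mT l Z then 0 else km Y Z • qq l (mulG Y Z) - (sg Y.1 Z.1 * km Z Y) • qq l (mulG Z Y)

/-- The induced derivation. -/
def theta (l : ℕ) {n : ℕ} (Y : QG n) : PS n →ₗ[ℂ] PS n := pDer (thc l Y)

lemma theta_mul (l : ℕ) {n : ℕ} (Y h : QG n) (F : PS n) :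
    theta l Y (pA h * F) = thc l Y h * F + sg Y.1 h.1 • (pA h * theta l Y F) := by
  rw [theta, pDer_mul Y.1]
  intro Z
  unfold thc
  split_ifs with hz
  · exact HP.zero _
  refine ((HP_q (mulG Y Z)).smul _).sub ?_
  have := (HP_q (l := l) (mulG Z Y)).smul (sg Y.1 Z.1 * km Z Y)
  rwa [show (mulG Z Y).1 = xor Y.1 Z.1 by simp [mulG, Bool.xor_comm]] at this

lemma rr_adD {l n : ℕ} {Y : QG n} (hY : mT l Y) (F : PS n) :
    rr l n (adD l Y F) = theta l Y (rr l n F) := by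
  have key : (rr l n).toLinearMap ∘ₗ adD l Y = theta l Y ∘ₗ (rr l n).toLinearMap := by
    refine pS_ext fun L => ?_
    simp only [LinearMap.comp_apply, AlgHom.toLinearMap_apply]
    induction L with
    | nil => simp [adD, theta]
    | cons h L ih =>
      rw [pL_cons, adD_mul]
      simp only [map_add, map_mul, map_smul, map_sub, ih]
      rw [rr_A]
      by_cases hm : mT l h
      · rw [if_pos hm]
        have hc : cc l Y h = 0 := by
          by_contra h0
          have := cc_deg l Y h h0
          have := mT_deg hY
          have := mT_deg hm
          omega
        have h1 : km Y h • qq l (mulG Y h) - (sg Y.1 h.1 * km h Y) • qq l (mulG h Y) =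
            algebraMap ℂ (PS n) (cc l Y h) := by
          have a1 : km Y h • qq l (mulG Y h) =
              km Y h • algebraMap ℂ (PS n) (chi l (mulG Y h)) := by
            by_cases hk : km Y h = 0
            · simp [hk]
            · rw [qq_m (mT_mulG hk hY hm)]
          have a2 : km h Y • qq l (mulG h Y) =
              km h Y • algebraMap ℂ (PS n) (chi l (mulG h Y)) := by
            by_cases hk : km h Y = 0
            · simp [hk]
            · rw [qq_m (mT_mulG hk hm hY)]
          rw [a1, mul_smul, a2, cc]
          simp only [Algebra.algebraMap_eq_smul_one]
          module
        rw [hc, map_zero] at h1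
        simp only [qq] at h1
        rw [h1]; simp
      · rw [if_neg hm, theta_mul, thc, if_neg hm]
        rfl
  exact LinearMap.congr_fun key F

/-- `W`-elements in terms of `br`. -/
def WC {n l : ℕ} (h : l ∣ n) (σ : UQ n →ₐ[ℂ] UQ n) (y : UQ n) : Prop :=
  ∀ Y : QG n, mT l Y → br σ Y y ∈ Ichi n l h

lemma Wcond_iff {n l : ℕ} (hl : 0 < l) (h : l ∣ n) (σ : UQ n →ₐ[ℂ] UQ n) (y : UQ n) :
    Wcond h σ y ↔ WC h σ y := by
  constructor
  · rintro hw ⟨b, i, j⟩ hY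
    have := hw (blk h i) (blk h j) (ps hl i) (ps hl j) hY
    rw [bidx_blk, bidx_blk] at this
    cases b
    · simpa [br_apply, agElem, tw] using this.1
    · simpa [br_apply, agElem, tw] using this.2
  · intro hw p q a b hab
    have hm : ∀ c : Bool, mT l ((c, bidx h p a, bidx h q b) : QG n) := by
      intro c; simpa [mT, bidx_mod] using hab
    have h1 := hw _ (hm false)
    have h2 := hw _ (hm true)
    constructor
    · simpa [br_apply, agElem, tw] using h1
    · simpa [br_apply, agElem, tw] using h2

lemma WC_theta {n l : ℕ} (h : l ∣ n) {σ : UQ n →ₐ[ℂ] UQ n} (hσ : IsPar σ) {y : UQ n} {d : ℤ}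
    (hw : WC h σ y) (hy : y ∈ KF n l d) (Y : QG n) (hY : mT l Y) :
    theta l Y (rr l n (sym l n d y)) = 0 := by
  obtain ⟨h1, h2⟩ := br_KF (l := l) hσ Y hy
  have := rr_sym_Ichi h (hw Y hY) h1
  rwa [h2, rr_adD hY] at this

/-! ## Injectivity on the slice -/

/-- Counts letters outside of the slice. -/
def ns (l : ℕ) {n : ℕ} (X : QG n) : ℕ := if X.2.1.val % l = 0 then 0 else 1

/-- Powers of the ideal of the slice. -/
def JJ (l n : ℕ) (k : ℕ) : Submodule ℂ (PS n) :=
  Submodule.span ℂ { F | ∃ L : List (QG n), k ≤ wt (ns l) L ∧ F = pL L }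

lemma pL_JJ {l n : ℕ} {k : ℕ} (L : List (QG n)) (h : k ≤ wt (ns l) L) : pL L ∈ JJ l n k :=
  Submodule.subset_span ⟨L, h, rfl⟩

lemma JJ_le {l n : ℕ} {k k' : ℕ} (T : PS n →ₗ[ℂ] PS n)
    (hT : ∀ L, k ≤ wt (ns l) L → T (pL L) ∈ JJ l n k') {F : PS n} (hF : F ∈ JJ l n k) :
    T F ∈ JJ l n k' := by
  unfold JJ at hF
  induction hF using Submodule.span_induction with
  | mem x hx => obtain ⟨L, h1, rfl⟩ := hx; exact hT L h1
  | zero => simp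
  | add x y _ _ hx hy => rw [map_add]; exact add_mem hx hy
  | smul c x _ hx => rw [map_smul]; exact Submodule.smul_mem _ _ hx

lemma JJ_mono {l n : ℕ} {k k' : ℕ} (h : k' ≤ k) {F : PS n} (hF : F ∈ JJ l n k) :
    F ∈ JJ l n k' := JJ_le (k := k) LinearMap.id (fun L hL => pL_JJ L (h.trans hL)) hF

lemma pA_JJ {l n : ℕ} {k : ℕ} (X : QG n) {F : PS n} (hF : F ∈ JJ l n k) :
    pA X * F ∈ JJ l n (k + ns l X) :=
  JJ_le (LinearMap.mulLeft ℂ (pA X)) (fun L hL => by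
    rw [LinearMap.mulLeft_apply, ← pL_cons]
    exact pL_JJ _ (by rw [wt_cons]; omega)) hF

lemma pD_JJ {l n : ℕ} {k : ℕ} (X : QG n) (hX : ns l X = 0) {F : PS n} (hF : F ∈ JJ l n k) :
    pD X F ∈ JJ l n k := by
  refine JJ_le (pD X) (fun L hL => JJ_mono hL ?_) hF
  clear hL hF
  induction L with
  | nil => simp
  | cons h L ih =>
    rw [pL_cons, pD_mul, wt_cons]
    refine add_mem ?_ (Submodule.smul_mem _ _ ?_)
    · split_ifs with hx
      · subst hx; rw [hX, zero_add]; exact pL_JJ L le_rfl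
      · exact zero_mem _
    · rw [add_comm]; exact pA_JJ h ih

lemma pD_rr {l n : ℕ} (X : QG n) (hX : mT l X) (F : PS n) : pD X (rr l n F) = 0 := by
  have : pD X ∘ₗ (rr l n).toLinearMap = 0 := by
    refine pS_ext fun L => ?_
    simp only [LinearMap.comp_apply, AlgHom.toLinearMap_apply, rr_L, LinearMap.zero_apply]
    split_ifs with hm
    · simp
    · exact pD_L_notMem X L fun h => hm ⟨X, h, hX⟩
  exact LinearMap.congr_fun this F

lemma qq_JJ {l n : ℕ} {k : ℕ} (X : QG n) {F : PS n} (hF : F ∈ JJ l n k) :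
    qq l X * F ∈ JJ l n k := by
  by_cases h : mT l X
  · rw [qq_m h, ← Algebra.smul_def]; exact Submodule.smul_mem _ _ hF
  · rw [qq_p h]; exact JJ_mono (Nat.le_add_right _ _) (pA_JJ X hF)

lemma pD_theta {l n : ℕ} (hl : 0 < l) {k : ℕ} {F : PS n} (hr : rr l n F = F)
    (hth : ∀ Y : QG n, mT l Y → theta l Y F = 0) (hF : F ∈ JJ l n k) :
    ∀ (a : ℕ) (X : QG n), X.2.1.val % l = a → pD X F ∈ JJ l n k := by
  intro a
  induction a using Nat.strong_induction_on with
  | _ a ih =>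
  intro X hXa
  by_cases hXm : mT l X
  · rw [← hr, pD_rr X hXm]; exact zero_mem _
  rcases Nat.eq_zero_or_pos a with ha | ha
  · exact pD_JJ X (by simp [ns, hXa, ha]) hF
  obtain ⟨b, i, j⟩ := X
  simp only at hXa
  simp only [mT, not_lt] at hXm
  have hi : 0 < i.val := by
    rcases Nat.eq_zero_or_pos i.val with h0 | h0
    · rw [h0] at hXa; simp at hXa; omega
    · exact h0
  have hdm := Nat.div_add_mod i.val l
  have hal : a < l := hXa ▸ Nat.mod_lt _ hl
  have hi1 : i.val - 1 = (a - 1) + l * (i.val / l) := by omega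
  obtain ⟨i', hi'⟩ : ∃ i' : Fin n, i'.val = i.val - 1 := ⟨⟨i.val - 1, by omega⟩, rfl⟩
  have him : i'.val % l = a - 1 := by
    rw [hi', hi1, Nat.add_mul_mod_self_left, Nat.mod_eq_of_lt (by omega)]
  have hid : i'.val / l = i.val / l := by
    rw [hi', hi1, Nat.add_mul_div_left _ _ hl, Nat.div_eq_of_lt (by omega), zero_add]
  have hY : mT l ((b, j, i') : QG n) := by simp only [mT, him]; omega
  have h0 := hth _ hY
  rw [theta, pDer_apply, ← Finset.add_sum_erase _ _ (Finset.mem_univ ((b, i, j) : QG n))] at h0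
  have hX : thc l (b, j, i') ((b, i, j) : QG n) = algebraMap ℂ (PS n) (-sg b b) := by
    have hm1 : ¬ mT l ((b, i, j) : QG n) := by simp only [mT]; omega
    have hk1 : km ((b, j, i') : QG n) (b, i, j) = 0 := by
      simp only [km, kd, Fin.ext_iff]
      rw [if_neg]; omega
    have hk2 : km ((b, i, j) : QG n) (b, j, i') = 1 := by simp [km, kd]
    have hm2 : mT l (mulG ((b, i, j) : QG n) (b, j, i')) := by simp only [mT, mulG, him]; omega
    have hc : chi l (mulG ((b, i, j) : QG n) (b, j, i')) = 1 := by
      simp only [chi, mulG, him, hid]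
      rw [if_pos ⟨by simp, by omega, trivial⟩]
    rw [thc, if_neg hm1, hk1, hk2, qq_m hm2, hc]
    simp only [Algebra.algebraMap_eq_smul_one]
    module
  have hrest : ∑ Z ∈ Finset.univ.erase ((b, i, j) : QG n), thc l (b, j, i') Z * pD Z F ∈ JJ l n k := by
    refine Submodule.sum_mem _ fun Z hZ => ?_
    have hZ := Finset.ne_of_mem_erase hZ
    unfold thc
    split_ifs with hzm
    · simp
    rw [sub_mul, smul_mul_assoc, smul_mul_assoc]
    refine sub_mem ?_ ?_
    · by_cases hk : km ((b, j, i') : QG n) Z = 0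
      · simp [hk]
      · have : i' = Z.2.1 := by by_contra hne; exact hk (by simp [km, kd, hne])
        exact Submodule.smul_mem _ _ (qq_JJ _ (ih (a - 1) (by omega) Z (by rw [← this, him])))
    · by_cases hk : km Z ((b, j, i') : QG n) = 0
      · simp [hk]
      have hzj : Z.2.2 = j := by by_contra hne; exact hk (by simp [km, kd, hne])
      by_cases hm : mT l (mulG Z ((b, j, i') : QG n))
      · rw [qq_m hm]
        have hc : chi l (mulG Z ((b, j, i') : QG n)) = 0 := by
          unfold chi
          rw [if_neg]
          rintro ⟨h1, h2, h3⟩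
          simp only [mulG, him, hid] at h1 h2 h3
          apply hZ
          obtain ⟨z, zi, zj⟩ := Z
          simp only at h1 h2 h3 hzj
          have hz1 : z = b := by revert h1; cases z <;> cases b <;> simp
          have hz2 : zi = i := by
            apply Fin.ext
            have := Nat.div_add_mod zi.val l
            rw [h3, h2] at this
            omega
          rw [hz1, hz2, hzj]
        rw [hc]; simp
      · refine Submodule.smul_mem _ _ (qq_JJ _ (ih (Z.2.1.val % l) ?_ Z rfl))
        simp only [mT, mulG, him] at hm
        omega
  rw [hX] at h0
  rw [← Algebra.smul_def] at h0
  have h1 : (-sg b b) • pD (b, i, j) F ∈ JJ l n k := by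
    rw [eq_neg_of_add_eq_zero_left h0]; exact neg_mem hrest
  have h2 := Submodule.smul_mem (JJ l n k) (-sg b b) h1
  rwa [smul_smul, neg_mul_neg, sg_sq, one_smul] at h2

/-- The Euler operator of the normal directions. -/
def eul (l n : ℕ) : PS n →ₗ[ℂ] PS n := pDer fun X => (ns l X : ℂ) • pA X

lemma eul_L {l n : ℕ} (L : List (QG n)) : eul l n (pL L) = ((wt (ns l) L : ℕ) : ℂ) • pL L := by
  induction L with
  | nil => simp [eul]
  | cons h L ih =>
    rw [pL_cons, eul, pDer_mul false, ← eul, ih, wt_cons]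
    · rw [sg_ff, one_smul, mul_smul_comm, smul_mul_assoc]
      push_cast; module
    · intro x; rw [Bool.false_xor]; exact (HP.pA x).smul _

lemma pC_eul {l n : ℕ} (k : ℕ) (F : PS n) :
    pC (ns l) k (eul l n F) = (k : ℂ) • pC (ns l) k F := by
  have : pC (ns l) k ∘ₗ eul l n = (k : ℂ) • pC (ns l) k := by
    refine pS_ext fun L => ?_
    simp only [LinearMap.comp_apply, eul_L, map_smul, LinearMap.smul_apply, pC_L]
    split_ifs with h
    · rw [h]
    · simp
  exact LinearMap.congr_fun this F

lemma pC_JJ {l n : ℕ} {j k : ℕ} (h : j < k) {F : PS n} (hF : F ∈ JJ l n k) :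
    pC (ns l) j F = 0 := by
  unfold JJ at hF
  induction hF using Submodule.span_induction with
  | mem x hx => obtain ⟨L, h1, rfl⟩ := hx; rw [pC_L, if_neg (by omega)]
  | zero => simp
  | add x y _ _ hx hy => simp [hx, hy]
  | smul c x _ hx => simp [hx]

lemma JJ_succ {l n : ℕ} {k : ℕ} {F : PS n} (hF : F ∈ JJ l n k) :
    F - pC (ns l) k F ∈ JJ l n (k + 1) := by
  refine JJ_le (LinearMap.id - pC (ns l) k) (fun L hL => ?_) hF
  simp only [LinearMap.sub_apply, LinearMap.id_apply, pC_L]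
  split_ifs with h
  · simp
  · rw [sub_zero]; exact pL_JJ L (by omega)

lemma slice_inj {l n : ℕ} (hl : 0 < l) {F : PS n} (hr : rr l n F = F)
    (hth : ∀ Y : QG n, mT l Y → theta l Y F = 0) (hF : F ∈ JJ l n 1) : F = 0 := by
  have key : ∀ k, F ∈ JJ l n (k + 1) := by
    intro k
    induction k with
    | zero => exact hF
    | succ k ih =>
      have he : eul l n F ∈ JJ l n (k + 1 + 1) := by
        rw [eul, pDer_apply]
        refine Submodule.sum_mem _ fun X _ => ?_
        have hp := pA_JJ X (pD_theta hl hr hth ih _ X rfl)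
        by_cases hX : ns l X = 0
        · simp [hX]
        · have : ns l X = 1 := by unfold ns at *; split_ifs at * <;> simp_all
          rw [this] at hp
          rw [smul_mul_assoc]
          exact Submodule.smul_mem _ _ hp
      have h1 := pC_JJ (Nat.lt_succ_self (k + 1)) he
      rw [pC_eul] at h1
      rcases smul_eq_zero.1 h1 with h2 | h2
      · rw [Nat.cast_eq_zero] at h2; omega
      · have := JJ_succ ih
        rwa [h2, sub_zero] at this
  exact pC_ext (ns l) fun d => pC_JJ (Nat.lt_succ_self d) (key d)

/-! ## Restriction to the slice -/

/-- Generators of `S(g^χ)` indexed by parity. -/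
def sE {m l : ℕ} (b : Bool) (k : Fin l) (p q : Fin m) : SA m l :=
  sgElem (if b then SGen.G k p q else SGen.C k p q)

lemma sE_comm {m l : ℕ} (b b' : Bool) (k k' : Fin l) (p q p' q' : Fin m) :
    sE b k p q * sE b' k' p' q' = sg b b' • (sE b' k' p' q' * sE b k p q) := by
  cases b <;> cases b'
  · have := RingQuot.mkAlgHom_rel ℂ (SRel.cc k k' p q p' q')
    rw [map_sub, map_mul, map_mul, map_zero, sub_eq_zero] at this
    simpa [sE, sgElem] using this
  · have := RingQuot.mkAlgHom_rel ℂ (SRel.cg k k' p q p' q')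
    rw [map_sub, map_mul, map_mul, map_zero, sub_eq_zero] at this
    simpa [sE, sgElem] using this
  · have := RingQuot.mkAlgHom_rel ℂ (SRel.cg k' k p' q' p q)
    rw [map_sub, map_mul, map_mul, map_zero, sub_eq_zero] at this
    simpa [sE, sgElem] using this.symm
  · have := RingQuot.mkAlgHom_rel ℂ (SRel.gg k k' p q p' q')
    rw [map_add, map_mul, map_mul, map_zero] at this
    have := eq_neg_of_add_eq_zero_left this
    rw [sg_tt]
    have e : sE true k p q * sE true k' p' q' = -(sE true k' p' q' * sE true k p q) := by
      simpa [sE, sgElem] using this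
    rw [e]; module

/-- Restriction to the slice. -/
def rho {n l : ℕ} (hl : 0 < l) (h : l ∣ n) : PS n →ₐ[ℂ] SA (n / l) l :=
  pLift (fun X => if X.2.1.val % l = 0 then sE X.1 (ps hl X.2.2) (blk h X.2.1) (blk h X.2.2) else 0)
    (by
      intro x y
      split_ifs
      · exact sE_comm _ _ _ _ _ _ _ _
      all_goals simp)

lemma rho_A {n l : ℕ} (hl : 0 < l) (h : l ∣ n) (X : QG n) : rho hl h (pA X) =
    if X.2.1.val % l = 0 then sE X.1 (ps hl X.2.2) (blk h X.2.1) (blk h X.2.2) else 0 := by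
  rw [rho, pLift_A]

/-- Section of the restriction to the slice. -/
def iot {n l : ℕ} (hl : 0 < l) (h : l ∣ n) : SA (n / l) l →ₐ[ℂ] PS n :=
  RingQuot.liftAlgHom ℂ ⟨FreeAlgebra.lift ℂ fun g => match g with
    | SGen.C k p q => pA (false, bidx h p ⟨0, hl⟩, bidx h q k)
    | SGen.G k p q => pA (true, bidx h p ⟨0, hl⟩, bidx h q k), by
    rintro _ _ (⟨k, k', p, q, p', q'⟩ | ⟨k, k', p, q, p', q'⟩ | ⟨k, k', p, q, p', q'⟩)
    · simp only [map_sub, map_mul, FreeAlgebra.lift_ι_apply, map_zero]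
      rw [pA_comm]; simp
    · simp only [map_sub, map_mul, FreeAlgebra.lift_ι_apply, map_zero]
      rw [pA_comm]; simp
    · simp only [map_add, map_mul, FreeAlgebra.lift_ι_apply, map_zero]
      rw [pA_comm, sg_tt]; module⟩

lemma iot_E {n l : ℕ} (hl : 0 < l) (h : l ∣ n) (b : Bool) (k : Fin l) (p q : Fin (n / l)) :
    iot hl h (sE b k p q) = pA (b, bidx h p ⟨0, hl⟩, bidx h q k) := by
  cases b <;> simp [iot, sE, sgElem]

lemma iot_rho_L {n l : ℕ} (hl : 0 < l) (h : l ∣ n) (L : List (QG n)) :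
    iot hl h (rho hl h (pL L)) = if wt (ns l) L = 0 then pL L else 0 := by
  induction L with
  | nil => simp
  | cons X L ih =>
    rw [pL_cons, map_mul, map_mul, ih, rho_A, wt_cons]
    by_cases hX : X.2.1.val % l = 0
    · have h1 : ns l X = 0 := by simp [ns, hX]
      have h2 : bidx h (blk h X.2.1) ⟨0, hl⟩ = X.2.1 := by
        conv_rhs => rw [← bidx_blk hl h X.2.1]
        congr 1
        exact Fin.ext hX.symm
      rw [if_pos hX, iot_E, h1, zero_add, bidx_blk, h2]
      simp
    · have h1 : ns l X = 1 := by simp [ns, hX]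
      rw [if_neg hX, h1, if_neg (by omega : ¬ (1 + wt (ns l) L = 0))]
      simp

lemma rho_JJ {n l : ℕ} (hl : 0 < l) (h : l ∣ n) (F : PS n) (hF : rho hl h F = 0) :
    F ∈ JJ l n 1 := by
  have key : ∀ F : PS n, F - iot hl h (rho hl h F) ∈ JJ l n 1 := by
    intro F
    have hx := pL_span F
    induction hx using Submodule.span_induction with
    | mem x hx =>
      obtain ⟨L, rfl⟩ := hx
      rw [iot_rho_L]
      split_ifs with h0
      · simp
      · rw [sub_zero]; exact pL_JJ L (by omega)
    | zero => simp
    | add x y _ _ hx hy =>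
      rw [map_add, map_add, add_sub_add_comm]; exact add_mem hx hy
    | smul c x _ hx => rw [map_smul, map_smul, ← smul_sub]; exact Submodule.smul_mem _ _ hx
  have := key F
  rwa [hF, map_zero, sub_zero] at this

lemma rho_rr {n l : ℕ} (hl : 0 < l) (h : l ∣ n) (F : PS n) : rho hl h (rr l n F) = rho hl h F := by
  have : (rho hl h).toLinearMap ∘ₗ (rr l n).toLinearMap = (rho hl h).toLinearMap := by
    refine pS_ext fun L => ?_
    simp only [LinearMap.comp_apply, AlgHom.toLinearMap_apply]
    induction L with
    | nil => simp
    | cons X L ih =>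
      rw [pL_cons]
      simp only [map_mul, ih, rr_A]
      split_ifs with hm
      · have : ¬ X.2.1.val % l = 0 := by unfold mT at hm; omega
        rw [rho_A, if_neg this]; simp
      · rfl
  exact LinearMap.congr_fun this F

lemma rr_rr {n l : ℕ} (F : PS n) : rr l n (rr l n F) = rr l n F := by
  have : (rr l n).toLinearMap ∘ₗ (rr l n).toLinearMap = (rr l n).toLinearMap := by
    refine pS_ext fun L => ?_
    simp only [LinearMap.comp_apply, AlgHom.toLinearMap_apply]
    rw [rr_L]
    split_ifs with hm
    · simp
    · rw [rr_L, if_neg hm]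
  exact LinearMap.congr_fun this F

/-- The symbol map to `S(g^χ)`. -/
def ss {n l : ℕ} (hl : 0 < l) (h : l ∣ n) (d : ℤ) : UQ n →ₗ[ℂ] SA (n / l) l :=
  (rho hl h).toLinearMap ∘ₗ sym l n d

lemma ss_apply {n l : ℕ} (hl : 0 < l) (h : l ∣ n) (d : ℤ) (y : UQ n) :
    ss hl h d y = rho hl h (sym l n d y) := rfl

lemma ss_one {n l : ℕ} (hl : 0 < l) (h : l ∣ n) : ss hl h 0 1 = 1 := by
  rw [ss_apply, sym_one, map_one]

lemma ss_mul {n l : ℕ} (hl : 0 < l) (h : l ∣ n) {d d' : ℤ} {x y : UQ n} (hx : x ∈ KF n l d)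
    (hy : y ∈ KF n l d') : ss hl h (d + d') (x * y) = ss hl h d x * ss hl h d' y := by
  rw [ss_apply, sym_mul hx hy, map_mul]; rfl

lemma ss_low {n l : ℕ} (hl : 0 < l) (h : l ∣ n) {d d' : ℤ} (hd : d < d') {y : UQ n}
    (hy : y ∈ KF n l d) : ss hl h d' y = 0 := by
  rw [ss_apply, sym_low hd hy, map_zero]

lemma ss_Ichi {n l : ℕ} (hl : 0 < l) (h : l ∣ n) {d : ℤ} {y : UQ n} (hy : y ∈ Ichi n l h)
    (hK : y ∈ KF n l d) : ss hl h d y = 0 := by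
  rw [ss_apply, ← rho_rr, rr_sym_Ichi h hy hK, map_zero]

lemma ss_inj {n l : ℕ} (hl : 0 < l) (h : l ∣ n) {σ : UQ n →ₐ[ℂ] UQ n} (hσ : IsPar σ) {d : ℤ}
    {y : UQ n} (hw : WC h σ y) (hK : y ∈ KF n l d) (h0 : ss hl h d y = 0) :
    ∃ z ∈ KF n l (d - 1), y - z ∈ Ichi n l h := by
  refine ker_rr_sym hl h hK (slice_inj hl (rr_rr _) (fun Y hY => WC_theta h hσ hw hK Y hY) ?_)
  exact rho_JJ hl h _ (by rw [rho_rr]; exact h0)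

/-- Symbol of a generator. -/
def rb {n l : ℕ} (hl : 0 < l) (h : l ∣ n) (X : QG n) : SA (n / l) l := rho hl h (pB l X)

lemma rb_slice {n l : ℕ} (hl : 0 < l) (h : l ∣ n) {X : QG n} (hX : X.2.1.val % l = 0) :
    rb hl h X = sE X.1 (ps hl X.2.2) (blk h X.2.1) (blk h X.2.2) := by
  have : chi l X = 0 := by unfold chi; rw [if_neg]; rintro ⟨_, h1, _⟩; omega
  rw [rb, pB, map_add, rho_A, if_pos hX, this]; simp

lemma rb_nonslice {n l : ℕ} (hl : 0 < l) (h : l ∣ n) {X : QG n} (hX : X.2.1.val % l ≠ 0) :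
    rb hl h X = algebraMap ℂ _ (chi l X) := by
  rw [rb, pB, map_add, rho_A, if_neg hX, zero_add, AlgHom.commutes]

lemma ss_ag {n l : ℕ} (hl : 0 < l) (h : l ∣ n) (X : QG n) :
    ss hl h (agDeg l X) (agElem X) = rb hl h X := by
  rw [ss_apply, sym_ag]; rfl

lemma ss_uL {n l : ℕ} (hl : 0 < l) (h : l ∣ n) (L : List (QG n)) :
    ss hl h (wt (agDeg l) L) (uL L) = (L.map (rb hl h)).prod := by
  rw [ss_apply, sym_uL, bL, map_list_prod, List.map_map]; rfl

lemma SGd_mul {m l : ℕ} {d d' : ℤ} {x y : SA m l} (hx : x ∈ SGd m l d) (hy : y ∈ SGd m l d') :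
    x * y ∈ SGd m l (d + d') := by
  unfold SGd at hx
  induction hx using Submodule.span_induction with
  | mem x hx =>
    obtain ⟨L, h1, rfl⟩ := hx
    unfold SGd at hy
    induction hy using Submodule.span_induction with
    | mem y hy =>
      obtain ⟨M, h2, rfl⟩ := hy
      exact Submodule.subset_span ⟨L ++ M, by simp [h1, h2], by simp⟩
    | zero => simp
    | add x y _ _ hx hy => rw [mul_add]; exact add_mem hx hy
    | smul c x _ hx => rw [mul_smul_comm]; exact Submodule.smul_mem _ _ hx
  | zero => simp
  | add x y _ _ hx hy => rw [add_mul]; exact add_mem hx hy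
  | smul c x _ hx => rw [smul_mul_assoc]; exact Submodule.smul_mem _ _ hx

lemma one_SGd {m l : ℕ} : (1 : SA m l) ∈ SGd m l 0 := Submodule.subset_span ⟨[], by simp, by simp⟩

lemma sE_SGd {m l : ℕ} (b : Bool) (k : Fin l) (p q : Fin m) :
    sE b k p q ∈ SGd m l (2 * (k.val : ℤ) + 2) :=
  Submodule.subset_span ⟨[if b then SGen.G k p q else SGen.C k p q], by cases b <;> simp [sgDeg],
    by simp [sE]⟩

lemma rb_SGd {n l : ℕ} (hl : 0 < l) (h : l ∣ n) (X : QG n) :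
    rb hl h X ∈ SGd (n / l) l (agDeg l X) := by
  by_cases hX : X.2.1.val % l = 0
  · rw [rb_slice hl h hX]
    have := sE_SGd X.1 (ps hl X.2.2) (blk h X.2.1) (blk h X.2.2)
    have e : agDeg l X = 2 * ((ps hl X.2.2).val : ℤ) + 2 := by
      simp only [agDeg, hX, ps]; simp
    rwa [e]
  · rw [rb_nonslice hl h hX]
    by_cases hc : chi l X = 0
    · rw [hc, map_zero]; exact zero_mem _
    · rw [chi_deg l X hc, Algebra.algebraMap_eq_smul_one]
      exact Submodule.smul_mem _ _ one_SGd

lemma ss_SGd {n l : ℕ} (hl : 0 < l) (h : l ∣ n) {d : ℤ} {y : UQ n} (hy : y ∈ KF n l d) :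
    ss hl h d y ∈ SGd (n / l) l d := by
  refine KF_induction (P := fun y => ss hl h d y ∈ SGd (n / l) l d) ?_ ?_ ?_ ?_ hy
  · intro L hL
    rcases lt_or_eq_of_le hL with h3 | h3
    · rw [ss_low hl h h3 (uL_mem_KF L le_rfl)]; exact zero_mem _
    · subst h3
      rw [ss_uL]
      clear hL hy
      induction L with
      | nil => simpa using one_SGd
      | cons X L ih =>
        rw [List.map_cons, List.prod_cons, wt_cons]
        exact SGd_mul (rb_SGd hl h X) ih
  · simp
  · intro x y hx hy; rw [map_add]; exact add_mem hx hy
  · intro c x hx; rw [map_smul]; exact Submodule.smul_mem _ _ hx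

lemma rb_par {n l : ℕ} (hl : 0 < l) (h : l ∣ n) (σS : SA (n / l) l →ₐ[ℂ] SA (n / l) l)
    (hS : ∀ b k p q, σS (sE b k p q) = sg true b • sE b k p q) (X : QG n) :
    σS (rb hl h X) = sg true X.1 • rb hl h X := by
  by_cases hX : X.2.1.val % l = 0
  · rw [rb_slice hl h hX, hS]
  · rw [rb_nonslice hl h hX, AlgHom.commutes]
    rcases hb : X.1 with _ | _
    · simp
    · rw [chi_odd l X hb]; simp

lemma ss_par {n l : ℕ} (hl : 0 < l) (h : l ∣ n) {σ : UQ n →ₐ[ℂ] UQ n} (hσ : IsPar σ)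
    (σS : SA (n / l) l →ₐ[ℂ] SA (n / l) l)
    (hS : ∀ b k p q, σS (sE b k p q) = sg true b • sE b k p q) (d : ℤ) {y : UQ n}
    (hy : y ∈ KF n l d) : ss hl h d (σ y) = σS (ss hl h d y) := by
  refine KF_induction (P := fun y => ss hl h d (σ y) = σS (ss hl h d y)) ?_ ?_ ?_ ?_ hy
  · intro L hL
    have key : ∀ L : List (QG n), ∃ c : ℂ, σ (uL L) = c • uL L ∧
        σS ((L.map (rb hl h)).prod) = c • (L.map (rb hl h)).prod := by
      intro L
      induction L with
      | nil => exact ⟨1, by simp⟩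
      | cons X L ih =>
        obtain ⟨c, h1, h2⟩ := ih
        refine ⟨sg true X.1 * c, ?_, ?_⟩
        · rw [uL_cons, map_mul, h1, hσ X, smul_mul_smul_comm]
        · rw [List.map_cons, List.prod_cons, map_mul, h2, rb_par hl h σS hS, smul_mul_smul_comm]
    obtain ⟨c, h1, h2⟩ := key L
    rw [h1, map_smul]
    rcases lt_or_eq_of_le hL with h3 | h3
    · rw [ss_low hl h h3 (uL_mem_KF L le_rfl)]; simp
    · subst h3
      rw [ss_uL, h2]
  · simp
  · intro x y hx hy; simp [hx, hy]
  · intro c x hx; simp [hx]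

/-! ## Sergeev's elements -/

/-- Sergeev's elements indexed by parity. -/
def sU {n : ℕ} (m : ℕ) (X : QG n) : UQ n := if X.1 then fU m X.2.1 X.2.2 else eU m X.2.1 X.2.2

/-- `ε^b`. -/
def ep (m : ℕ) (b : Bool) : ℂ := if b then (-1) ^ m else 1

lemma ep_sq (m : ℕ) (b : Bool) : ep m b * ep m b = 1 := by
  cases b
  · simp [ep]
  · simp only [ep, if_true]; rw [← pow_add, ← two_mul, pow_mul]; simp

lemma ep_xor (m : ℕ) (b c : Bool) : ep m (xor b c) = ep m b * ep m c := by
  cases b <;> cases c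
  · simp [ep]
  · simp [ep]
  · simp [ep]
  · rw [ep_sq]; simp [ep]

lemma ep_succ (m : ℕ) (b : Bool) : ep (m + 1) b = sg b b * ep m b := by
  cases b
  · simp [ep]
  · simp [ep, pow_succ]

lemma sU_zero {n : ℕ} (X : QG n) :
    sU 0 X = if X.1 then 0 else algebraMap ℂ (UQ n) (kd X.2.1 X.2.2) := by
  simp [sU, fU, eU, efU]

lemma sU_succ {n : ℕ} (m : ℕ) (X : QG n) :
    sU (m + 1) X = ∑ a : Bool, ∑ k : Fin n,
      ep m a • (agElem (a, X.2.1, k) * sU m (xor a X.1, k, X.2.2)) := by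
  obtain ⟨b, i, j⟩ := X
  rw [Fintype.sum_bool]
  cases b <;> simp [sU, fU, eU, efU, ep, agElem, Finset.smul_sum, add_comm]

/-- Reindexing sums over parities. -/
lemma sum_xor {V : Type*} [AddCommMonoid V] (b : Bool) (f : Bool → V) :
    ∑ a : Bool, f (xor a b) = ∑ a : Bool, f a := by
  cases b <;> simp [add_comm]

lemma sum_kd_left {n : ℕ} {V : Type*} [AddCommMonoid V] [Module ℂ V] (j : Fin n) (f : Fin n → V) :
    ∑ r, kd j r • f r = f j := by
  simp [kd, ite_smul]

lemma sum_kd_right {n : ℕ} {V : Type*} [AddCommMonoid V] [Module ℂ V] (j : Fin n) (f : Fin n → V) :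
    ∑ r, kd r j • f r = f j := by
  simp [kd, ite_smul]

lemma sU_comm {n : ℕ} (m : ℕ) (Y X : QG n) :
    agElem Y * sU m X - sg Y.1 X.1 • (sU m X * agElem Y) =
      (ep (m + 1) Y.1 * km Y X) • sU m (mulG Y X) - (sg Y.1 X.1 * km X Y) • sU m (mulG X Y) := by
  induction m generalizing X with
  | zero =>
    obtain ⟨b, i, j⟩ := Y
    obtain ⟨c, k, r⟩ := X
    simp only [sU_zero, km, mulG, kd]
    cases b <;> cases c <;> simp [ep]
    all_goals (split_ifs <;> simp_all)
  | succ m ih =>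
    obtain ⟨b, i, j⟩ := Y
    obtain ⟨c, k, r⟩ := X
    have t : ∀ (a : Bool) (s : Fin n),
        agElem (b, i, j) * (ep m a • (agElem (a, k, s) * sU m (xor a c, s, r))) -
          sg b c • ((ep m a • (agElem (a, k, s) * sU m (xor a c, s, r))) * agElem (b, i, j)) =
        kd j k • (ep m a • (agElem (xor b a, i, s) * sU m (xor a c, s, r))) -
        kd s i • ((ep m a * sg b a) • (agElem (xor a b, k, j) * sU m (xor a c, s, r))) +
        kd j s • ((ep m a * sg b a * ep (m + 1) b) •
          (agElem (a, k, s) * sU m (xor b (xor a c), i, r))) -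
        (sg b c * kd r i) • (ep m a • (agElem (a, k, s) * sU m (xor (xor a c) b, s, j))) := by
      intro a s
      have h1 := ag_comm (b, i, j) (a, k, s)
      have h2 := ih (xor a c, s, r)
      simp only [km, mulG] at h1 h2
      have e1 : agElem (b, i, j) * (agElem (a, k, s) * sU m (xor a c, s, r)) -
          sg b c • (agElem (a, k, s) * sU m (xor a c, s, r) * agElem (b, i, j)) =
          (agElem (b, i, j) * agElem (a, k, s) - sg b a • (agElem (a, k, s) * agElem (b, i, j))) *
            sU m (xor a c, s, r) + sg b a • (agElem (a, k, s) *
            (agElem (b, i, j) * sU m (xor a c, s, r) -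
              sg b (xor a c) • (sU m (xor a c, s, r) * agElem (b, i, j)))) := by
        have : sg b c = sg b a * sg b (xor a c) := by
          cases a <;> cases b <;> cases c <;> simp
        rw [this, sub_mul, mul_sub, smul_sub]
        simp only [smul_mul_assoc, mul_smul_comm, mul_assoc, smul_smul]
        abel
      have hs : sg b a * sg b (xor a c) = sg b c := by
        cases a <;> cases b <;> cases c <;> simp
      rw [h1, h2] at e1
      have e3 : ∀ u v : UQ n, ep m a • u - sg b c • (ep m a • v) = ep m a • (u - sg b c • v) := by
        intro u v; module
      rw [mul_smul_comm, smul_mul_assoc, e3, e1, ← hs]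
      simp only [sub_mul, mul_sub, smul_mul_assoc, mul_smul_comm]
      module
    simp only [km, mulG]
    rw [sU_succ, sU_succ, sU_succ]
    simp only [Finset.mul_sum, Finset.sum_mul, Finset.smul_sum, ← Finset.sum_sub_distrib]
    rw [Finset.sum_congr rfl fun a _ => Finset.sum_congr rfl fun s _ => t a s]
    simp only [Finset.sum_add_distrib, Finset.sum_sub_distrib]
    have c2 : ∑ a : Bool, ∑ s : Fin n,
        kd s i • ((ep m a * sg b a) • (agElem (xor a b, k, j) * sU m (xor a c, s, r))) =
        ∑ a : Bool, ∑ s : Fin n, kd j s • ((ep m a * sg b a * ep (m + 1) b) •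
          (agElem (a, k, s) * sU m (xor b (xor a c), i, r))) := by
      simp only [sum_kd_left, sum_kd_right]
      rw [← sum_xor b fun a => (ep m a * sg b a * ep (m + 1) b) •
          (agElem (a, k, j) * sU m (xor b (xor a c), i, r))]
      refine Finset.sum_congr rfl fun a _ => ?_
      have e1 : ep m (xor a b) * sg b (xor a b) * ep (m + 1) b = ep m a * sg b a := by
        rw [ep_xor, ep_succ]
        have := ep_sq m b
        have h2 : sg b (xor a b) * sg b b = sg b a := by cases a <;> cases b <;> simp
        linear_combination (ep m a * sg b (xor a b) * sg b b) * this + ep m a * h2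
      have e2 : xor b (xor (xor a b) c) = xor a c := by cases a <;> cases b <;> cases c <;> rfl
      rw [e1, e2]
    have c1 : ∑ a : Bool, ∑ s : Fin n,
        kd j k • (ep m a • (agElem (xor b a, i, s) * sU m (xor a c, s, r))) =
        ∑ a : Bool, ∑ s : Fin n, (ep (m + 2) b * kd j k) •
          (ep m a • (agElem (a, i, s) * sU m (xor a (xor b c), s, r))) := by
      rw [← sum_xor b fun a => ∑ s : Fin n, (ep (m + 2) b * kd j k) •
          (ep m a • (agElem (a, i, s) * sU m (xor a (xor b c), s, r)))]
      refine Finset.sum_congr rfl fun a _ => Finset.sum_congr rfl fun s _ => ?_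
      have e1 : ep (m + 2) b * ep m (xor a b) = ep m a := by
        rw [ep_xor, ep_succ, ep_succ]
        linear_combination (ep m a * sg b b * sg b b) * ep_sq m b + ep m a * sg_sq b b
      have e2 : xor (xor a b) (xor b c) = xor a c := by cases a <;> cases b <;> cases c <;> rfl
      rw [← e1, e2, Bool.xor_comm b a]
      module
    rw [c2, c1]
    have c3 : ∀ a : Bool, xor (xor a c) b = xor a (xor c b) := fun a => by
      cases a <;> cases b <;> cases c <;> rfl
    simp only [c3]
    abel

/-! ## Surjectivity -/

lemma sU_tw {n : ℕ} {σ : UQ n →ₐ[ℂ] UQ n} (hσ : IsPar σ) (b : Bool) (m : ℕ) (X : QG n) :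
    tw σ b (sU m X) = sg b X.1 • sU m X := by
  induction m generalizing X with
  | zero =>
    rw [sU_zero]
    obtain ⟨c, i, j⟩ := X
    cases c
    · simp only [Bool.false_eq_true, if_false]; rw [AlgHom.commutes, sg_fr, one_smul]
    · simp
  | succ m ih =>
    rw [sU_succ, map_sum, Finset.smul_sum]
    refine Finset.sum_congr rfl fun a _ => ?_
    rw [map_sum, Finset.smul_sum]
    refine Finset.sum_congr rfl fun k _ => ?_
    rw [map_smul, map_mul, tw_ag hσ, ih, smul_mul_smul_comm, smul_comm (sg b X.1)]
    congr 2
    cases a <;> cases b <;> rcases X.1 <;> simp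

lemma sU_WC {n l : ℕ} (h : l ∣ n) {σ : UQ n →ₐ[ℂ] UQ n} (hσ : IsPar σ) (m : ℕ) (X : QG n)
    (hl : 0 < l) (h1 : X.2.1.val % l = l - 1) (h2 : X.2.2.val % l = 0) : WC h σ (sU m X) := by
  intro Y hY
  rw [br_apply, sU_tw hσ, smul_mul_assoc, sU_comm]
  unfold mT at hY
  have hb : Y.2.1.val % l < l := Nat.mod_lt _ hl
  have k1 : km Y X = 0 := by
    unfold km kd; rw [if_neg]; intro h3; rw [h3] at hY; omega
  have k2 : km X Y = 0 := by
    unfold km kd; rw [if_neg]; intro h3; rw [← h3] at hY; omega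
  rw [k1, k2]; simp

lemma sU_KF {n l : ℕ} (m : ℕ) (X : QG n) : sU m X ∈ KF n l (agDeg l X + 2 * m - 2) := by
  induction m generalizing X with
  | zero =>
    rw [sU_zero]
    split_ifs
    · exact zero_mem _
    · unfold kd
      split_ifs with hk
      · rw [map_one]
        apply one_mem_KF
        simp [agDeg, hk]
      · rw [map_zero]; exact zero_mem _
  | succ m ih =>
    rw [sU_succ]
    refine Submodule.sum_mem _ fun a _ => Submodule.sum_mem _ fun k _ => Submodule.smul_mem _ _ ?_
    have := KF_mul (ag_mem_KF (l := l) (a, X.2.1, k) le_rfl) (ih (xor a X.1, k, X.2.2))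
    refine KF_mono ?_ this
    simp only [agDeg]; push_cast; omega

/-- Symbols of Sergeev's elements. -/
def sS {n l : ℕ} (hl : 0 < l) (h : l ∣ n) (m : ℕ) (X : QG n) : SA (n / l) l :=
  ss hl h (agDeg l X + 2 * m - 2) (sU m X)

lemma sS_zero {n l : ℕ} (hl : 0 < l) (h : l ∣ n) (X : QG n) :
    sS hl h 0 X = if X.1 = false ∧ X.2.1 = X.2.2 then 1 else 0 := by
  rw [sS, sU_zero]
  obtain ⟨b, i, j⟩ := X
  cases b
  · by_cases hk : i = j
    · subst hk
      have : agDeg l ((false, i, i) : QG n) + 2 * ((0 : ℕ) : ℤ) - 2 = 0 := by simp [agDeg]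
      rw [this]
      simp [kd, ss_one]
    · simp [kd, hk]
  · simp

lemma sS_succ {n l : ℕ} (hl : 0 < l) (h : l ∣ n) (m : ℕ) (X : QG n) :
    sS hl h (m + 1) X = ∑ a : Bool, ∑ k : Fin n,
      ep m a • (rb hl h (a, X.2.1, k) * sS hl h m (xor a X.1, k, X.2.2)) := by
  rw [sS, sU_succ, map_sum]
  refine Finset.sum_congr rfl fun a _ => ?_
  rw [map_sum]
  refine Finset.sum_congr rfl fun k _ => ?_
  rw [map_smul]
  congr 1
  have e : agDeg l X + 2 * ((m + 1 : ℕ) : ℤ) - 2 = agDeg l ((a, X.2.1, k) : QG n) +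
      (agDeg l ((xor a X.1, k, X.2.2) : QG n) + 2 * m - 2) := by
    simp only [agDeg]; push_cast; ring
  rw [e, ss_mul hl h (ag_mem_KF _ le_rfl) (sU_KF m _), ss_ag]; rfl

lemma sS_row {n l : ℕ} (hl : 0 < l) (h : l ∣ n) (m : ℕ) (b : Bool) (p : Fin (n / l)) (c : ℕ)
    (hc : c + 1 < l) (j : Fin n) :
    sS hl h (m + 1) (b, bidx h p ⟨c + 1, hc⟩, j) =
      sS hl h m (b, bidx h p ⟨c, Nat.lt_of_succ_lt hc⟩, j) := by
  rw [sS_succ]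
  have hr : ∀ (a : Bool) (k : Fin n), rb hl h (a, bidx h p ⟨c + 1, hc⟩, k) =
      if a = false ∧ k = bidx h p ⟨c, Nat.lt_of_succ_lt hc⟩ then 1 else 0 := by
    intro a k
    rw [rb_nonslice hl h (by simp [bidx_mod])]
    unfold chi
    simp only [bidx_mod, bidx_div]
    by_cases hk : a = false ∧ k = bidx h p ⟨c, Nat.lt_of_succ_lt hc⟩
    · rw [if_pos hk, if_pos, map_one]
      rw [hk.2, bidx_mod, bidx_div]
      exact ⟨hk.1, rfl, rfl⟩
    · rw [if_neg hk, if_neg, map_zero]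
      rintro ⟨h1, h2, h3⟩
      refine hk ⟨h1, ?_⟩
      rw [← bidx_blk hl h k]
      congr 1
      · exact Fin.ext h3.symm
      · apply Fin.ext; simp only [ps]; omega
  simp only [hr]
  rw [Fintype.sum_bool]
  simp [ep, ite_and]

lemma sS_high {n l : ℕ} (hl : 0 < l) (h : l ∣ n) (m : ℕ) (b : Bool) (p : Fin (n / l)) (c : ℕ)
    (hc : c < l) (j : Fin n) :
    sS hl h (m + c) (b, bidx h p ⟨c, hc⟩, j) = sS hl h m (b, bidx h p ⟨0, hl⟩, j) := by
  induction c with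
  | zero => rfl
  | succ c ih => rw [← add_assoc, sS_row, ih]

lemma sS_lowz {n l : ℕ} (hl : 0 < l) (h : l ∣ n) (m : ℕ) (b : Bool) (p : Fin (n / l)) (c : ℕ)
    (hc : c < l) (hm : m < c) (j : Fin n) (hj : j.val % l = 0) :
    sS hl h m (b, bidx h p ⟨c, hc⟩, j) = 0 := by
  induction m generalizing c with
  | zero =>
    rw [sS_zero, if_neg]
    rintro ⟨_, h2⟩
    simp only at h2
    rw [← h2, bidx_mod] at hj
    simp only at hj
    omega
  | succ m ih =>
    obtain ⟨c, rfl⟩ : ∃ c', c = c' + 1 := ⟨c - 1, by omega⟩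
    rw [sS_row]
    exact ih c _ (by omega)

/-- Symbols of elements of the W-algebra. -/
def TT {n l : ℕ} (hl : 0 < l) (h : l ∣ n) (σ : UQ n →ₐ[ℂ] UQ n) (d : ℤ) :
    Submodule ℂ (SA (n / l) l) where
  carrier := {x | ∃ y, WC h σ y ∧ y ∈ KF n l d ∧ ss hl h d y = x}
  zero_mem' := ⟨0, fun Y _ => by rw [map_zero]; exact zero_mem _, zero_mem _, map_zero _⟩
  add_mem' := by
    rintro _ _ ⟨x, h1, h2, rfl⟩ ⟨y, h3, h4, rfl⟩
    exact ⟨x + y, fun Y hY => by rw [map_add]; exact add_mem (h1 Y hY) (h3 Y hY),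
      add_mem h2 h4, map_add _ _ _⟩
  smul_mem' := by
    rintro c _ ⟨x, h1, h2, rfl⟩
    exact ⟨c • x, fun Y hY => by
      rw [map_smul]; exact ((Ichi n l h).restrictScalars ℂ).smul_mem c (h1 Y hY),
      Submodule.smul_mem _ _ h2, map_smul _ _ _⟩

lemma Ichi_mul_WC {n l : ℕ} (hl : 0 < l) (h : l ∣ n) {σ : UQ n →ₐ[ℂ] UQ n} {x y : UQ n}
    (hx : x ∈ Ichi n l h) (hy : WC h σ y) : x * y ∈ Ichi n l h := by
  unfold Ichi at hx
  induction hx using Submodule.span_induction with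
  | mem x hx =>
    obtain ⟨X, hX, rfl⟩ := mSet_vv h hx
    have h1 := hy X hX
    have h2 := vv_mem_Ichi hl h X hX
    have e : vv l X * y = br σ X y + tw σ X.1 y * vv l X := by
      rw [br_apply, vv, sub_mul, mul_sub, ← Algebra.commutes]
      rcases hb : X.1 with _ | _
      · simp [tw]
      · rw [chi_odd l X hb]; simp
    rw [e]
    exact add_mem h1 ((Ichi n l h).smul_mem _ h2)
  | zero => rw [zero_mul]; exact zero_mem _
  | add x y _ _ hx hy => rw [add_mul]; exact add_mem hx hy
  | smul u x _ hx => rw [smul_mul_assoc]; exact (Ichi n l h).smul_mem _ hx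

lemma WC_mul {n l : ℕ} (hl : 0 < l) (h : l ∣ n) {σ : UQ n →ₐ[ℂ] UQ n} {x y : UQ n}
    (hx : WC h σ x) (hy : WC h σ y) : WC h σ (x * y) := by
  intro Y hY
  have e : br σ Y (x * y) = br σ Y x * y + tw σ Y.1 x * br σ Y y := by
    rw [br_apply, br_apply, br_apply, map_mul, sub_mul, mul_sub]; simp only [mul_assoc]; abel
  rw [e]
  exact add_mem (Ichi_mul_WC hl h (hx Y hY) hy) ((Ichi n l h).smul_mem _ (hy Y hY))

lemma TT_mul {n l : ℕ} (hl : 0 < l) (h : l ∣ n) {σ : UQ n →ₐ[ℂ] UQ n} {d d' : ℤ}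
    {x y : SA (n / l) l} (hx : x ∈ TT hl h σ d) (hy : y ∈ TT hl h σ d') :
    x * y ∈ TT hl h σ (d + d') := by
  obtain ⟨x, h1, h2, rfl⟩ := hx
  obtain ⟨y, h3, h4, rfl⟩ := hy
  exact ⟨x * y, WC_mul hl h h1 h3, KF_mul h2 h4, ss_mul hl h h2 h4⟩

lemma TT_one {n l : ℕ} (hl : 0 < l) (h : l ∣ n) {σ : UQ n →ₐ[ℂ] UQ n} :
    (1 : SA (n / l) l) ∈ TT hl h σ 0 :=
  ⟨1, (Wcond_iff hl h σ 1).1 (Wcond_one h σ), one_mem_KF n l 0 le_rfl, ss_one hl h⟩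

lemma sS_TT {n l : ℕ} (hl : 0 < l) (h : l ∣ n) {σ : UQ n →ₐ[ℂ] UQ n} (hσ : IsPar σ) (m : ℕ)
    (b : Bool) (p q : Fin (n / l)) :
    sS hl h m (b, bidx h p ⟨0, hl⟩, bidx h q ⟨0, hl⟩) ∈ TT hl h σ (2 * m) := by
  have hc : l - 1 < l := by omega
  rw [← sS_high hl h m b p (l - 1) hc]
  have e : agDeg l ((b, bidx h p ⟨l - 1, hc⟩, bidx h q ⟨0, hl⟩) : QG n) +
      2 * ((m + (l - 1) : ℕ) : ℤ) - 2 = 2 * m := by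
    simp only [agDeg, bidx_mod]; push_cast; ring
  rw [sS, e]
  exact ⟨_, sU_WC h hσ _ _ hl (by simp [bidx_mod]) (by simp [bidx_mod]),
    KF_mono (le_of_eq e) (sU_KF _ _), rfl⟩

lemma sE_TT {n l : ℕ} (hl : 0 < l) (h : l ∣ n) {σ : UQ n →ₐ[ℂ] UQ n} (hσ : IsPar σ) (c : ℕ) :
    ∀ (hc : c < l) (b : Bool) (p q : Fin (n / l)),
      sE b ⟨c, hc⟩ p q ∈ TT hl h σ (2 * c + 2) := by
  induction c using Nat.strong_induction_on with
  | _ c ih =>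
  intro hc b p q
  have hH := sS_TT hl h hσ (c + 1) b p q
  rw [sS_succ, ← Fintype.sum_prod_type',
    ← Finset.add_sum_erase _ _ (Finset.mem_univ (b, bidx h q ⟨c, hc⟩))] at hH
  have e0 : (2 * ((c + 1 : ℕ) : ℤ)) = 2 * c + 2 := by push_cast; ring
  rw [e0] at hH
  have hbl : ∀ (p : Fin (n / l)) (x : Fin l), blk h (bidx h p x) = p := by
    intro p x; apply Fin.ext; simp only [blk]; exact bidx_div h p x
  have hps : ∀ (p : Fin (n / l)) (x : Fin l), ps hl (bidx h p x) = x := by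
    intro p x; apply Fin.ext; simp only [ps]; exact bidx_mod h p x
  have hrb : ∀ (a : Bool) (k : Fin n),
      rb hl h (a, bidx h p ⟨0, hl⟩, k) = sE a (ps hl k) p (blk h k) := by
    intro a k
    rw [rb_slice hl h (by simp [bidx_mod])]
    simp only [hbl]
  have hrest : ∑ x ∈ Finset.univ.erase ((b, bidx h q ⟨c, hc⟩) : Bool × Fin n),
      ep c x.1 • (rb hl h (x.1, bidx h p ⟨0, hl⟩, x.2) *
        sS hl h c (xor x.1 b, x.2, bidx h q ⟨0, hl⟩)) ∈ TT hl h σ (2 * c + 2) := by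
    refine Submodule.sum_mem _ fun x hx => Submodule.smul_mem _ _ ?_
    have hx := Finset.ne_of_mem_erase hx
    obtain ⟨a, k⟩ := x
    simp only
    obtain ⟨r, ⟨t, ht⟩, rfl⟩ : ∃ r t, k = bidx h r t := ⟨_, _, (bidx_blk hl h k).symm⟩
    rw [hrb, hbl, hps]
    rcases lt_trichotomy t c with h1 | h1 | h1
    · obtain ⟨s, rfl⟩ := Nat.exists_eq_add_of_lt h1
      have hs := sS_TT hl h hσ (s + 1) (xor a b) r q
      have e1 : t + s + 1 = (s + 1) + t := by ring
      have e2 : 2 * ((t + s + 1 : ℕ) : ℤ) + 2 = (2 * t + 2) + 2 * ((s + 1 : ℕ) : ℤ) := by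
        push_cast; ring
      rw [e2]
      refine TT_mul hl h (ih t h1 ht a p r) ?_
      rw [e1, sS_high]
      exact hs
    · subst h1
      have := sS_high hl h 0 (xor a b) r t ht (bidx h q ⟨0, hl⟩)
      rw [zero_add] at this
      rw [this, sS_zero, if_neg]
      · rw [mul_zero]; exact zero_mem _
      · rintro ⟨h2, h3⟩
        simp only at h2 h3
        apply hx
        have h4 : r = q := by rw [← hbl r ⟨0, hl⟩, h3, hbl]
        have h5 : a = b := by revert h2; cases a <;> cases b <;> simp
        rw [h4, h5]
    · rw [sS_lowz hl h c _ r t ht h1 _ (by simp [bidx_mod]), mul_zero]; exact zero_mem _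
  have hmain := sub_mem hH hrest
  rw [add_sub_cancel_right] at hmain
  have h6 := sS_high hl h 0 (xor b b) q c hc (bidx h q ⟨0, hl⟩)
  rw [zero_add] at h6
  simp only at hmain
  rw [h6, sS_zero, if_pos ⟨by simp, rfl⟩, mul_one, hrb, hbl, hps] at hmain
  have h7 := Submodule.smul_mem _ (ep c b) hmain
  rwa [smul_smul, ep_sq, one_smul] at h7

lemma SGd_le_TT {n l : ℕ} (hl : 0 < l) (h : l ∣ n) {σ : UQ n →ₐ[ℂ] UQ n} (hσ : IsPar σ) (d : ℤ) :
    SGd (n / l) l d ≤ TT hl h σ d := by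
  refine Submodule.span_le.2 ?_
  rintro _ ⟨L, rfl, rfl⟩
  induction L with
  | nil => simpa using TT_one hl h
  | cons g L ih =>
    simp only [List.map_cons, List.sum_cons, List.prod_cons]
    refine TT_mul hl h ?_ ih
    cases g with
    | C k p q => exact sE_TT hl h hσ k.val k.isLt false p q
    | G k p q => exact sE_TT hl h hσ k.val k.isLt true p q

/-! ## The isomorphism -/

lemma WC_Ichi {n l : ℕ} (hl : 0 < l) (h : l ∣ n) {σ : UQ n →ₐ[ℂ] UQ n} {x : UQ n}
    (hx : x ∈ Ichi n l h) : WC h σ x := by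
  intro Y hY
  have h2 := vv_mem_Ichi hl h Y hY
  have h1 : tw σ Y.1 x * agElem Y ∈ Ichi n l h := by
    have e : tw σ Y.1 x * agElem Y =
        tw σ Y.1 x * vv l Y + algebraMap ℂ (UQ n) (chi l Y) * tw σ Y.1 x := by
      rw [vv, mul_sub, Algebra.commutes]; abel
    rw [e]
    refine add_mem ((Ichi n l h).smul_mem _ h2) ?_
    rcases hb : Y.1 with _ | _
    · have : tw σ false x = x := by simp [tw]
      rw [this]
      exact (Ichi n l h).smul_mem _ hx
    · rw [chi_odd l Y hb, map_zero, zero_mul]; exact zero_mem _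
  rw [br_apply]
  exact sub_mem ((Ichi n l h).smul_mem _ hx) h1

lemma piq_eq {n l : ℕ} {h : l ∣ n} {x y : UQ n} :
    piq n l h x = piq n l h y ↔ x - y ∈ Ichi n l h := by
  unfold piq
  rw [Submodule.mkQ_apply, Submodule.mkQ_apply, Submodule.Quotient.eq]; rfl

/-- Chosen filtered representative. -/
def rep {n l : ℕ} {h : l ∣ n} {σ : UQ n →ₐ[ℂ] UQ n} {d : ℤ} (w : WFsub n l h σ d) : UQ n :=
  Classical.choose w.2.2

lemma rep_KF {n l : ℕ} {h : l ∣ n} {σ : UQ n →ₐ[ℂ] UQ n} {d : ℤ} (w : WFsub n l h σ d) :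
    rep w ∈ KF n l d := (Classical.choose_spec w.2.2).1

lemma rep_piq {n l : ℕ} {h : l ∣ n} {σ : UQ n →ₐ[ℂ] UQ n} {d : ℤ} (w : WFsub n l h σ d) :
    piq n l h (rep w) = w.1 := (Classical.choose_spec w.2.2).2

lemma rep_WC {n l : ℕ} (hl : 0 < l) {h : l ∣ n} {σ : UQ n →ₐ[ℂ] UQ n} {d : ℤ}
    (w : WFsub n l h σ d) : WC h σ (rep w) := by
  obtain ⟨y, hy, e⟩ := w.2.1
  have h1 : rep w - y ∈ Ichi n l h := piq_eq.1 ((rep_piq w).trans e.symm)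
  have h2 := WC_Ichi hl h (σ := σ) h1
  have h3 := (Wcond_iff hl h σ y).1 hy
  intro Y hY
  have := add_mem (h2 Y hY) (h3 Y hY)
  rwa [← map_add, sub_add_cancel] at this

lemma ss_rep {n l : ℕ} (hl : 0 < l) {h : l ∣ n} {σ : UQ n →ₐ[ℂ] UQ n} {d : ℤ}
    (w : WFsub n l h σ d) {y : UQ n} (hy : y ∈ KF n l d) (e : piq n l h y = w.1) :
    ss hl h d (rep w) = ss hl h d y := by
  rw [← sub_eq_zero, ← map_sub]
  exact ss_Ichi hl h (piq_eq.1 ((rep_piq w).trans e.symm)) (sub_mem (rep_KF w) hy)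

/-- The symbol map on a filtered piece of the W-algebra. -/
def psi {n l : ℕ} (hl : 0 < l) (h : l ∣ n) (σ : UQ n →ₐ[ℂ] UQ n) (d : ℤ) :
    WFsub n l h σ d →ₗ[ℂ] SGd (n / l) l d where
  toFun w := ⟨ss hl h d (rep w), ss_SGd hl h (rep_KF w)⟩
  map_add' x y := by
    apply Subtype.ext
    simp only [Submodule.coe_add]
    rw [ss_rep hl (x + y) (add_mem (rep_KF x) (rep_KF y))
      (by rw [map_add, rep_piq, rep_piq]; rfl), map_add]
  map_smul' c x := by
    apply Subtype.ext
    simp only [Submodule.coe_smul, RingHom.id_apply]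
    rw [ss_rep hl (c • x) (Submodule.smul_mem _ c (rep_KF x))
      (by rw [map_smul, rep_piq]; rfl), map_smul]

lemma psi_apply {n l : ℕ} (hl : 0 < l) (h : l ∣ n) (σ : UQ n →ₐ[ℂ] UQ n) (d : ℤ)
    (w : WFsub n l h σ d) : (psi hl h σ d w : SA (n / l) l) = ss hl h d (rep w) := rfl

lemma psi_ker {n l : ℕ} (hl : 0 < l) (h : l ∣ n) {σ : UQ n →ₐ[ℂ] UQ n} (hσ : IsPar σ) (d : ℤ) :
    LinearMap.ker (psi hl h σ d) =
      Submodule.comap (WFsub n l h σ d).subtype (WFsub n l h σ (d - 1)) := by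
  ext w
  rw [LinearMap.mem_ker, Submodule.mem_comap, Submodule.subtype_apply]
  constructor
  · intro hw
    have h0 : ss hl h d (rep w) = 0 := by rw [← psi_apply, hw]; rfl
    obtain ⟨z, hz, h1⟩ := ss_inj hl h hσ (rep_WC hl w) (rep_KF w) h0
    exact Submodule.mem_inf.2 ⟨w.2.1, ⟨z, hz, by rw [← piq_eq.2 h1, rep_piq]⟩⟩
  · intro hw
    obtain ⟨z, hz, h1⟩ := (Submodule.mem_inf.1 hw).2
    apply Subtype.ext
    rw [psi_apply, ss_rep hl w (KF_mono (by omega) hz) h1]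
    exact ss_low hl h (by omega) hz

lemma psi_surj {n l : ℕ} (hl : 0 < l) (h : l ∣ n) {σ : UQ n →ₐ[ℂ] UQ n} (hσ : IsPar σ) (d : ℤ) :
    Function.Surjective (psi hl h σ d) := by
  rintro ⟨x, hx⟩
  obtain ⟨y, hw, hK, rfl⟩ := SGd_le_TT hl h hσ d hx
  refine ⟨⟨piq n l h y, Submodule.mem_inf.2
    ⟨⟨y, (Wcond_iff hl h σ y).2 hw, rfl⟩, ⟨y, hK, rfl⟩⟩⟩, Subtype.ext ?_⟩
  rw [psi_apply, ss_rep hl _ hK rfl]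

lemma ker_eq {V W : Type*} [AddCommGroup V] [AddCommMonoid W] [Module ℂ V] [Module ℂ W]
    (f : V →ₗ[ℂ] W) (K : Submodule ℂ V) (hk : LinearMap.ker f = K) (a b : V) :
    a - b ∈ K ↔ f a = f b := by
  rw [← hk, LinearMap.mem_ker]
  constructor
  · intro h0
    have : f a = f ((a - b) + b) := by rw [sub_add_cancel]
    rw [this, map_add, h0, zero_add]
  · intro h0
    have e1 : a - b = a + (-1 : ℂ) • b := by module
    have e2 : b + (-1 : ℂ) • b = 0 := by module
    rw [e1, map_add, h0, ← map_add, e2, map_zero]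

/-- First isomorphism theorem with prescribed kernel (the map). -/
def quotMap {V W : Type*} [AddCommGroup V] [AddCommMonoid W] [Module ℂ V] [Module ℂ W]
    (f : V →ₗ[ℂ] W) (K : Submodule ℂ V) (hk : LinearMap.ker f = K) : (V ⧸ K) →ₗ[ℂ] W where
  toFun q := f (Quotient.out q)
  map_add' x y := by
    rw [← map_add]
    refine (ker_eq f K hk _ _).1 ((Submodule.Quotient.eq K).1 ?_)
    rw [Submodule.Quotient.mk_add]
    simp only [Submodule.Quotient.mk_out]
  map_smul' c x := by
    rw [RingHom.id_apply, ← map_smul]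
    refine (ker_eq f K hk _ _).1 ((Submodule.Quotient.eq K).1 ?_)
    rw [Submodule.Quotient.mk_smul]
    simp only [Submodule.Quotient.mk_out]

lemma quotMap_mk {V W : Type*} [AddCommGroup V] [AddCommMonoid W] [Module ℂ V] [Module ℂ W]
    (f : V →ₗ[ℂ] W) (K : Submodule ℂ V) (hk : LinearMap.ker f = K) (v : V) :
    quotMap f K hk (Submodule.Quotient.mk v) = f v := by
  refine (ker_eq f K hk _ _).1 ((Submodule.Quotient.eq K).1 ?_)
  simp only [Submodule.Quotient.mk_out]

/-- First isomorphism theorem with prescribed kernel. -/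
def quotIso {V W : Type*} [AddCommGroup V] [AddCommMonoid W] [Module ℂ V] [Module ℂ W]
    (f : V →ₗ[ℂ] W) (K : Submodule ℂ V) (hk : LinearMap.ker f = K)
    (hs : Function.Surjective f) : (V ⧸ K) ≃ₗ[ℂ] W :=
  LinearEquiv.ofBijective (quotMap f K hk) (by
    constructor
    · intro x y hxy
      obtain ⟨x, rfl⟩ := Submodule.Quotient.mk_surjective K x
      obtain ⟨y, rfl⟩ := Submodule.Quotient.mk_surjective K y
      rw [quotMap_mk, quotMap_mk] at hxy
      exact (Submodule.Quotient.eq K).2 ((ker_eq f K hk _ _).2 hxy)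
    · intro w
      obtain ⟨v, rfl⟩ := hs w
      exact ⟨_, quotMap_mk f K hk v⟩)

lemma quotIso_mk {V W : Type*} [AddCommGroup V] [AddCommMonoid W] [Module ℂ V] [Module ℂ W]
    (f : V →ₗ[ℂ] W) (K : Submodule ℂ V) (hk : LinearMap.ker f = K)
    (hs : Function.Surjective f) (v : V) :
    quotIso f K hk hs (Submodule.Quotient.mk v) = f v := quotMap_mk f K hk v

/-- The graded isomorphism. -/
def eiso {n l : ℕ} (hl : 0 < l) (h : l ∣ n) {σ : UQ n →ₐ[ℂ] UQ n} (hσ : IsPar σ) (d : ℤ) :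
    GrW n l h σ d ≃ₗ[ℂ] SGd (n / l) l d :=
  quotIso (psi hl h σ d) _ (psi_ker hl h hσ d) (psi_surj hl h hσ d)

lemma eiso_mk {n l : ℕ} (hl : 0 < l) (h : l ∣ n) {σ : UQ n →ₐ[ℂ] UQ n} (hσ : IsPar σ) (d : ℤ)
    {y : UQ n} (hy : y ∈ KF n l d) (hm : piq n l h y ∈ WFsub n l h σ d) :
    (eiso hl h hσ d (Submodule.Quotient.mk ⟨piq n l h y, hm⟩) : SA (n / l) l) = ss hl h d y := by
  rw [eiso, quotIso_mk, psi_apply]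
  exact ss_rep hl ⟨piq n l h y, hm⟩ hy rfl

/-- Let `l ∣ n` and let `χ` correspond to the even nilpotent element of
`Q(n)` all of whose Jordan blocks have size `l`.  Then the associated graded superalgebra
of the finite W-algebra `W_χ` with respect to the Kazhdan filtration is isomorphic to the
supersymmetric algebra `S(g^χ)` — the tensor product of the polynomial algebra on the
even part of `g^χ` (of dimension `n²/l`) with the exterior algebra on the odd part of
`g^χ` (of dimension `n²/l`):  there is a family of `ℂ`-linear isomorphisms between the
graded pieces, compatible with units, with the products (computed on representatives,
since the product of `W_χ` is `π(y₁)π(y₂) = π(y₁y₂)`) and with the parity involutions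
(`σ` on `U(Q(n))`, `σSG` on `S(g^χ)`). -/
theorem statement8 (n l : ℕ) (hn : 0 < n) (hl : 0 < l) (h : l ∣ n)
    (σ : UQ n →ₐ[ℂ] UQ n)
    (hσe : ∀ i j : Fin n, σ (Ue i j) = Ue i j)
    (hσf : ∀ i j : Fin n, σ (Uf i j) = -Uf i j)
    (σSG : SA (n / l) l →ₐ[ℂ] SA (n / l) l)
    (hσSGc : ∀ (k : Fin l) (p q : Fin (n / l)),
      σSG (sgElem (SGen.C k p q)) = sgElem (SGen.C k p q))
    (hσSGg : ∀ (k : Fin l) (p q : Fin (n / l)),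
      σSG (sgElem (SGen.G k p q)) = -sgElem (SGen.G k p q)) :
    ∃ e : ∀ d : ℤ, GrW n l h σ d ≃ₗ[ℂ] ↥(SGd (n / l) l d),
      -- the isomorphism is unital
      (↑(e 0 (Submodule.Quotient.mk
          ⟨piq n l h 1, Submodule.mem_inf.mpr
            ⟨⟨1, Wcond_one h σ, rfl⟩, ⟨1, one_mem_KF n l 0 le_rfl, rfl⟩⟩⟩))
        : SA (n / l) l) = 1 ∧
      -- the isomorphism is multiplicative
      (∀ (d1 d2 : ℤ) (y1 y2 : UQ n)
          (hw1 : Wcond h σ y1) (hw2 : Wcond h σ y2) (hw12 : Wcond h σ (y1 * y2))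
          (hf1 : y1 ∈ KF n l d1) (hf2 : y2 ∈ KF n l d2)
          (hf12 : y1 * y2 ∈ KF n l (d1 + d2)),
        (↑(e (d1 + d2) (Submodule.Quotient.mk
            ⟨piq n l h (y1 * y2), Submodule.mem_inf.mpr
              ⟨⟨y1 * y2, hw12, rfl⟩, ⟨y1 * y2, hf12, rfl⟩⟩⟩)) : SA (n / l) l) =
          (↑(e d1 (Submodule.Quotient.mk
            ⟨piq n l h y1, Submodule.mem_inf.mpr
              ⟨⟨y1, hw1, rfl⟩, ⟨y1, hf1, rfl⟩⟩⟩)) : SA (n / l) l) *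
          (↑(e d2 (Submodule.Quotient.mk
            ⟨piq n l h y2, Submodule.mem_inf.mpr
              ⟨⟨y2, hw2, rfl⟩, ⟨y2, hf2, rfl⟩⟩⟩)) : SA (n / l) l)) ∧
      -- the isomorphism preserves parity
      (∀ (d : ℤ) (y : UQ n)
          (hw : Wcond h σ y) (hf : y ∈ KF n l d)
          (hw' : Wcond h σ (σ y)) (hf' : σ y ∈ KF n l d),
        (↑(e d (Submodule.Quotient.mk
            ⟨piq n l h (σ y), Submodule.mem_inf.mpr
              ⟨⟨σ y, hw', rfl⟩, ⟨σ y, hf', rfl⟩⟩⟩)) : SA (n / l) l) =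
          σSG (↑(e d (Submodule.Quotient.mk
            ⟨piq n l h y, Submodule.mem_inf.mpr
              ⟨⟨y, hw, rfl⟩, ⟨y, hf, rfl⟩⟩⟩)) : SA (n / l) l)) := by
  have hσ : IsPar σ := by
    rintro ⟨b, i, j⟩
    cases b
    · simpa [agElem] using hσe i j
    · have e := hσf i j
      have e2 : (agElem (true, i, j) : UQ n) = Uf i j := by simp [agElem]
      rw [sg_tt, e2, e]; module
  refine ⟨eiso hl h hσ, ?_, ?_, ?_⟩
  · exact (eiso_mk hl h hσ 0 (one_mem_KF n l 0 le_rfl) _).trans (ss_one hl h)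
  · intro d1 d2 y1 y2 hw1 hw2 hw12 hf1 hf2 hf12
    refine (eiso_mk hl h hσ _ hf12 _).trans ((ss_mul hl h hf1 hf2).trans ?_)
    exact (congrArg₂ (· * ·) (eiso_mk hl h hσ _ hf1 _) (eiso_mk hl h hσ _ hf2 _)).symm
  · intro d y hw hf hw' hf'
    refine (eiso_mk hl h hσ _ hf' _).trans (Eq.trans (ss_par hl h hσ σSG ?_ d hf)
      (congrArg σSG (eiso_mk hl h hσ _ hf _)).symm)
    intro b k p q
    cases b
    · simpa [sE] using hσSGc k p q
    · have e := hσSGg k p q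
      have e2 : (sE true k p q : SA (n / l) l) = sgElem (SGen.G k p q) := by simp [sE]
      rw [sg_tt, e2, e]; module
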